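/- Let f, g ∈ ℚ_p[x₁,…,x_n] be nonzero polynomials such that there is no constant c ∈ ℚ_p with f = c·g, let D = {x ∈ ℚ_p^n : f(x) = 0 or g(x) = 0}, let Φ : ℚ_p^n → ℂ be a test function, and let Ψ be a standard additive character of ℚ_p. Define E_Φ(z) = ∫_{ℚ_p^n ∖ D} Φ(x)·Ψ(z·f(x)/g(x)) dμ(x) for z ∈ ℚ_p. Then there exist a finite set V ⊂ ℚ_p, for each c ∈ V a finite set Γ_c ⊂ {s ∈ ℂ : Re(s) < 0}, positive integers m_γ for γ ∈ Γ_c, locally constant functions e_{γ,m,c} : ℤ_p^× → ℂ, and R > 0, such that for every z ∈ ℚ_p with |z|_p > R: E_Φ(z) = Σ_{c∈V} Ψ(c·z) · Σ_{γ∈Γ_c} Σ_{m=1}^{m_γ} e_{γ,m,c}(ac z) · |z|_p^γ · (ln|z|_p)^{m−1}. -/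

import Mathlib

section

open Filter Topology

set_option linter.unusedSectionVars false

section AnalyticGerms

variable {𝕜 : Type*} [NontriviallyNormedField 𝕜] [CompleteSpace 𝕜]
  {E : Type*} [NormedAddCommGroup E] [NormedSpace 𝕜 E]

theorem AnalyticAt.eventually_eq_zero_of_frequently {f : E → 𝕜} {y : E} (hf : AnalyticAt 𝕜 f y)
    (h : ∃ᶠ z in 𝓝 y, ∀ᶠ x in 𝓝 z, f x = 0) : ∀ᶠ x in 𝓝 y, f x = 0 := by
  obtain ⟨p, r, hp⟩ := hf
  have hr : ∀ᶠ z in 𝓝 y, ‖z - y‖ₑ + ‖z - y‖ₑ < r := by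
    have : ContinuousAt (fun z : E => ‖z - y‖ₑ + ‖z - y‖ₑ) y := by fun_prop
    refine this.eventually (gt_mem_nhds ?_)
    simpa using hp.r_pos
  obtain ⟨z, hz0, hz⟩ := (h.and_eventually hr).exists
  have hzr : ‖z - y‖ₑ < r := lt_of_le_of_lt le_self_add hz
  have hq := hp.changeOrigin hzr
  rw [add_sub_cancel] at hq
  have hrad : ‖z - y‖ₑ < r - ‖z - y‖ₑ := lt_tsub_iff_right.2 hz
  have hball : Metric.eball z (r - ‖z - y‖ₑ) ∈ 𝓝 y := by
    refine Metric.isOpen_eball.mem_nhds ?_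
    rw [Metric.mem_eball, edist_comm, edist_eq_enorm_sub]
    exact hrad
  filter_upwards [hball] with x hx
  have hs := hq.hasSum_sub hx
  have hz' : ∀ n, (p.changeOrigin (z - y) n fun _ => x - z) = 0 := by
    intro n
    have h0 : HasFPowerSeriesAt f (p.changeOrigin (z - y)) z := ⟨_, hq⟩
    exact (h0.congr hz0 : HasFPowerSeriesAt (fun _ => (0 : 𝕜)) _ z).apply_eq_zero n _
  simp only [hz'] at hs
  exact hs.unique hasSum_zero

theorem AnalyticAt.eventually_eq_zero_of_mul {f g : E → 𝕜} {y : E}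
    (hf : AnalyticAt 𝕜 f y) (hg : AnalyticAt 𝕜 g y) (h : ∀ᶠ x in 𝓝 y, f x * g x = 0) :
    (∀ᶠ x in 𝓝 y, f x = 0) ∨ ∀ᶠ x in 𝓝 y, g x = 0 := by
  by_cases h0 : ∀ᶠ x in 𝓝 y, f x = 0
  · exact Or.inl h0
  right
  apply hg.eventually_eq_zero_of_frequently
  have h1 : ∃ᶠ x in 𝓝 y, f x ≠ 0 := not_eventually.1 h0
  refine (h1.and_eventually (h.eventually_nhds.and hf.eventually_analyticAt)).mono ?_
  rintro z ⟨hz, hz1, hz2⟩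
  filter_upwards [hz1, hz2.continuousAt.eventually_ne hz] with x hx hx2
  exact (mul_eq_zero.1 hx).resolve_left hx2

/-- Divided difference of a multilinear map along a rank-one decomposition
`v = π v + ℓ v • e`. -/
noncomputable def quotientSeries (p : FormalMultilinearSeries 𝕜 E 𝕜) (e : E) (π : E →L[𝕜] E) :
    FormalMultilinearSeries 𝕜 E 𝕜 := fun k =>
  ∑ j : Fin (k + 1), ((p (k + 1)).curryMid j e).compContinuousLinearMap
    fun i : Fin k => if (i : ℕ) < j then ContinuousLinearMap.id 𝕜 E else π

theorem quotientSeries_apply (p : FormalMultilinearSeries 𝕜 E 𝕜) (e : E) (ℓ : E →L[𝕜] 𝕜)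
    (π : E →L[𝕜] E) (hπ : ∀ v, π v = v - ℓ v • e) (k : ℕ) (v : E) :
    (p (k + 1) fun _ => v) - (p (k + 1) fun _ => π v)
      = ℓ v * quotientSeries p e π k (fun _ => v) := by
  set w : ℕ → Fin (k + 1) → E := fun j i => if (i : ℕ) < j then v else π v with hw
  have h1 : (p (k + 1) fun _ => v) = p (k + 1) (w (k + 1)) := by
    congr 1; ext i; rw [hw]; simp only [i.is_lt, if_true]
  have h2 : (p (k + 1) fun _ => π v) = p (k + 1) (w 0) := by
    congr 1
  rw [h1, h2, ← Finset.sum_range_sub (fun j => p (k + 1) (w j)), quotientSeries,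
    sum_apply, Finset.mul_sum, ← Fin.sum_univ_eq_sum_range
      (fun j => p (k + 1) (w (j + 1)) - p (k + 1) (w j))]
  refine Finset.sum_congr rfl fun j _ => ?_
  have e1 : w (j + 1) = Function.update (w j) j (π v + ℓ v • e) := by
    ext i
    rcases eq_or_ne i j with rfl | hij
    · simp [hw, hπ]
    · have : ((i : ℕ) < j + 1) ↔ (i : ℕ) < j := by
        have : (i : ℕ) ≠ j := fun h => hij (Fin.ext h)
        omega
      simp [hw, hij, this]
  have e2 : w j = Function.update (w j) j (π v) := by
    rw [eq_comm, Function.update_eq_self_iff]; simp [hw]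
  have e3 : (j.insertNth e fun i : Fin k =>
      (if (i : ℕ) < j then ContinuousLinearMap.id 𝕜 E else π) v) = Function.update (w j) j e := by
    ext i
    refine Fin.succAboveCases j ?_ (fun i => ?_) i
    · simp
    · rw [Fin.insertNth_apply_succAbove, Function.update_of_ne (Fin.succAbove_ne j i)]
      have : ((j.succAbove i : Fin (k + 1)) : ℕ) < j ↔ (i : ℕ) < j := by
        rw [← Fin.lt_def, Fin.succAbove_lt_iff_castSucc_lt]; rfl
      by_cases h : (i : ℕ) < j <;> simp [hw, this, h]
  rw [e1, ContinuousMultilinearMap.map_update_add, ContinuousMultilinearMap.map_update_smul, ← e2]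
  simp only [ContinuousMultilinearMap.compContinuousLinearMap_apply,
    ContinuousMultilinearMap.curryMid_apply, e3]
  simp

theorem quotientSeries_radius_pos {p : FormalMultilinearSeries 𝕜 E 𝕜} (hp : 0 < p.radius) (e : E)
    (π : E →L[𝕜] E) : 0 < (quotientSeries p e π).radius := by
  obtain ⟨C, r, hC, hr, hpr⟩ := p.le_mul_pow_of_radius_pos hp
  set M : ℝ := max 1 ‖π‖ with hM
  have hM1 : 1 ≤ M := le_max_left _ _
  have hM0 : 0 < M := by positivity
  have hb : ∀ k, ‖quotientSeries p e π k‖ ≤ (k + 1) * (C * r ^ (k + 1) * ‖e‖ * M ^ k) := by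
    intro k
    refine (norm_sum_le _ _).trans ?_
    refine (Finset.sum_le_card_nsmul _ _ (C * r ^ (k + 1) * ‖e‖ * M ^ k) fun j _ => ?_).trans
      (by simp)
    refine (ContinuousMultilinearMap.norm_compContinuousLinearMap_le _ _).trans ?_
    have h1 : ‖(p (k + 1)).curryMid j e‖ ≤ C * r ^ (k + 1) * ‖e‖ := by
      refine (ContinuousLinearMap.le_opNorm _ _).trans ?_
      rw [ContinuousMultilinearMap.norm_curryMid]
      gcongr
      exact hpr _
    have h2 : ∏ i : Fin k, ‖if (i : ℕ) < j then ContinuousLinearMap.id 𝕜 E else π‖ ≤ M ^ k := by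
      refine (Finset.prod_le_prod (fun _ _ => norm_nonneg _) (g := fun _ => M)
        fun i _ => ?_).trans (by simp)
      split_ifs
      · exact (ContinuousLinearMap.norm_id_le).trans hM1
      · exact le_max_right _ _
    gcongr
  obtain ⟨ρ, hρ⟩ : ∃ ρ : ℝ, ρ = (2 * r * M)⁻¹ := ⟨_, rfl⟩
  have hρ0 : 0 < ρ := by rw [hρ]; positivity
  refine lt_of_lt_of_le (?_ : (0 : ENNReal) < ENNReal.ofNNReal ⟨ρ, hρ0.le⟩) ?_
  · exact ENNReal.coe_pos.2 hρ0
  refine FormalMultilinearSeries.le_radius_of_bound _ (C * r * ‖e‖) fun k => ?_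
  have h2 : ((k : ℝ) + 1) ≤ 2 ^ k := by
    exact_mod_cast Nat.lt_two_pow_self (n := k)
  change ‖quotientSeries p e π k‖ * ρ ^ k ≤ _
  clear_value M
  calc ‖quotientSeries p e π k‖ * ρ ^ k
      ≤ ((k + 1) * (C * r ^ (k + 1) * ‖e‖ * M ^ k)) * ρ ^ k := by gcongr; exact hb k
    _ ≤ (2 ^ k * (C * r ^ (k + 1) * ‖e‖ * M ^ k)) * ρ ^ k := by gcongr
    _ = C * r * ‖e‖ * (2 * r * M * ρ) ^ k := by ring
    _ = C * r * ‖e‖ := by rw [hρ, mul_inv_cancel₀ (by positivity)]; simp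

theorem AnalyticAt.exists_eventually_eq_add_mul {f : E → 𝕜} {y : E} (hf : AnalyticAt 𝕜 f y)
    (ℓ : E →L[𝕜] 𝕜) (e : E) :
    ∃ g : E → 𝕜, AnalyticAt 𝕜 g y ∧
      ∀ᶠ x in 𝓝 y, f x = f (x - ℓ (x - y) • e) + ℓ (x - y) * g x := by
  obtain ⟨p, r, hp⟩ := hf
  set π : E →L[𝕜] E := ContinuousLinearMap.id 𝕜 E - ℓ.smulRight e with hπ
  have hπ' : ∀ v, π v = v - ℓ v • e := fun v => by simp [hπ]
  set q := quotientSeries p e π with hq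
  have hq0 : 0 < q.radius := quotientSeries_radius_pos (hp.r_pos.trans_le hp.r_le) e π
  have hqs := q.hasFPowerSeriesOnBall hq0
  refine ⟨fun x => q.sum (x - y), ?_, ?_⟩
  · have h := hqs.comp_sub y
    rw [zero_add] at h
    exact h.analyticAt
  have c1 : ∀ᶠ x in 𝓝 y, x ∈ Metric.eball y r := Metric.eball_mem_nhds _ hp.r_pos
  have c2 : ∀ᶠ x in 𝓝 y, x - ℓ (x - y) • e ∈ Metric.eball y r := by
    have : ContinuousAt (fun x => x - ℓ (x - y) • e) y := by fun_prop
    exact this.eventually_mem (by simpa using Metric.eball_mem_nhds _ hp.r_pos)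
  have c3 : ∀ᶠ x in 𝓝 y, x - y ∈ Metric.eball (0 : E) q.radius := by
    have : ContinuousAt (fun x => x - y) y := by fun_prop
    exact this.eventually_mem (by simpa using Metric.eball_mem_nhds _ hq0)
  filter_upwards [c1, c2, c3] with x h1 h2 h3
  have s1 := hp.hasSum_sub h1
  have s2 := hp.hasSum_sub h2
  have s3 := hqs.hasSum h3
  rw [zero_add] at s3
  have s4 := s1.sub s2
  have s5 := (s3.mul_left (ℓ (x - y)))
  have e1 : x - ℓ (x - y) • e - y = π (x - y) := by rw [hπ']; abel
  have s6 := (hasSum_nat_add_iff' 1).2 s4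
  rw [e1] at s6
  simp only [quotientSeries_apply p e ℓ π hπ'] at s6
  have := s6.unique s5
  simp only [Finset.range_one, Finset.sum_singleton] at this
  have e2 : (p 0 fun _ : Fin 0 => x - y) - (p 0 fun _ : Fin 0 => π (x - y)) = 0 := by
    rw [sub_eq_zero]; congr 1; ext i; exact i.elim0
  rw [e2] at this
  linear_combination this

end AnalyticGerms

end

section

open Filter Topology

set_option linter.unusedSectionVars false

section Monomial

variable {𝕜 : Type*} [NontriviallyNormedField 𝕜] [CompleteSpace 𝕜] {m n : ℕ}

/-- Near `y`, the function `g` is an analytic unit times a monomial in the `x i - y i`. -/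
def IsMono (g : (Fin n → 𝕜) → 𝕜) (y : Fin n → 𝕜) : Prop :=
  ∃ (α : Fin n → ℕ) (U : (Fin n → 𝕜) → 𝕜), AnalyticAt 𝕜 U y ∧ U y ≠ 0 ∧
    ∀ᶠ x in 𝓝 y, g x = U x * ∏ i, (x i - y i) ^ α i

/-- Near `y`, the function `g` is either zero or a unit times a monomial. -/
def IsZM (g : (Fin n → 𝕜) → 𝕜) (y : Fin n → 𝕜) : Prop :=
  (∀ᶠ x in 𝓝 y, g x = 0) ∨ IsMono g y

theorem analyticAt_coord (i : Fin n) (y : Fin n → 𝕜) : AnalyticAt 𝕜 (fun x : Fin n → 𝕜 => x i) y :=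
  (ContinuousLinearMap.proj (R := 𝕜) (φ := fun _ : Fin n => 𝕜) i).analyticAt y

theorem analyticAt_monomial (α : Fin n → ℕ) (c y : Fin n → 𝕜) :
    AnalyticAt 𝕜 (fun x : Fin n → 𝕜 => ∏ i, (x i - c i) ^ α i) y := by
  refine Finset.analyticAt_fun_prod _ fun i _ => ?_
  exact ((analyticAt_coord i y).sub analyticAt_const).pow _

theorem IsMono.congr {g h : (Fin n → 𝕜) → 𝕜} {y : Fin n → 𝕜} (hg : IsMono g y)
    (e : ∀ᶠ x in 𝓝 y, h x = g x) : IsMono h y := by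
  obtain ⟨α, U, hU, h0, hU'⟩ := hg
  exact ⟨α, U, hU, h0, by filter_upwards [hU', e] with x h1 h2; rw [h2, h1]⟩

theorem IsZM.congr {g h : (Fin n → 𝕜) → 𝕜} {y : Fin n → 𝕜} (hg : IsZM g y)
    (e : ∀ᶠ x in 𝓝 y, h x = g x) : IsZM h y := by
  refine hg.imp (fun h0 => ?_) fun h1 => h1.congr e
  filter_upwards [h0, e] with x h1 h2
  rw [h2, h1]

theorem IsMono.analyticAt {g : (Fin n → 𝕜) → 𝕜} {y : Fin n → 𝕜} (hg : IsMono g y) :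
    AnalyticAt 𝕜 g y := by
  obtain ⟨α, U, hU, -, hU'⟩ := hg
  refine (hU.mul (analyticAt_monomial α y y)).congr ?_
  filter_upwards [hU'] with x h
  rw [h]; rfl

theorem IsMono.of_ne_zero {g : (Fin n → 𝕜) → 𝕜} {y : Fin n → 𝕜} (hg : AnalyticAt 𝕜 g y)
    (h : g y ≠ 0) : IsMono g y :=
  ⟨0, g, hg, h, by simp⟩

theorem isMono_const {c : 𝕜} (hc : c ≠ 0) (y : Fin n → 𝕜) : IsMono (fun _ => c) y :=
  IsMono.of_ne_zero analyticAt_const hc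

theorem isMono_coord_sub (i : Fin n) (c : 𝕜) (y : Fin n → 𝕜) : IsMono (fun x => x i - c) y := by
  by_cases h : y i = c
  · refine ⟨Pi.single i 1, fun _ => 1, analyticAt_const, one_ne_zero, Eventually.of_forall ?_⟩
    intro x
    rw [Finset.prod_eq_single i]
    · simp [h]
    · intro b _ hb; simp [hb]
    · simp
  · exact IsMono.of_ne_zero ((analyticAt_coord i y).sub analyticAt_const) (sub_ne_zero.2 h)

theorem isMono_coord (i : Fin n) (y : Fin n → 𝕜) : IsMono (fun x => x i) y := by
  simpa using isMono_coord_sub i 0 y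

theorem IsMono.mul {g h : (Fin n → 𝕜) → 𝕜} {y : Fin n → 𝕜} (hg : IsMono g y) (hh : IsMono h y) :
    IsMono (fun x => g x * h x) y := by
  obtain ⟨α, U, hU, U0, hU'⟩ := hg
  obtain ⟨β, V, hV, V0, hV'⟩ := hh
  refine ⟨α + β, fun x => U x * V x, hU.mul hV, mul_ne_zero U0 V0, ?_⟩
  filter_upwards [hU', hV'] with x h1 h2
  rw [h1, h2]
  simp only [Pi.add_apply, pow_add, Finset.prod_mul_distrib]
  ring

theorem IsMono.pow {g : (Fin n → 𝕜) → 𝕜} {y : Fin n → 𝕜} (hg : IsMono g y) (k : ℕ) :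
    IsMono (fun x => g x ^ k) y := by
  induction k with
  | zero => simpa using isMono_const one_ne_zero y
  | succ k ih => simpa only [pow_succ] using ih.mul hg

theorem IsMono.prod {ι : Type*} (s : Finset ι) {g : ι → (Fin n → 𝕜) → 𝕜} {y : Fin n → 𝕜}
    (hg : ∀ i ∈ s, IsMono (g i) y) : IsMono (fun x => ∏ i ∈ s, g i x) y := by
  classical
  induction s using Finset.induction_on with
  | empty => simpa using isMono_const one_ne_zero y
  | insert a s ha ih =>
    simp only [Finset.prod_insert ha]
    exact (hg a (Finset.mem_insert_self a s)).mul
      (ih fun i hi => hg i (Finset.mem_insert_of_mem hi))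

theorem IsMono.comp {g : (Fin n → 𝕜) → 𝕜} {φ : (Fin m → 𝕜) → Fin n → 𝕜} {y : Fin m → 𝕜}
    (hg : IsMono g (φ y)) (hφ : AnalyticAt 𝕜 φ y)
    (h : ∀ i, IsMono (fun x => φ x i - φ y i) y) : IsMono (fun x => g (φ x)) y := by
  obtain ⟨α, U, hU, U0, hU'⟩ := hg
  have := (IsMono.of_ne_zero (hU.comp hφ) U0).mul
    (IsMono.prod Finset.univ fun i _ => (h i).pow (α i))
  exact this.congr (hφ.continuousAt.eventually hU')

theorem IsZM.comp {g : (Fin n → 𝕜) → 𝕜} {φ : (Fin m → 𝕜) → Fin n → 𝕜} {y : Fin m → 𝕜}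
    (hg : IsZM g (φ y)) (hφ : AnalyticAt 𝕜 φ y)
    (h : ∀ i, IsMono (fun x => φ x i - φ y i) y) : IsZM (fun x => g (φ x)) y :=
  hg.imp (fun h0 => hφ.continuousAt.eventually h0) fun h1 => h1.comp hφ h

theorem IsMono.eventually {g : (Fin n → 𝕜) → 𝕜} {y : Fin n → 𝕜} (hg : IsMono g y) :
    ∀ᶠ z in 𝓝 y, IsMono g z := by
  obtain ⟨α, U, hU, U0, hU'⟩ := hg
  filter_upwards [hU'.eventually_nhds, hU.eventually_analyticAt, hU.continuousAt.eventually_ne U0]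
    with z h1 h2 h3
  exact ((IsMono.of_ne_zero h2 h3).mul
    (IsMono.prod Finset.univ fun i _ => (isMono_coord_sub i (y i) z).pow (α i))).congr h1

theorem IsZM.eventually {g : (Fin n → 𝕜) → 𝕜} {y : Fin n → 𝕜} (hg : IsZM g y) :
    ∀ᶠ z in 𝓝 y, IsZM g z := by
  rcases hg with h | h
  · exact h.eventually_nhds.mono fun z hz => Or.inl hz
  · exact h.eventually.mono fun z hz => Or.inr hz

theorem exists_ne_zero_eventually {y : Fin n → 𝕜} {P : (Fin n → 𝕜) → Prop}
    (h : ∀ᶠ x in 𝓝 y, P x) (ε : Fin n → 𝕜) :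
    ∃ s : 𝕜, s ≠ 0 ∧ P (y + s • ε) := by
  have : ContinuousAt (fun s : 𝕜 => y + s • ε) 0 := by fun_prop
  have h1 : ∀ᶠ s in 𝓝 (0 : 𝕜), P (y + s • ε) := this.eventually (by simpa using h)
  obtain ⟨s, hs, hs0⟩ :=
    ((h1.filter_mono nhdsWithin_le_nhds).and (self_mem_nhdsWithin (s := {(0 : 𝕜)}ᶜ))).exists
  exact ⟨s, hs0, hs⟩

theorem IsMono.not_eventually_zero {g : (Fin n → 𝕜) → 𝕜} {y : Fin n → 𝕜} (hg : IsMono g y) :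
    ¬ ∀ᶠ x in 𝓝 y, g x = 0 := by
  intro h
  obtain ⟨α, U, hU, U0, hU'⟩ := hg
  obtain ⟨s, hs, h1, h2, h3⟩ := exists_ne_zero_eventually
    (h.and (hU'.and (hU.continuousAt.eventually_ne U0))) (fun _ => 1)
  rw [h1] at h2
  refine mul_ne_zero h3 ?_ h2.symm
  simp [hs, Finset.prod_eq_zero_iff]

/-- The projection freezing the coordinate `i` at the value `y i`. -/
theorem exists_eventually_eq_update {f : (Fin n → 𝕜) → 𝕜} {y : Fin n → 𝕜} (hf : AnalyticAt 𝕜 f y)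
    (i : Fin n) : ∃ g : (Fin n → 𝕜) → 𝕜, AnalyticAt 𝕜 g y ∧
      ∀ᶠ x in 𝓝 y, f x = f (Function.update x i (y i)) + (x i - y i) * g x := by
  obtain ⟨g, hg, h⟩ := hf.exists_eventually_eq_add_mul
    (ContinuousLinearMap.proj (R := 𝕜) (φ := fun _ : Fin n => 𝕜) i) (Pi.single i 1)
  refine ⟨g, hg, ?_⟩
  filter_upwards [h] with x hx
  rw [hx]
  congr 2
  ext k
  rcases eq_or_ne k i with rfl | hk
  · simp
  · simp [hk]

theorem analyticAt_update (i : Fin n) (c : 𝕜) (y : Fin n → 𝕜) :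
    AnalyticAt 𝕜 (fun x : Fin n → 𝕜 => Function.update x i c) y := by
  refine analyticAt_pi_iff.2 fun k => ?_
  rcases eq_or_ne k i with rfl | hk
  · simpa using analyticAt_const
  · simpa [hk] using analyticAt_coord k y

theorem prod_coord_succ (x y : Fin n → 𝕜) (α : Fin n → ℕ) (i : Fin n) (h : α i ≠ 0) :
    ∏ k, (x k - y k) ^ α k
      = (x i - y i) * ∏ k, (x k - y k) ^ (Function.update α i (α i - 1) k) := by
  rw [← Finset.mul_prod_erase _ _ (Finset.mem_univ i),
    ← Finset.mul_prod_erase Finset.univ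
      (fun k => (x k - y k) ^ (Function.update α i (α i - 1) k)) (Finset.mem_univ i), ← mul_assoc]
  congr 1
  · rw [Function.update_self, ← pow_succ']
    congr 1; omega
  · refine Finset.prod_congr rfl fun k hk => ?_
    rw [Function.update_of_ne (Finset.ne_of_mem_erase hk)]

theorem eventually_eq_of_coord_mul {a b : (Fin n → 𝕜) → 𝕜} {y : Fin n → 𝕜}
    (ha : AnalyticAt 𝕜 a y) (hb : AnalyticAt 𝕜 b y) {c : (Fin n → 𝕜) → 𝕜} (hc : IsMono c y)
    (h : ∀ᶠ x in 𝓝 y, c x * a x = c x * b x) :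
    ∀ᶠ x in 𝓝 y, a x = b x := by
  have h1 : ∀ᶠ x in 𝓝 y, c x * (a x - b x) = 0 := by
    filter_upwards [h] with x hx; linear_combination hx
  rcases hc.analyticAt.eventually_eq_zero_of_mul (ha.sub hb) h1 with h2 | h2
  · exact absurd h2 hc.not_eventually_zero
  · filter_upwards [h2] with x hx; exact sub_eq_zero.1 hx

theorem IsMono.of_mul {a b : (Fin n → 𝕜) → 𝕜} {y : Fin n → 𝕜}
    (ha : AnalyticAt 𝕜 a y) (hb : AnalyticAt 𝕜 b y) (h : IsMono (fun x => a x * b x) y) :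
    IsMono a y ∧ IsMono b y := by
  obtain ⟨α, U, hU, U0, hU'⟩ := h
  obtain ⟨N, hN⟩ : ∃ N, ∑ i, α i = N := ⟨_, rfl⟩
  induction N generalizing α a b with
  | zero =>
    have hα : ∀ i, α i = 0 := by simpa using hN
    have := hU'.self_of_nhds
    simp only [hα, pow_zero, Finset.prod_const_one, mul_one] at this
    rw [← this] at U0
    exact ⟨IsMono.of_ne_zero ha (left_ne_zero_of_mul U0),
      IsMono.of_ne_zero hb (right_ne_zero_of_mul U0)⟩
  | succ N ih =>
    obtain ⟨i, hi⟩ : ∃ i, α i ≠ 0 := by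
      by_contra! h
      simp [h] at hN
    have hN' : ∑ k, Function.update α i (α i - 1) k = N := by
      have e1 := Finset.add_sum_erase _ α (Finset.mem_univ i)
      have e2 := Finset.add_sum_erase _ (Function.update α i (α i - 1)) (Finset.mem_univ i)
      have e3 : ∑ k ∈ Finset.univ.erase i, Function.update α i (α i - 1) k
          = ∑ k ∈ Finset.univ.erase i, α k := by
        refine Finset.sum_congr rfl fun k hk => ?_
        rw [Function.update_of_ne (Finset.ne_of_mem_erase hk)]
      rw [e3, Function.update_self] at e2
      omega
    have key : ∀ a b : (Fin n → 𝕜) → 𝕜, AnalyticAt 𝕜 a y → AnalyticAt 𝕜 b y →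
        (∀ᶠ x in 𝓝 y, a x * b x = U x * ∏ i, (x i - y i) ^ α i) →
        (∀ᶠ x in 𝓝 y, a (Function.update x i (y i)) = 0) → IsMono a y ∧ IsMono b y := by
      intro a b ha hb hab h0
      obtain ⟨a1, ha1, hd⟩ := exists_eventually_eq_update ha i
      have e : ∀ᶠ x in 𝓝 y, a1 x * b x
          = U x * ∏ k, (x k - y k) ^ (Function.update α i (α i - 1) k) := by
        refine eventually_eq_of_coord_mul (ha1.mul hb) (hU.mul (analyticAt_monomial _ y y))
          (isMono_coord_sub i (y i) y) ?_
        filter_upwards [h0, hd, hab] with x h1 h2 h3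
        rw [prod_coord_succ x y α i hi, h2, h1] at h3
        linear_combination h3
      obtain ⟨r1, r2⟩ := ih ha1 hb _ e hN'
      refine ⟨((isMono_coord_sub i (y i) y).mul r1).congr ?_, r2⟩
      filter_upwards [h0, hd] with x h1 h2
      rw [h2, h1, zero_add]
    have hπ := analyticAt_update i (y i) y
    have hπy : Function.update y i (y i) = y := by simp
    have ha' : AnalyticAt 𝕜 (fun x => a (Function.update x i (y i))) y :=
      AnalyticAt.comp (by rwa [hπy]) hπ
    have hb' : AnalyticAt 𝕜 (fun x => b (Function.update x i (y i))) y :=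
      AnalyticAt.comp (by rwa [hπy]) hπ
    have h0 : ∀ᶠ x in 𝓝 y, a (Function.update x i (y i)) * b (Function.update x i (y i)) = 0 := by
      have := hπ.continuousAt.eventually (p := fun x => a x * b x = U x * ∏ i, (x i - y i) ^ α i)
        (by simpa using hU')
      filter_upwards [this] with x hx
      rw [hx, Finset.prod_eq_zero (Finset.mem_univ i), mul_zero]
      simp [hi]
    rcases ha'.eventually_eq_zero_of_mul hb' h0 with h1 | h1
    · exact key a b ha hb hU' h1
    · refine (key b a hb ha ?_ h1).symm
      filter_upwards [hU'] with x hx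
      rw [← hx, mul_comm]

theorem exponents_le_or_le {y : Fin n → 𝕜} {α β : Fin n → ℕ} {U V : (Fin n → 𝕜) → 𝕜}
    (hU : AnalyticAt 𝕜 U y) (hV : AnalyticAt 𝕜 V y) (U0 : U y ≠ 0) (V0 : V y ≠ 0)
    (h : IsZM (fun x => U x * ∏ i, (x i - y i) ^ α i - V x * ∏ i, (x i - y i) ^ β i) y) :
    α ≤ β ∨ β ≤ α := by
  by_contra! hc
  obtain ⟨hc1, hc2⟩ := hc
  obtain ⟨i, hi⟩ : ∃ i, β i < α i := by simpa [Pi.le_def] using hc1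
  obtain ⟨j, hj⟩ : ∃ j, α j < β j := by simpa [Pi.le_def] using hc2
  set α' : Fin n → ℕ := fun k => α k - min (α k) (β k) with hα
  set β' : Fin n → ℕ := fun k => β k - min (α k) (β k) with hβ
  set μ : (Fin n → 𝕜) → 𝕜 := fun x => ∏ k, (x k - y k) ^ min (α k) (β k) with hμ
  have hμM : IsMono μ y := IsMono.prod _ fun k _ => (isMono_coord_sub k (y k) y).pow _
  set q : (Fin n → 𝕜) → 𝕜 :=
    fun x => U x * ∏ i, (x i - y i) ^ α' i - V x * ∏ i, (x i - y i) ^ β' i with hq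
  have hqA : AnalyticAt 𝕜 q y :=
    (hU.mul (analyticAt_monomial α' y y)).sub (hV.mul (analyticAt_monomial β' y y))
  have e : (fun x => U x * ∏ i, (x i - y i) ^ α i - V x * ∏ i, (x i - y i) ^ β i)
      = fun x => μ x * q x := by
    ext x
    simp only [hμ, hq]
    have e1 : ∏ i, (x i - y i) ^ α i
        = (∏ k, (x k - y k) ^ min (α k) (β k)) * ∏ i, (x i - y i) ^ α' i := by
      rw [← Finset.prod_mul_distrib]
      refine Finset.prod_congr rfl fun k _ => ?_
      rw [← pow_add]; congr 1; simp only [hα]; omega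
    have e2 : ∏ i, (x i - y i) ^ β i
        = (∏ k, (x k - y k) ^ min (α k) (β k)) * ∏ i, (x i - y i) ^ β' i := by
      rw [← Finset.prod_mul_distrib]
      refine Finset.prod_congr rfl fun k _ => ?_
      rw [← pow_add]; congr 1; simp only [hβ]; omega
    rw [e1, e2]; ring
  have hdisj : ∀ k, α' k = 0 ∨ β' k = 0 := by
    intro k; simp only [hα, hβ]; omega
  have hi' : α' i ≠ 0 := by simp only [hα]; omega
  have hj' : β' j ≠ 0 := by simp only [hβ]; omega
  rw [e] at h
  -- a point where all coordinates but `k` and `l` are moved off the centre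
  have pt : ∀ (S : Finset (Fin n)) (P : (Fin n → 𝕜) → Prop), (∀ᶠ x in 𝓝 y, P x) →
      ∃ x, P x ∧ U x ≠ 0 ∧ V x ≠ 0 ∧ ∀ k, (x k - y k = 0 ↔ k ∈ S) := by
    intro S P hP
    classical
    obtain ⟨s, hs, h1, h2, h3⟩ := exists_ne_zero_eventually
      (hP.and ((hU.continuousAt.eventually_ne U0).and (hV.continuousAt.eventually_ne V0)))
      (fun k => if k ∈ S then 0 else 1)
    refine ⟨_, h1, h2, h3, fun k => ?_⟩
    by_cases hk : k ∈ S <;> simp [hk, hs]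
  have van : ∀ (γ : Fin n → ℕ) (S : Finset (Fin n)) (x : Fin n → 𝕜),
      (∀ k, (x k - y k = 0 ↔ k ∈ S)) → ((∏ k, (x k - y k) ^ γ k = 0) ↔ ∃ k ∈ S, γ k ≠ 0) := by
    intro γ S x hx
    rw [Finset.prod_eq_zero_iff]
    refine ⟨fun ⟨k, _, hk⟩ => ⟨k, ?_, ?_⟩, fun ⟨k, hk1, hk2⟩ => ⟨k, Finset.mem_univ _, ?_⟩⟩
    · exact (hx k).1 (eq_zero_of_pow_eq_zero hk)
    · rintro h0; simp [h0] at hk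
    · rw [(hx k).2 hk1]; simp [hk2]
  have noc : ∀ S : Finset (Fin n), (∀ᶠ x in 𝓝 y, (∀ k, (x k - y k = 0 ↔ k ∈ S)) → q x = 0) →
      ((∃ k ∈ S, α' k ≠ 0) ↔ ∃ k ∈ S, β' k ≠ 0) := by
    intro S hS
    obtain ⟨x, h1, h2, h3, h4⟩ := pt S _ hS
    have h5 := h1 h4
    rw [← van α' S x h4, ← van β' S x h4]
    simp only [hq] at h5
    constructor
    · intro h; rw [h] at h5; simpa [h3] using h5
    · intro h; rw [h] at h5; simpa [h2] using h5
  rcases h with h | h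
  · have hq0 : ∀ᶠ x in 𝓝 y, q x = 0 :=
      eventually_eq_of_coord_mul hqA analyticAt_const hμM (by simpa using h)
    obtain ⟨k, hk, hk'⟩ := (noc {i} (hq0.mono fun x hx _ => hx)).1 ⟨i, by simp, hi'⟩
    rw [Finset.mem_singleton] at hk
    subst hk
    exact (hdisj k).elim hi' hk'
  · obtain ⟨γ, W, hW, W0, hW'⟩ := (IsMono.of_mul hμM.analyticAt hqA h).2
    by_cases hγ : ∀ l, γ l = 0
    · have h1 := hW'.self_of_nhds
      simp only [hγ, pow_zero, Finset.prod_const_one, mul_one, hq] at h1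
      rw [Finset.prod_eq_zero (Finset.mem_univ i) (by simp [hi']),
        Finset.prod_eq_zero (Finset.mem_univ j) (by simp [hj'])] at h1
      exact W0 (by simpa using h1.symm)
    · push Not at hγ
      obtain ⟨l, hl⟩ := hγ
      have hz : ∀ S : Finset (Fin n), l ∈ S →
          (∀ᶠ x in 𝓝 y, (∀ k, (x k - y k = 0 ↔ k ∈ S)) → q x = 0) := by
        intro S hS
        filter_upwards [hW'] with x hx h1
        rw [hx, Finset.prod_eq_zero (Finset.mem_univ l) (by rw [(h1 l).2 hS]; simp [hl]), mul_zero]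
      by_cases hb : β' l = 0
      · obtain ⟨k, hk, hk'⟩ := (noc {l, i} (hz _ (by simp))).1 ⟨i, by simp, hi'⟩
        simp only [Finset.mem_insert, Finset.mem_singleton] at hk
        rcases hk with rfl | rfl
        · exact hk' hb
        · exact (hdisj k).elim hi' hk'
      · obtain ⟨k, hk, hk'⟩ := (noc {l, j} (hz _ (by simp))).2 ⟨j, by simp, hj'⟩
        simp only [Finset.mem_insert, Finset.mem_singleton] at hk
        rcases hk with rfl | rfl
        · exact (hdisj k).elim hk' hb
        · exact (hdisj k).elim hk' hj'

end Monomial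

end

section

open Filter Topology

set_option linter.unusedSectionVars false

section FirstCoordinate

variable {𝕜 : Type*} [NontriviallyNormedField 𝕜] [CompleteSpace 𝕜] {n : ℕ}

theorem iteratedDeriv_of_expansion [CharZero 𝕜] {φ u : 𝕜 → 𝕜} {d : ℕ} {c : ℕ → 𝕜}
    (hu : AnalyticAt 𝕜 u 0)
    (h : ∀ᶠ s in 𝓝 0, φ s = ∑ i ∈ Finset.range d, c i * s ^ i + s ^ d * u s) (i : ℕ) (hi : i < d) :
    iteratedDeriv i φ 0 = (i.factorial : 𝕜) * c i := by
  have e : φ =ᶠ[𝓝 0] fun s => (∑ i ∈ Finset.range d, c i * s ^ i) + s ^ d * u s := h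
  have hA : AnalyticAt 𝕜 (fun s : 𝕜 => s ^ d * u s) 0 := (analyticAt_id.pow d).mul hu
  have hS : AnalyticAt 𝕜 (fun s : 𝕜 => ∑ i ∈ Finset.range d, c i * s ^ i) 0 := by fun_prop
  rw [e.iteratedDeriv_eq, iteratedDeriv_fun_add hS.contDiffAt hA.contDiffAt]
  have h0 : iteratedDeriv i (fun s : 𝕜 => s ^ d * u s) 0 = 0 := by
    refine (natCast_le_analyticOrderAt_iff_iteratedDeriv_eq_zero hA (n := d)).1 ?_ i hi
    rw [natCast_le_analyticOrderAt hA]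
    exact ⟨u, hu, by simp⟩
  rw [h0, add_zero, iteratedDeriv_fun_sum]
  · simp only [iteratedDeriv_const_mul_field, iteratedDeriv_fun_pow_zero]
    rw [Finset.sum_eq_single i]
    · simp [mul_comm]
    · intro b _ hb
      simp [hb.symm]
    · intro h; exact absurd (Finset.mem_range.2 hi) h
  · intro j _
    exact AnalyticAt.contDiffAt (by fun_prop)

theorem iteratedDeriv_of_expansion_self [CharZero 𝕜] {φ u : 𝕜 → 𝕜} {d : ℕ} {c : ℕ → 𝕜}
    (hu : AnalyticAt 𝕜 u 0)
    (h : ∀ᶠ s in 𝓝 0, φ s = ∑ i ∈ Finset.range d, c i * s ^ i + s ^ d * u s) :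
    iteratedDeriv d φ 0 = (d.factorial : 𝕜) * u 0 := by
  have hA : AnalyticAt 𝕜 (fun s => u s - u 0) 0 := hu.sub analyticAt_const
  have h1 : (1 : ℕ) ≤ analyticOrderAt (fun s => u s - u 0) 0 := by
    rw [Nat.cast_one, Order.one_le_iff_ne_zero, hA.analyticOrderAt_ne_zero]; simp
  obtain ⟨v, hv, hv'⟩ := (natCast_le_analyticOrderAt hA).1 h1
  have := iteratedDeriv_of_expansion (φ := φ) (d := d + 1) (c := fun i => if i < d then c i else u 0)
    hv ?_ d (Nat.lt_succ_self d)
  · simpa using this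
  · filter_upwards [h, hv'] with s h1 h2
    rw [h1, Finset.sum_range_succ]
    simp only [lt_irrefl, if_false]
    have e2 : ∑ i ∈ Finset.range d, (if i < d then c i else u 0) * s ^ i
        = ∑ i ∈ Finset.range d, c i * s ^ i :=
      Finset.sum_congr rfl fun i hi => by rw [if_pos (Finset.mem_range.1 hi)]
    rw [e2]
    simp only [sub_zero, pow_one, smul_eq_mul] at h2
    linear_combination s ^ d * h2

theorem exists_direction {F : (Fin (n + 1) → 𝕜) → 𝕜} {a : Fin (n + 1) → 𝕜}
    (hF : AnalyticAt 𝕜 F a) (h : ¬ ∀ᶠ x in 𝓝 a, F x = 0) :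
    ∃ v : Fin (n + 1) → 𝕜, v 0 = 1 ∧ ¬ ∀ᶠ s in 𝓝 (0 : 𝕜), F (a + s • v) = 0 := by
  obtain ⟨p, r, hp⟩ := hF
  obtain ⟨x, ⟨hx0, hxr⟩⟩ : ∃ x, F x ≠ 0 ∧ x ∈ Metric.eball a r :=
    ((not_eventually.1 h).and_eventually (Metric.eball_mem_nhds a hp.r_pos)).exists
  have hcont : ContinuousAt F x := hp.continuousOn.continuousAt (Metric.isOpen_eball.mem_nhds hxr)
  obtain ⟨x, hx0, hxr, hx1⟩ : ∃ x, F x ≠ 0 ∧ x ∈ Metric.eball a r ∧ x 0 ≠ a 0 := by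
    by_cases hxa : x 0 = a 0
    · obtain ⟨s, hs, h1, h2⟩ := exists_ne_zero_eventually
        ((hcont.eventually_ne hx0).and (Metric.isOpen_eball.mem_nhds hxr)) (Pi.single 0 1)
      exact ⟨_, h1, h2, by simp [hxa, hs]⟩
    · exact ⟨x, hx0, hxr, hxa⟩
  set d := x 0 - a 0 with hd
  have hd0 : d ≠ 0 := sub_ne_zero.2 hx1
  refine ⟨d⁻¹ • (x - a), by simp [← hd, hd0], fun hv => hx0 ?_⟩
  have hs := hp.hasSum_sub hxr
  have hz : ∀ k, p k (fun _ => x - a) = 0 := by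
    intro k
    set L : 𝕜 →L[𝕜] (Fin (n + 1) → 𝕜) := (ContinuousLinearMap.id 𝕜 𝕜).smulRight (x - a) with hL
    have h1 : HasFPowerSeriesAt (fun y => F (a + y)) p 0 := by
      refine ⟨r, ?_⟩
      have := hp.comp_sub (-a)
      simpa [sub_neg_eq_add, add_comm] using this
    have h2 : HasFPowerSeriesAt ((fun y => F (a + y)) ∘ L) (p.compContinuousLinearMap L) 0 :=
      HasFPowerSeriesAt.compContinuousLinearMap (by simpa using h1)
    have h3 : (fun y => F (a + y)) ∘ L =ᶠ[𝓝 0] fun _ => 0 := by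
      have : ContinuousAt (fun s : 𝕜 => s * d) 0 := by fun_prop
      have := this.eventually (p := fun s => F (a + s • d⁻¹ • (x - a)) = 0) (by simpa using hv)
      filter_upwards [this] with s hs
      simp only [Function.comp, hL]
      rw [smul_smul, mul_assoc, mul_inv_cancel₀ hd0, mul_one] at hs
      simpa using hs
    have := (h2.congr h3).apply_eq_zero k 1
    rw [FormalMultilinearSeries.compContinuousLinearMap_apply] at this
    convert this using 2
    ext1 i
    simp [hL]
  simp only [hz] at hs
  exact hs.unique hasSum_zero

/-- Partial derivative in the zeroth coordinate. -/
noncomputable def dzero (F : (Fin (n + 1) → 𝕜) → 𝕜) (w : Fin (n + 1) → 𝕜) : 𝕜 :=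
  deriv (fun s : 𝕜 => F (w + s • Pi.single 0 1)) 0

theorem dzero_iterate (F : (Fin (n + 1) → 𝕜) → 𝕜) (w : Fin (n + 1) → 𝕜) (i : ℕ) (s : 𝕜) :
    (dzero^[i] F) (w + s • Pi.single 0 1)
      = iteratedDeriv i (fun s : 𝕜 => F (w + s • Pi.single 0 1)) s := by
  induction i generalizing s with
  | zero => simp
  | succ i ih =>
    rw [Function.iterate_succ_apply', dzero, iteratedDeriv_succ]
    have : (fun t : 𝕜 => (dzero^[i] F) (w + s • Pi.single 0 1 + t • Pi.single 0 1))
        = fun t => iteratedDeriv i (fun s : 𝕜 => F (w + s • Pi.single 0 1)) (s + t) := by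
      ext t
      rw [← ih, add_smul, add_assoc]
    rw [this, deriv_comp_const_add, add_zero]

theorem dzero_iterate_zero (F : (Fin (n + 1) → 𝕜) → 𝕜) (w : Fin (n + 1) → 𝕜) (i : ℕ) :
    (dzero^[i] F) w = iteratedDeriv i (fun s : 𝕜 => F (w + s • Pi.single 0 1)) 0 := by
  rw [← dzero_iterate]; simp

theorem dzero_iterate_comp {m : ℕ} (F : (Fin (n + 1) → 𝕜) → 𝕜)
    (Θ : (Fin (m + 1) → 𝕜) → Fin (n + 1) → 𝕜)
    (h : ∀ w (s : 𝕜), Θ (w + s • Pi.single 0 1) = Θ w + s • Pi.single 0 1) (i : ℕ)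
    (w : Fin (m + 1) → 𝕜) :
    (dzero^[i] fun x => F (Θ x)) w = (dzero^[i] F) (Θ w) := by
  simp only [dzero_iterate_zero, h]

theorem analyticAt_dzero {F : (Fin (n + 1) → 𝕜) → 𝕜} {w : Fin (n + 1) → 𝕜}
    (hF : AnalyticAt 𝕜 F w) : AnalyticAt 𝕜 (dzero F) w := by
  have h1 : AnalyticAt 𝕜 (fun x => fderiv 𝕜 F x (Pi.single 0 1)) w :=
    ((ContinuousLinearMap.apply 𝕜 𝕜 (Pi.single 0 1 : Fin (n + 1) → 𝕜)).analyticAt _).comp hF.fderiv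
  refine h1.congr ?_
  filter_upwards [hF.eventually_analyticAt] with x hx
  have h2 : HasFDerivAt F (fderiv 𝕜 F x) (x + (0 : 𝕜) • Pi.single 0 1) := by
    simpa using hx.differentiableAt.hasFDerivAt
  have h3 : HasDerivAt (fun s : 𝕜 => x + s • (Pi.single 0 1 : Fin (n + 1) → 𝕜)) (Pi.single 0 1) 0 := by
    simpa using ((hasDerivAt_id (0 : 𝕜)).smul_const (Pi.single 0 1 : Fin (n + 1) → 𝕜)).const_add x
  exact (h2.comp_hasDerivAt 0 h3).deriv.symm

theorem analyticAt_dzero_iterate {F : (Fin (n + 1) → 𝕜) → 𝕜} {w : Fin (n + 1) → 𝕜}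
    (hF : AnalyticAt 𝕜 F w) (i : ℕ) : AnalyticAt 𝕜 (dzero^[i] F) w := by
  induction i with
  | zero => exact hF
  | succ i ih => rw [Function.iterate_succ_apply']; exact analyticAt_dzero ih

theorem exists_dzero_ne_zero [CharZero 𝕜] {F : (Fin (n + 1) → 𝕜) → 𝕜} {w : Fin (n + 1) → 𝕜}
    (hF : AnalyticAt 𝕜 F w) (h : ¬ ∀ᶠ s in 𝓝 (0 : 𝕜), F (w + s • Pi.single 0 1) = 0) :
    ∃ i, (dzero^[i] F) w ≠ 0 := by
  have hl : AnalyticAt 𝕜 (fun s : 𝕜 => F (w + s • Pi.single 0 1)) 0 := by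
    refine AnalyticAt.comp (by simpa using hF) ?_
    fun_prop
  have : analyticOrderAt (fun s : 𝕜 => F (w + s • Pi.single 0 1)) 0 ≠ ⊤ := by
    rwa [Ne, analyticOrderAt_eq_top]
  obtain ⟨i, hi⟩ := ENat.ne_top_iff_exists.1 this
  refine ⟨i, ?_⟩
  rw [dzero_iterate_zero]
  exact ((analyticOrderAt_eq_nat_iff_iteratedDeriv_eq_zero hl).1 hi.symm).2

theorem analyticAt_tail (w : Fin (n + 1) → 𝕜) :
    AnalyticAt 𝕜 (fun x : Fin (n + 1) → 𝕜 => Fin.tail x) w :=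
  analyticAt_pi_iff.2 fun k => analyticAt_coord k.succ w

theorem analyticAt_cons_const (c : 𝕜) (x : Fin n → 𝕜) :
    AnalyticAt 𝕜 (fun x : Fin n → 𝕜 => (Fin.cons c x : Fin (n + 1) → 𝕜)) x := by
  refine analyticAt_pi_iff.2 fun k => ?_
  refine Fin.cases ?_ (fun k => ?_) k
  · simpa using analyticAt_const
  · simpa using analyticAt_coord k x

theorem update_zero_eq_cons (w : Fin (n + 1) → 𝕜) (c : 𝕜) :
    Function.update w 0 c = Fin.cons c (Fin.tail w) := by
  ext k
  refine Fin.cases ?_ (fun k => ?_) k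
  · simp
  · simp [Fin.tail]

theorem cons_add_smul (t s : 𝕜) (x : Fin n → 𝕜) :
    (Fin.cons t x : Fin (n + 1) → 𝕜) + s • Pi.single 0 1 = Fin.cons (t + s) x := by
  ext k
  refine Fin.cases ?_ (fun k => ?_) k <;> simp

theorem exists_taylor {F : (Fin (n + 1) → 𝕜) → 𝕜} {w : Fin (n + 1) → 𝕜} (hw : w 0 = 0)
    (hF : AnalyticAt 𝕜 F w) (d : ℕ) :
    ∃ (A : ℕ → (Fin n → 𝕜) → 𝕜) (U : (Fin (n + 1) → 𝕜) → 𝕜),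
      (∀ i, AnalyticAt 𝕜 (A i) (Fin.tail w)) ∧ AnalyticAt 𝕜 U w ∧
      ∀ᶠ x in 𝓝 w, F x = ∑ i ∈ Finset.range d, A i (Fin.tail x) * x 0 ^ i + x 0 ^ d * U x := by
  induction d with
  | zero => exact ⟨fun _ _ => 0, F, fun _ => analyticAt_const, hF, by simp⟩
  | succ d ih =>
    obtain ⟨A, U, hA, hU, h⟩ := ih
    obtain ⟨V, hV, hV'⟩ := exists_eventually_eq_update hU 0
    have hB : AnalyticAt 𝕜 (fun x : Fin n → 𝕜 => U (Fin.cons 0 x)) (Fin.tail w) := by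
      refine AnalyticAt.comp ?_ (analyticAt_cons_const 0 _)
      rw [← hw]
      exact (Fin.cons_self_tail w).symm ▸ hU
    refine ⟨fun i => if i < d then A i else fun x => U (Fin.cons 0 x), V, fun i => ?_, hV, ?_⟩
    · by_cases hi : i < d <;> simp only [hi, if_true, if_false]
      · exact hA i
      · exact hB
    · filter_upwards [h, hV'] with x h1 h2
      rw [h1, Finset.sum_range_succ, h2, hw, update_zero_eq_cons]
      simp only [lt_irrefl, if_false]
      have e2 : ∑ i ∈ Finset.range d,
          (if i < d then A i else fun x => U (Fin.cons 0 x)) (Fin.tail x) * x 0 ^ i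
          = ∑ i ∈ Finset.range d, A i (Fin.tail x) * x 0 ^ i :=
        Finset.sum_congr rfl fun i hi => by rw [if_pos (Finset.mem_range.1 hi)]
      rw [e2]
      ring

theorem dzero_of_expansion [CharZero 𝕜] {F U : (Fin (n + 1) → 𝕜) → 𝕜}
    {A : ℕ → (Fin n → 𝕜) → 𝕜} {x : Fin n → 𝕜} {d : ℕ}
    (hU : AnalyticAt 𝕜 U (Fin.cons 0 x))
    (h : ∀ᶠ x in 𝓝 (Fin.cons 0 x : Fin (n + 1) → 𝕜),
      F x = ∑ i ∈ Finset.range d, A i (Fin.tail x) * x 0 ^ i + x 0 ^ d * U x) :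
    (∀ i < d, (dzero^[i] F) (Fin.cons 0 x) = (i.factorial : 𝕜) * A i x) ∧
    (dzero^[d] F) (Fin.cons 0 x) = (d.factorial : 𝕜) * U (Fin.cons 0 x) := by
  set L : 𝕜 → Fin (n + 1) → 𝕜 := fun s => Fin.cons 0 x + s • Pi.single 0 1 with hL
  have hL0 : L 0 = Fin.cons 0 x := by simp [hL]
  have hLA : AnalyticAt 𝕜 L 0 := by simp only [hL]; fun_prop
  have hu : AnalyticAt 𝕜 (fun s => U (L s)) 0 := AnalyticAt.comp (by rwa [hL0]) hLA
  have hLs : ∀ s, L s = Fin.cons s x := fun s => by simp [hL, cons_add_smul]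
  have h1 : ∀ᶠ s in 𝓝 0, F (L s)
      = ∑ i ∈ Finset.range d, A i x * s ^ i + s ^ d * U (L s) := by
    filter_upwards [hLA.continuousAt.eventually (by rwa [hL0])] with s hs
    rw [hs, hLs]; simp
  constructor
  · intro i hi
    rw [dzero_iterate_zero]
    exact iteratedDeriv_of_expansion hu h1 i hi
  · rw [dzero_iterate_zero]
    have := iteratedDeriv_of_expansion_self hu h1
    rwa [hL0] at this

theorem eventually_ne_zero_of_dzero [CharZero 𝕜] {G : (Fin (n + 1) → 𝕜) → 𝕜}
    {w : Fin (n + 1) → 𝕜} (hw : w 0 = 0) (hG : AnalyticAt 𝕜 G w) (h0 : dzero G w ≠ 0)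
    (hz : ∀ᶠ x in 𝓝 (Fin.tail w), G (Fin.cons 0 x) = 0) :
    ∀ᶠ x in 𝓝 w, x 0 ≠ 0 → G x ≠ 0 := by
  obtain ⟨A, U, hA, hU, h⟩ := exists_taylor hw hG 1
  have hwc : w = Fin.cons 0 (Fin.tail w) := by rw [← hw]; exact (Fin.cons_self_tail w).symm
  have hd := (dzero_of_expansion (F := G) (U := U) (A := A) (x := Fin.tail w) (d := 1)
    (by rwa [← hwc]) (by rwa [← hwc])).2
  rw [← hwc] at hd
  have hU0 : U w ≠ 0 := by
    intro h1; rw [h1] at hd; exact h0 (by simpa using hd)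
  have hA0 : ∀ᶠ x in 𝓝 w, A 0 (Fin.tail x) = 0 := by
    have c : ContinuousAt (fun x : Fin n → 𝕜 => (Fin.cons 0 x : Fin (n + 1) → 𝕜)) (Fin.tail w) :=
      (analyticAt_cons_const 0 _).continuousAt
    have h2 := c.eventually (show ∀ᶠ x in 𝓝 (Fin.cons 0 (Fin.tail w) : Fin (n + 1) → 𝕜),
      G x = ∑ i ∈ Finset.range 1, A i (Fin.tail x) * x 0 ^ i + x 0 ^ 1 * U x by
        rw [← hwc]; exact h)
    have h3 : ∀ᶠ x in 𝓝 (Fin.tail w), A 0 x = 0 := by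
      filter_upwards [h2, hz] with x h4 h5
      rw [h5] at h4; simpa using h4.symm
    exact (analyticAt_tail w).continuousAt.eventually h3
  filter_upwards [h, hA0, hU.continuousAt.eventually_ne hU0] with x h1 h2 h3 hx
  rw [h1]
  simp [h2, hx, h3]

theorem exists_implicit {A : (Fin (n + 1) → 𝕜) → 𝕜} {w : Fin (n + 1) → 𝕜}
    (hA : AnalyticAt 𝕜 A w) (h0 : A w = 0) (h1 : dzero A w ≠ 0) :
    ∃ b : (Fin n → 𝕜) → 𝕜, AnalyticAt 𝕜 b (Fin.tail w) ∧ b (Fin.tail w) = w 0 ∧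
      ∀ᶠ x in 𝓝 (Fin.tail w), A (Fin.cons (b x) x) = 0 := by
  set H : (Fin (n + 1) → 𝕜) → Fin (n + 1) → 𝕜 := fun x => Fin.cons (A x) (Fin.tail x) with hH
  have hHA : AnalyticAt 𝕜 H w := by
    refine analyticAt_pi_iff.2 fun k => ?_
    refine Fin.cases ?_ (fun k => ?_) k
    · simpa [hH] using hA
    · simpa [hH, Fin.tail] using analyticAt_coord k.succ w
  set L : (Fin (n + 1) → 𝕜) →L[𝕜] Fin (n + 1) → 𝕜 := fderiv 𝕜 H w with hLd
  have hLk : ∀ v (k : Fin (n + 1)), L v k = fderiv 𝕜 (fun x => H x k) w v := by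
    intro v k
    have := (hasFDerivAt_pi'.1 hHA.differentiableAt.hasFDerivAt k).fderiv
    rw [this]
    rfl
  have hLs : ∀ v (k : Fin n), L v k.succ = v k.succ := by
    intro v k
    rw [hLk]
    have : (fun x => H x k.succ)
        = (ContinuousLinearMap.proj (R := 𝕜) (φ := fun _ : Fin (n + 1) => 𝕜) k.succ) := by
      ext x; simp [hH, Fin.tail]
    rw [this, ContinuousLinearMap.fderiv]
    rfl
  have hL0 : ∀ v, L v 0 = fderiv 𝕜 A w v := by
    intro v; rw [hLk]; simp [hH]
  have he : fderiv 𝕜 A w (Pi.single 0 1) = dzero A w := by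
    have h2 : HasFDerivAt A (fderiv 𝕜 A w) (w + (0 : 𝕜) • Pi.single 0 1) := by
      simpa using hA.differentiableAt.hasFDerivAt
    have h3 : HasDerivAt (fun s : 𝕜 => w + s • (Pi.single 0 1 : Fin (n + 1) → 𝕜))
        (Pi.single 0 1) 0 := by
      simpa using ((hasDerivAt_id (0 : 𝕜)).smul_const (Pi.single 0 1 : Fin (n + 1) → 𝕜)).const_add w
    exact (h2.comp_hasDerivAt 0 h3).deriv.symm
  have hinj : Function.Injective (L : (Fin (n + 1) → 𝕜) →ₗ[𝕜] Fin (n + 1) → 𝕜) := by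
    rw [injective_iff_map_eq_zero]
    intro v hv
    have hv' : ∀ k, L v k = 0 := fun k => congrFun hv k
    have ht : v = v 0 • Pi.single 0 1 := by
      ext k
      refine Fin.cases ?_ (fun k => ?_) k
      · simp
      · have := hv' k.succ
        rw [hLs] at this
        simp [this]
    have h2 := hv' 0
    rw [hL0, ht, map_smul, he, smul_eq_mul] at h2
    have h3 : v 0 = 0 := (mul_eq_zero.1 (by simpa using h2)).resolve_right h1
    rw [ht, h3, zero_smul]
  set e := (LinearEquiv.ofInjectiveEndo _ hinj).toContinuousLinearEquiv with hedef
  have heL : (e : (Fin (n + 1) → 𝕜) →L[𝕜] Fin (n + 1) → 𝕜) = L := by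
    ext1 v; rfl
  have hstrict : HasStrictFDerivAt H (e : (Fin (n + 1) → 𝕜) →L[𝕜] Fin (n + 1) → 𝕜) w := by
    rw [heL]; exact hHA.hasStrictFDerivAt
  set Q := hstrict.toOpenPartialHomeomorph H with hQ
  have hQc : (Q : (Fin (n + 1) → 𝕜) → Fin (n + 1) → 𝕜) = H := rfl
  have hsA : AnalyticAt 𝕜 Q.symm (H w) := by
    have := Q.analyticAt_symm' (i := e) hstrict.mem_toOpenPartialHomeomorph_source
      (by rw [hQc]; exact hHA) (by rw [hQc, heL])
    rwa [hQc] at this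
  have hw : H w = Fin.cons 0 (Fin.tail w) := by simp [hH, h0]
  have hsym : Q.symm (H w) = w := Q.left_inv hstrict.mem_toOpenPartialHomeomorph_source
  have hcA := analyticAt_cons_const (𝕜 := 𝕜) 0 (Fin.tail w)
  have hsc : AnalyticAt 𝕜 (fun x : Fin n → 𝕜 => Q.symm (Fin.cons 0 x)) (Fin.tail w) :=
    AnalyticAt.comp (by rwa [← hw]) hcA
  refine ⟨fun x => Q.symm (Fin.cons 0 x) 0, analyticAt_pi_iff.1 hsc 0, ?_, ?_⟩
  · change Q.symm (Fin.cons 0 (Fin.tail w)) 0 = w 0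
    rw [← hw, hsym]
  have hright := Q.eventually_right_inverse (x := H w) (Q.map_source
    hstrict.mem_toOpenPartialHomeomorph_source)
  filter_upwards [hcA.continuousAt.eventually
    (show ∀ᶠ y in 𝓝 (Fin.cons 0 (Fin.tail w) : Fin (n + 1) → 𝕜), Q (Q.symm y) = y by
      rw [← hw]; exact hright)] with x hx
  rw [hQc] at hx
  have ht : Fin.tail (Q.symm (Fin.cons 0 x)) = x := by
    have := congrArg Fin.tail hx
    simpa [hH] using this
  have hA' : A (Q.symm (Fin.cons 0 x)) = 0 := by
    have := congrFun hx 0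
    simpa [hH] using this
  have : (Fin.cons (Q.symm (Fin.cons 0 x) 0) x : Fin (n + 1) → 𝕜) = Q.symm (Fin.cons 0 x) := by
    have h2 := Fin.cons_self_tail (Q.symm (Fin.cons 0 x) : Fin (n + 1) → 𝕜)
    rwa [ht] at h2
  rw [this, hA']

end FirstCoordinate

end

section

open Filter Topology MeasureTheory
open scoped ENNReal NNReal Pointwise

set_option linter.unusedSectionVars false

section PadicMeasure

variable {p : ℕ} [Fact p.Prime]

theorem closedBall_eq_iUnion_residues :
    Metric.closedBall (0 : ℚ_[p]) 1
      = ⋃ i ∈ Finset.range p, (fun x : ℚ_[p] => (i : ℚ_[p]) + x) ''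
        Metric.closedBall (0 : ℚ_[p]) (p : ℝ)⁻¹ := by
  have hp1 : 1 < (p : ℝ) := by exact_mod_cast (Fact.out : p.Prime).one_lt
  ext x
  simp only [Finset.mem_range, Set.mem_iUnion, Set.mem_image, mem_closedBall_zero_iff, exists_prop]
  constructor
  · intro hx
    obtain ⟨X, rfl⟩ : ∃ X : ℤ_[p], (X : ℚ_[p]) = x := ⟨⟨x, hx⟩, rfl⟩
    obtain ⟨i, hi, h⟩ := PadicInt.exists_mem_range X
    refine ⟨i, hi, X - i, ?_, by ring⟩
    have h1 : ‖X - (i : ℤ_[p])‖ < 1 := by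
      rw [← PadicInt.mem_nonunits]; exact h
    have h2 : ‖(X : ℚ_[p]) - (i : ℚ_[p])‖ < 1 := by
      rw [PadicInt.norm_def, PadicInt.coe_sub, PadicInt.coe_natCast] at h1; exact h1
    have := (Padic.norm_le_pow_iff_norm_lt_pow_add_one ((X : ℚ_[p]) - (i : ℚ_[p])) (-1)).2
      (by rwa [neg_add_cancel, zpow_zero])
    rwa [zpow_neg_one] at this
  · rintro ⟨i, hi, y, hy, rfl⟩
    refine (Padic.nonarchimedean _ _).trans (max_le ?_ (hy.trans (inv_le_one_of_one_le₀ hp1.le)))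
    exact_mod_cast Padic.norm_int_le_one (p := p) i

theorem smul_closedBall_padic (a : ℚ_[p]ˣ) (r : ℝ) :
    a • Metric.closedBall (0 : ℚ_[p]) r = Metric.closedBall 0 (‖(a : ℚ_[p])‖ * r) := by
  ext x
  have ha : 0 < ‖(a : ℚ_[p])‖ := norm_pos_iff.2 a.ne_zero
  rw [Set.mem_smul_set_iff_inv_smul_mem]
  simp only [mem_closedBall_zero_iff, Units.smul_def, smul_eq_mul, norm_mul, Units.val_inv_eq_inv_val,
    norm_inv]
  rw [inv_mul_le_iff₀ ha]

variable [MeasureSpace ℚ_[p]] [BorelSpace ℚ_[p]] [(volume : Measure ℚ_[p]).IsAddHaarMeasure]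

theorem volume_closedBall_one_ne_zero : volume (Metric.closedBall (0 : ℚ_[p]) 1) ≠ 0 :=
  (Metric.measure_closedBall_pos _ _ one_pos).ne'

theorem distribHaarChar_padic (a : ℚ_[p]ˣ) : distribHaarChar ℚ_[p] a = ‖(a : ℚ_[p])‖₊ := by
  have hp0 : 0 < p := (Fact.out : p.Prime).pos
  have hpp : (p : ℚ_[p]) ≠ 0 := by exact_mod_cast hp0.ne'
  have hfin : volume (Metric.closedBall (0 : ℚ_[p]) 1) ≠ ⊤ := measure_closedBall_lt_top.ne
  set π : ℚ_[p]ˣ := Units.mk0 p hpp with hπ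
  have h1 : ∀ u : ℚ_[p]ˣ, ‖(u : ℚ_[p])‖ = 1 → distribHaarChar ℚ_[p] u = 1 := by
    intro u hu
    refine distribHaarChar_eq_of_measure_smul_eq_mul (μ := volume) volume_closedBall_one_ne_zero hfin ?_
    rw [smul_closedBall_padic, hu]; simp
  have h2 : distribHaarChar ℚ_[p] π = (p : ℝ≥0)⁻¹ := by
    refine distribHaarChar_eq_of_measure_smul_eq_mul (μ := volume) volume_closedBall_one_ne_zero hfin ?_
    rw [smul_closedBall_padic]
    have hn : ‖(π : ℚ_[p])‖ * 1 = (p : ℝ)⁻¹ := by simp [hπ]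
    rw [hn]
    conv_rhs => rw [closedBall_eq_iUnion_residues]
    rw [measure_biUnion_finset]
    · simp only [Set.image_add_left, measure_preimage_add, Finset.sum_const, Finset.card_range,
        nsmul_eq_mul]
      rw [← mul_assoc, ENNReal.coe_inv (by exact_mod_cast hp0.ne'), ENNReal.coe_natCast,
        ENNReal.inv_mul_cancel (by exact_mod_cast hp0.ne') (by simp), one_mul]
    · intro i hi j hj hij
      simp only [Function.onFun, Set.disjoint_left, Set.mem_image, mem_closedBall_zero_iff]
      rintro x ⟨y, hy, rfl⟩ ⟨z, hz, h⟩
      have h3 : ((i - j : ℤ) : ℚ_[p]) = z - y := by push_cast; linear_combination -h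
      have h4 : ‖((i - j : ℤ) : ℚ_[p])‖ < 1 := by
        rw [h3, sub_eq_add_neg]
        refine (Padic.nonarchimedean _ _).trans_lt ?_
        have : (p : ℝ)⁻¹ < 1 := inv_lt_one_of_one_lt₀ (by exact_mod_cast (Fact.out : p.Prime).one_lt)
        exact max_lt (hz.trans_lt this) (by rw [norm_neg]; exact hy.trans_lt this)
      rw [Padic.norm_intCast_lt_one_iff] at h4
      simp only [Finset.coe_range, Set.mem_Iio] at hi hj
      have := Int.eq_zero_of_abs_lt_dvd h4 (by rw [abs_lt]; omega)
      omega
    · intro i _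
      rw [Set.image_add_left]
      exact (continuous_const.add continuous_id).measurable Metric.isClosed_closedBall.measurableSet
  set k := (a : ℚ_[p]).valuation with hk
  have ha : a = π ^ k * (π ^ (-k) * a) := by
    rw [← mul_assoc, ← zpow_add, add_neg_cancel, zpow_zero, one_mul]
  have hn := Padic.norm_eq_zpow_neg_valuation a.ne_zero
  have hu : ‖((π ^ (-k) * a : ℚ_[p]ˣ) : ℚ_[p])‖ = 1 := by
    simp only [Units.val_mul, Units.val_zpow_eq_zpow_val, hπ, Units.val_mk0, norm_mul, norm_zpow,
      Padic.norm_p]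
    rw [hn, inv_zpow', ← zpow_add₀ (by exact_mod_cast hp0.ne'), ← hk]
    simp
  rw [ha, map_mul, map_zpow, h1 _ hu, h2, ← ha, mul_one]
  ext
  simp only [NNReal.coe_zpow, NNReal.coe_natCast, coe_nnnorm, hn, inv_zpow']
  rfl

theorem volume_smul_padic (a : ℚ_[p]ˣ) (s : Set ℚ_[p]) : volume (a • s) = ‖(a : ℚ_[p])‖ₑ * volume s := by
  rw [← distribHaarChar_mul volume, distribHaarChar_padic]; rfl

theorem volume_preimage_mul {a : ℚ_[p]} (ha : a ≠ 0) (s : Set ℚ_[p]) :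
    ‖a‖ₑ * volume ((fun y => a * y) ⁻¹' s) = volume s := by
  have : (fun y => a * y) ⁻¹' s = (Units.mk0 a ha)⁻¹ • s := by
    ext x; rw [Set.mem_inv_smul_set_iff]; rfl
  rw [this, volume_smul_padic, ← mul_assoc, Units.val_inv_eq_inv_val, Units.val_mk0, enorm_inv ha,
    ENNReal.mul_inv_cancel (by simpa using ha) (by simp), one_mul]

end PadicMeasure

end

section

open Filter Topology MeasureTheory
open scoped ENNReal NNReal

set_option linter.unusedSectionVars false

section Charts

theorem clopen_induction {X : Type*} [TopologicalSpace X] [T2Space X] [LocallyCompactSpace X]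
    [TotallyDisconnectedSpace X] {B : Set X} (hB : IsCompact B) (hBo : IsOpen B) {q : Set X → Prop}
    (h0 : q ∅)
    (hu : ∀ A C, A ⊆ B → C ⊆ B → IsCompact A → IsOpen A → IsCompact C → IsOpen C → Disjoint A C →
      q A → q C → q (A ∪ C))
    (hl : ∀ a ∈ B, ∃ N ∈ 𝓝 a, ∀ A, A ⊆ N → A ⊆ B → IsCompact A → IsOpen A → q A) : q B := by
  have key : ∃ U, IsClopen U ∧ B ⊆ U ∧ ∀ A, A ⊆ U → A ⊆ B → IsCompact A → IsOpen A → q A := by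
    refine hB.induction_on
      (p := fun S => ∃ U, IsClopen U ∧ S ⊆ U ∧ ∀ A, A ⊆ U → A ⊆ B → IsCompact A → IsOpen A → q A)
      ?_ ?_ ?_ ?_
    · exact ⟨∅, isClopen_empty, subset_rfl, fun A hA _ _ _ => by rwa [Set.subset_empty_iff.1 hA]⟩
    · rintro s t hst ⟨U, hU, htU, h⟩
      exact ⟨U, hU, hst.trans htU, h⟩
    · rintro s t ⟨U, hU, hsU, h⟩ ⟨V, hV, htV, h'⟩
      refine ⟨U ∪ V, hU.union hV, Set.union_subset_union hsU htV, fun A hA hAB hAc hAo => ?_⟩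
      rw [← Set.inter_union_sdiff A U]
      have c1 : IsCompact (A ∩ U) := hAc.inter_right hU.1
      have c2 : IsCompact (A \ U) := hAc.diff hU.2
      have o1 : IsOpen (A ∩ U) := hAo.inter hU.2
      have o2 : IsOpen (A \ U) := hAo.sdiff hU.1
      have s1 : A ∩ U ⊆ B := Set.inter_subset_left.trans hAB
      have s2 : A \ U ⊆ B := Set.sdiff_subset.trans hAB
      refine hu _ _ s1 s2 c1 o1 c2 o2 (Set.disjoint_sdiff_right.mono_left Set.inter_subset_right)
        (h _ Set.inter_subset_right s1 c1 o1) (h' _ ?_ s2 c2 o2)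
      rintro x ⟨hx, hxU⟩
      exact (hA hx).resolve_left hxU
    · intro a ha
      obtain ⟨N, hN, h⟩ := hl a ha
      obtain ⟨U, hU, haU, hUN⟩ := (loc_compact_Haus_tot_disc_of_zero_dim (H := X)).mem_nhds_iff.1 hN
      exact ⟨U, mem_nhdsWithin_of_mem_nhds (hU.2.mem_nhds haU), U, hU, subset_rfl,
        fun A hA => h A (hA.trans hUN)⟩
  obtain ⟨U, _, hBU, h⟩ := key
  exact h B hBU subset_rfl hB hBo

variable {p : ℕ} [Fact p.Prime] {n : ℕ}

instance : TotallyDisconnectedSpace ℚ_[p] := inferInstance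

variable [MeasureSpace ℚ_[p]] [BorelSpace ℚ_[p]] [(volume : Measure ℚ_[p]).IsAddHaarMeasure]

/-- Finite combinations of pushforwards of Haar measure with Jacobian densities, along charts
satisfying a given predicate. -/
inductive ChartRep (P : ((Fin n → ℚ_[p]) → Fin n → ℚ_[p]) → ((Fin n → ℚ_[p]) → ℚ_[p]) →
    (Fin n → ℚ_[p]) → Prop) : Measure (Fin n → ℚ_[p]) → Prop
  | zero : ChartRep P 0
  | add {ν₁ ν₂ : Measure (Fin n → ℚ_[p])} : ChartRep P ν₁ → ChartRep P ν₂ → ChartRep P (ν₁ + ν₂)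
  | smul {ν : Measure (Fin n → ℚ_[p])} (c : ℝ≥0∞) (hc : c ≠ ⊤) : ChartRep P ν → ChartRep P (c • ν)
  | leaf (B : Set (Fin n → ℚ_[p])) (φ : (Fin n → ℚ_[p]) → Fin n → ℚ_[p])
      (j : (Fin n → ℚ_[p]) → ℚ_[p]) (hB : IsCompact B) (hBo : IsOpen B) (hφ : Continuous φ)
      (hj : Continuous j) (h : ∀ y ∈ B, P φ j y) :
      ChartRep P (((volume.restrict B).withDensity fun y => ‖j y‖ₑ).map φ)

/-- Predicates on charts seen through a preliminary chart `φ₀` with Jacobian `j₀`. -/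
def chartPull (φ₀ : (Fin n → ℚ_[p]) → Fin n → ℚ_[p]) (j₀ : (Fin n → ℚ_[p]) → ℚ_[p])
    (P : ((Fin n → ℚ_[p]) → Fin n → ℚ_[p]) → ((Fin n → ℚ_[p]) → ℚ_[p]) →
      (Fin n → ℚ_[p]) → Prop) (φ : (Fin n → ℚ_[p]) → Fin n → ℚ_[p])
    (j : (Fin n → ℚ_[p]) → ℚ_[p]) (y : Fin n → ℚ_[p]) : Prop :=
  P (fun x => φ₀ (φ x)) (fun x => j₀ (φ x) * j x) y

variable {P Q : ((Fin n → ℚ_[p]) → Fin n → ℚ_[p]) → ((Fin n → ℚ_[p]) → ℚ_[p]) →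
    (Fin n → ℚ_[p]) → Prop}

theorem ChartRep.mono {ν : Measure (Fin n → ℚ_[p])} (h : ChartRep P ν)
    (hPQ : ∀ φ j y, Continuous φ → Continuous j → P φ j y → Q φ j y) : ChartRep Q ν := by
  induction h with
  | zero => exact .zero
  | add _ _ h1 h2 => exact .add h1 h2
  | smul c hc _ h => exact .smul c hc h
  | leaf B φ j hB hBo hφ hj h => exact .leaf B φ j hB hBo hφ hj fun y hy => hPQ _ _ _ hφ hj (h y hy)

theorem withDensity_map_eq {X Y : Type*} [MeasurableSpace X] [MeasurableSpace Y] {ν : Measure X}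
    {φ : X → Y} (hφ : Measurable φ) {g : Y → ℝ≥0∞} (hg : Measurable g) :
    (ν.map φ).withDensity g = (ν.withDensity fun x => g (φ x)).map φ := by
  ext s hs
  rw [withDensity_apply _ hs, Measure.map_apply hφ hs, withDensity_apply _ (hφ hs),
    setLIntegral_map hs hg hφ]

theorem ChartRep.map {φ₀ : (Fin n → ℚ_[p]) → Fin n → ℚ_[p]} {j₀ : (Fin n → ℚ_[p]) → ℚ_[p]}
    (hφ₀ : Continuous φ₀) (hj₀ : Continuous j₀) {ν : Measure (Fin n → ℚ_[p])}
    (h : ChartRep (chartPull φ₀ j₀ P) ν) : ChartRep P ((ν.withDensity fun y => ‖j₀ y‖ₑ).map φ₀) := by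
  induction h with
  | zero => simpa using ChartRep.zero
  | add _ _ h1 h2 =>
    rw [withDensity_add_measure, Measure.map_add _ _ hφ₀.measurable]
    exact .add h1 h2
  | smul c hc _ h =>
    rw [withDensity_smul_measure, Measure.map_smul]
    exact .smul c hc h
  | leaf B φ j hB hBo hφ hj h =>
    rw [withDensity_map_eq hφ.measurable hj₀.enorm.measurable,
      Measure.map_map hφ₀.measurable hφ.measurable,
      ← withDensity_mul _ hj.enorm.measurable
        (show Measurable fun x => ‖j₀ (φ x)‖ₑ from (hj₀.comp hφ).enorm.measurable)]
    have := ChartRep.leaf (P := P) B (fun x => φ₀ (φ x)) (fun x => j₀ (φ x) * j x) hB hBo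
      (hφ₀.comp hφ) ((hj₀.comp hφ).mul hj) h
    have e : ((fun x => ‖j x‖ₑ) * fun x => ‖j₀ (φ x)‖ₑ) = fun y => ‖j₀ (φ y) * j y‖ₑ := by
      ext y
      rw [Pi.mul_apply, enorm_mul, mul_comm]
    rw [e]
    exact this

/-- A compact open set is covered by charts satisfying `P`. -/
def ChartCov (P : ((Fin n → ℚ_[p]) → Fin n → ℚ_[p]) → ((Fin n → ℚ_[p]) → ℚ_[p]) →
    (Fin n → ℚ_[p]) → Prop) (B : Set (Fin n → ℚ_[p])) : Prop :=
  ChartRep (fun φ j y => φ y ∈ B ∧ P φ j y) (volume.restrict B)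

/-- All small compact open sets near a point are covered by charts satisfying `P`. -/
def LocCov (P : ((Fin n → ℚ_[p]) → Fin n → ℚ_[p]) → ((Fin n → ℚ_[p]) → ℚ_[p]) →
    (Fin n → ℚ_[p]) → Prop) (a : Fin n → ℚ_[p]) : Prop :=
  ∃ N ∈ 𝓝 a, ∀ B, B ⊆ N → IsCompact B → IsOpen B → ChartCov P B

theorem LocCov.mono {a : Fin n → ℚ_[p]} (h : LocCov P a)
    (hPQ : ∀ᶠ x in 𝓝 a, ∀ φ j y, Continuous φ → Continuous j → φ y = x → P φ j y → Q φ j y) :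
    LocCov Q a := by
  obtain ⟨N, hN, h⟩ := h
  refine ⟨N ∩ {x | _}, inter_mem hN hPQ, fun B hB hBc hBo => ?_⟩
  exact (h B (hB.trans Set.inter_subset_left) hBc hBo).mono fun φ j y hφ hj hy =>
    ⟨hy.1, (hB hy.1).2 φ j y hφ hj rfl hy.2⟩

theorem LocCov.of_id {a : Fin n → ℚ_[p]} (h : ∀ᶠ x in 𝓝 a, P id (fun _ => 1) x) : LocCov P a := by
  refine ⟨_, h, fun B hB hBc hBo => ?_⟩
  have := ChartRep.leaf (P := fun φ j y => φ y ∈ B ∧ P φ j y) B id (fun _ => 1) hBc hBo continuous_id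
    continuous_const fun y hy => ⟨hy, hB hy⟩
  simpa [ChartCov] using this

theorem ChartRep.bind {ν : Measure (Fin n → ℚ_[p])} (h : ChartRep P ν) {W : Set (Fin n → ℚ_[p])}
    (hPQ : ∀ φ j y, Continuous φ → Continuous j → P φ j y → φ ⁻¹' W ∈ 𝓝 y ∧ LocCov (chartPull φ j Q) y) :
    ChartRep (fun φ j y => φ y ∈ W ∧ Q φ j y) ν := by
  induction h with
  | zero => exact .zero
  | add _ _ h1 h2 => exact .add h1 h2
  | smul c hc _ h => exact .smul c hc h
  | leaf B φ j hB hBo hφ hj h =>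
    refine clopen_induction hB hBo (q := fun A => ChartRep (fun φ j y => φ y ∈ W ∧ Q φ j y)
      (((volume.restrict A).withDensity fun y => ‖j y‖ₑ).map φ)) ?_ ?_ ?_
    · simpa using ChartRep.zero
    · intro A C _ _ _ _ _ hCo hAC h1 h2
      rw [Measure.restrict_union hAC hCo.measurableSet, withDensity_add_measure,
        Measure.map_add _ _ hφ.measurable]
      exact .add h1 h2
    · intro a ha
      obtain ⟨h1, N, hN, h2⟩ := hPQ φ j a hφ hj (h a ha)
      refine ⟨N ∩ φ ⁻¹' W, inter_mem hN h1, fun A hA _ hAc hAo => ?_⟩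
      refine ChartRep.map hφ hj ?_
      exact (h2 A (hA.trans Set.inter_subset_left) hAc hAo).mono fun ψ k y _ _ hy =>
        ⟨(hA hy.1).2, hy.2⟩

theorem ChartCov.bind {B : Set (Fin n → ℚ_[p])} (hBo : IsOpen B) (h : ChartCov P B)
    (hPQ : ∀ φ j y, Continuous φ → Continuous j → φ y ∈ B → P φ j y → LocCov (chartPull φ j Q) y) :
    ChartCov Q B :=
  ChartRep.bind h fun φ j y hφ hj hy =>
    ⟨hφ.continuousAt (hBo.mem_nhds hy.1), hPQ φ j y hφ hj hy.1 hy.2⟩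

theorem LocCov.bind {a : Fin n → ℚ_[p]} (h : LocCov P a)
    (hPQ : ∀ᶠ x in 𝓝 a, ∀ φ j y, Continuous φ → Continuous j → φ y = x → P φ j y →
      LocCov (chartPull φ j Q) y) : LocCov Q a := by
  obtain ⟨N, hN, h⟩ := h
  refine ⟨N ∩ {x | _}, inter_mem hN hPQ, fun B hB hBc hBo => ?_⟩
  exact (h B (hB.trans Set.inter_subset_left) hBc hBo).bind hBo fun φ j y hφ hj hy hP =>
    (hB hy).2 φ j y hφ hj rfl hP

theorem ChartCov.union {A C : Set (Fin n → ℚ_[p])} (hC : IsOpen C) (hAC : Disjoint A C)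
    (h1 : ChartCov P A) (h2 : ChartCov P C) : ChartCov P (A ∪ C) := by
  rw [ChartCov, Measure.restrict_union hAC hC.measurableSet]
  exact .add (h1.mono fun _ _ _ _ _ h => ⟨Or.inl h.1, h.2⟩)
    (h2.mono fun _ _ _ _ _ h => ⟨Or.inr h.1, h.2⟩)

theorem ChartCov.of_local {B : Set (Fin n → ℚ_[p])} (hB : IsCompact B) (hBo : IsOpen B)
    (h : ∀ a ∈ B, LocCov P a) : ChartCov P B := by
  refine clopen_induction hB hBo (q := ChartCov P) ?_ ?_ ?_
  · rw [ChartCov, Measure.restrict_empty]; exact .zero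
  · intro A C _ _ _ _ _ hCo hAC h1 h2
    exact h1.union hCo hAC h2
  · intro a ha
    obtain ⟨N, hN, h⟩ := h a ha
    exact ⟨N, hN, fun A hA _ => h A hA⟩

end Charts

end

section

open Filter Topology MeasureTheory
open scoped ENNReal NNReal

set_option linter.unusedSectionVars false

section ChartRules

variable {p : ℕ} [Fact p.Prime] {n : ℕ}
variable [MeasureSpace ℚ_[p]] [BorelSpace ℚ_[p]] [(volume : Measure ℚ_[p]).IsAddHaarMeasure]
variable {P Q : ((Fin n → ℚ_[p]) → Fin n → ℚ_[p]) → ((Fin n → ℚ_[p]) → ℚ_[p]) →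
    (Fin n → ℚ_[p]) → Prop}

theorem LocCov.eventually {a : Fin n → ℚ_[p]} (h : LocCov P a) : ∀ᶠ x in 𝓝 a, LocCov P x := by
  obtain ⟨N, hN, h⟩ := h
  filter_upwards [eventually_mem_nhds_iff.2 hN] with x hx
  exact ⟨N, hx, h⟩

theorem ChartRep.of_chart {σ : (Fin n → ℚ_[p]) → Fin n → ℚ_[p]} {j : (Fin n → ℚ_[p]) → ℚ_[p]}
    (hσ : Continuous σ) (hj : Continuous j) {S T B : Set (Fin n → ℚ_[p])}
    (hS : MeasurableSet S) (hT : IsOpen T) (hST : ∀ y, j y ≠ 0 → (σ y ∈ S ↔ y ∈ T))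
    (hB : IsOpen B) (hc : IsCompact (σ ⁻¹' B ∩ T))
    (h : ∀ y, σ y ∈ B → y ∈ T → LocCov (chartPull σ j P) y) :
    ChartRep (fun φ k y => φ y ∈ B ∧ P φ k y)
      (((volume.withDensity fun y => ‖j y‖ₑ).map σ).restrict (B ∩ S)) := by
  have ho : IsOpen (σ ⁻¹' B ∩ T) := (hB.preimage hσ).inter hT
  have hcov : ChartCov (chartPull σ j P) (σ ⁻¹' B ∩ T) :=
    ChartCov.of_local hc ho fun y hy => h y hy.1 hy.2
  have e : ((volume.withDensity fun y => ‖j y‖ₑ).map σ).restrict (B ∩ S)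
      = ((volume.restrict (σ ⁻¹' B ∩ T)).withDensity fun y => ‖j y‖ₑ).map σ := by
    rw [Measure.restrict_map hσ.measurable (hB.measurableSet.inter hS),
      ← restrict_withDensity ho.measurableSet]
    congr 1
    apply Measure.restrict_congr_set
    have : ∀ᵐ y ∂(volume.withDensity fun y => ‖j y‖ₑ), j y ≠ 0 := by
      rw [ae_withDensity_iff hj.enorm.measurable]
      exact Eventually.of_forall fun y hy => by simpa using hy
    filter_upwards [this] with y hy
    apply propext
    exact and_congr_right fun _ => hST y hy
  rw [e]
  exact ChartRep.map hσ hj (hcov.mono fun φ k y _ _ hy => ⟨hy.1.1, hy.2⟩)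

theorem LocCov.of_homeomorph (σ : (Fin n → ℚ_[p]) ≃ₜ (Fin n → ℚ_[p]))
    (hσ : MeasurePreserving σ volume volume) {a : Fin n → ℚ_[p]}
    (h : LocCov (chartPull σ (fun _ => 1) P) a) : LocCov P (σ a) := by
  have h1 : ∀ᶠ x in 𝓝 (σ a), LocCov (chartPull σ (fun _ => 1) P) (σ.symm x) :=
    σ.symm.continuous.continuousAt.eventually (by rw [σ.symm_apply_apply]; exact h.eventually)
  refine ⟨_, h1, fun B hB hBc hBo => ?_⟩
  have := ChartRep.of_chart (P := P) σ.continuous (continuous_const (y := (1 : ℚ_[p])))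
    MeasurableSet.univ isOpen_univ (fun y _ => by simp) hBo
    (by simpa using (σ.isCompact_preimage (s := B)).2 hBc)
    (fun y hy _ => by simpa using hB hy)
  simpa [ChartCov, hσ.map_eq] using this

/-- Change of variables in a single coordinate, with the other coordinates as parameters. -/
theorem volume_eq_sum_map_update {ι : Type*} (Λ : Finset ι) (c : ι → ℝ≥0∞) (i : Fin (n + 1))
    (τ J : ι → (Fin (n + 1) → ℚ_[p]) → ℚ_[p]) (hτ : ∀ l, Measurable (τ l))
    (hJ : ∀ l, Measurable (J l))
    (h : ∀ᵐ x : Fin n → ℚ_[p], ∀ S : Set ℚ_[p], MeasurableSet S →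
      volume S = ∑ l ∈ Λ, c l * ∫⁻ s in {s | τ l (i.insertNth s x) ∈ S}, ‖J l (i.insertNth s x)‖ₑ) :
    (volume : Measure (Fin (n + 1) → ℚ_[p])) = ∑ l ∈ Λ, c l •
      (volume.withDensity fun y => ‖J l y‖ₑ).map (fun y => Function.update y i (τ l y)) := by
  have he := volume_preserving_piFinSuccAbove (fun _ : Fin (n + 1) => ℚ_[p]) i
  set e := MeasurableEquiv.piFinSuccAbove (fun _ : Fin (n + 1) => ℚ_[p]) i with hedef
  have hes : ∀ z : ℚ_[p] × (Fin n → ℚ_[p]), e.symm z = i.insertNth z.1 z.2 := fun z => rfl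
  have hσ : ∀ l, Measurable fun y : Fin (n + 1) → ℚ_[p] => Function.update y i (τ l y) := by
    intro l
    refine measurable_pi_iff.2 fun k => ?_
    by_cases hk : k = i
    · subst hk; simpa using hτ l
    · simpa [hk] using measurable_pi_apply k
  ext S hS
  rw [Measure.finsetSum_apply]
  simp only [Measure.smul_apply, smul_eq_mul]
  have h1 : volume S = ∫⁻ x : Fin n → ℚ_[p], volume {s : ℚ_[p] | i.insertNth s x ∈ S} := by
    rw [← (he.symm e).measure_preimage_equiv S]
    change (volume.prod volume) (e.symm ⁻¹' S) = _
    rw [Measure.prod_apply_symm (e.symm.measurable hS)]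
    rfl
  have h2 : ∀ l, (Measurable fun x : Fin n → ℚ_[p] =>
        ∫⁻ s in {s | τ l (i.insertNth s x) ∈ {s | i.insertNth s x ∈ S}},
          ‖J l (i.insertNth s x)‖ₑ) ∧ ((volume.withDensity fun y => ‖J l y‖ₑ).map
      (fun y => Function.update y i (τ l y))) S
      = ∫⁻ x : Fin n → ℚ_[p], ∫⁻ s in {s | τ l (i.insertNth s x) ∈ {s | i.insertNth s x ∈ S}},
        ‖J l (i.insertNth s x)‖ₑ := by
    intro l
    have hms := hσ l hS
    have hmeas : Measurable (Set.indicator ((fun y => Function.update y i (τ l y)) ⁻¹' S)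
      fun y => ‖J l y‖ₑ) := (hJ l).enorm.indicator hms
    have heq : ∀ x : Fin n → ℚ_[p], ∫⁻ s in {s | τ l (i.insertNth s x) ∈ {s | i.insertNth s x ∈ S}},
          ‖J l (i.insertNth s x)‖ₑ = ∫⁻ s, Set.indicator ((fun y => Function.update y i (τ l y)) ⁻¹' S)
            (fun y => ‖J l y‖ₑ) (e.symm (s, x)) := by
      intro x
      have hins : Measurable fun s : ℚ_[p] => (i.insertNth s x : Fin (n + 1) → ℚ_[p]) :=
        e.symm.measurable.comp (measurable_id.prodMk measurable_const)
      have hm2 : MeasurableSet {s : ℚ_[p] | τ l (i.insertNth s x) ∈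
          {s : ℚ_[p] | (i.insertNth s x : Fin (n + 1) → ℚ_[p]) ∈ S}} :=
        ((hτ l).comp hins) (hins hS)
      rw [← lintegral_indicator hm2]
      refine lintegral_congr fun s => ?_
      have hiff : s ∈ {s : ℚ_[p] | τ l (i.insertNth s x) ∈
          {s : ℚ_[p] | (i.insertNth s x : Fin (n + 1) → ℚ_[p]) ∈ S}} ↔
          e.symm (s, x) ∈ (fun y => Function.update y i (τ l y)) ⁻¹' S := by
        change (i.insertNth (τ l (i.insertNth s x)) x : Fin (n + 1) → ℚ_[p]) ∈ S ↔
          Function.update (i.insertNth s x : Fin (n + 1) → ℚ_[p]) i (τ l (i.insertNth s x)) ∈ S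
        rw [Fin.update_insertNth]
      by_cases hs : e.symm (s, x) ∈ (fun y => Function.update y i (τ l y)) ⁻¹' S
      · rw [Set.indicator_of_mem hs, Set.indicator_of_mem (hiff.2 hs)]; rfl
      · rw [Set.indicator_of_notMem hs, Set.indicator_of_notMem (mt hiff.1 hs)]
    simp only [heq]
    have hmeas' := hmeas.comp e.symm.measurable
    refine ⟨hmeas'.lintegral_prod_left', ?_⟩
    rw [Measure.map_apply (hσ l) hS, withDensity_apply _ hms, ← lintegral_indicator hms,
      ← (he.symm e).lintegral_comp hmeas]
    change ∫⁻ z, _ ∂(volume.prod volume) = _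
    exact lintegral_prod_symm' _ hmeas'
  rw [h1]
  simp only [fun l => (h2 l).2]
  rw [Finset.sum_congr rfl fun l _ => (lintegral_const_mul (c l) (h2 l).1).symm,
    ← lintegral_finsetSum _ fun l _ => (h2 l).1.const_mul (c l)]
  refine lintegral_congr_ae ?_
  filter_upwards [h] with x hx
  refine hx _ ?_
  exact (e.symm.measurable.comp (measurable_id.prodMk measurable_const)) hS

end ChartRules

end

section

open Filter Topology MeasureTheory
open scoped ENNReal NNReal

set_option linter.unusedSectionVars false

section ChartRules

variable {p : ℕ} [Fact p.Prime] {n : ℕ}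

/-- Translation of the zeroth coordinate by a function of the others. -/
noncomputable def shearHomeo (b : (Fin n → ℚ_[p]) → ℚ_[p]) (hb : Continuous b) :
    (Fin (n + 1) → ℚ_[p]) ≃ₜ (Fin (n + 1) → ℚ_[p]) where
  toFun w := Function.update w 0 (w 0 + b (Fin.tail w))
  invFun w := Function.update w 0 (w 0 - b (Fin.tail w))
  left_inv w := by simp [update_zero_eq_cons]
  right_inv w := by simp [update_zero_eq_cons]
  continuous_toFun := by
    have : Continuous fun w : Fin (n + 1) → ℚ_[p] => Fin.tail w :=
      continuous_pi fun k => continuous_apply k.succ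
    exact continuous_id.update 0 ((continuous_apply 0).add (hb.comp this))
  continuous_invFun := by
    have : Continuous fun w : Fin (n + 1) → ℚ_[p] => Fin.tail w :=
      continuous_pi fun k => continuous_apply k.succ
    exact continuous_id.update 0 ((continuous_apply 0).sub (hb.comp this))

/-- The linear shear adding `w 0 • u`. -/
noncomputable def linearShearHomeo (u : Fin (n + 1) → ℚ_[p]) (hu : u 0 = 0) :
    (Fin (n + 1) → ℚ_[p]) ≃ₜ (Fin (n + 1) → ℚ_[p]) where
  toFun w := w + w 0 • u
  invFun w := w - w 0 • u
  left_inv w := by simp [hu]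
  right_inv w := by simp [hu]
  continuous_toFun := by fun_prop
  continuous_invFun := by fun_prop

variable [MeasureSpace ℚ_[p]] [BorelSpace ℚ_[p]] [(volume : Measure ℚ_[p]).IsAddHaarMeasure]

theorem measurePreserving_shearHomeo (b : (Fin n → ℚ_[p]) → ℚ_[p]) (hb : Continuous b) :
    MeasurePreserving (shearHomeo b hb) volume volume := by
  refine ⟨(shearHomeo b hb).continuous.measurable, ?_⟩
  have ht : Continuous fun w : Fin (n + 1) → ℚ_[p] => Fin.tail w :=
    continuous_pi fun k => continuous_apply k.succ
  have := volume_eq_sum_map_update (p := p) (n := n) {()} (fun _ => 1) 0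
    (fun _ w => w 0 + b (Fin.tail w)) (fun _ _ => 1)
    (fun _ => ((continuous_apply 0).add (hb.comp ht)).measurable) (fun _ => measurable_const)
    (Eventually.of_forall fun x S hS => by
      simp only [Finset.sum_singleton, one_mul, enorm_one, lintegral_one, Measure.restrict_apply_univ,
        Fin.insertNth_zero, Fin.cons_zero, Fin.tail_cons]
      exact (measure_preimage_add_right volume (b x) S).symm)
  simp only [enorm_one, Finset.sum_singleton, one_smul] at this
  rw [show (fun _ : Fin (n + 1) → ℚ_[p] => (1 : ℝ≥0∞)) = 1 from rfl, withDensity_one] at this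
  exact this.symm

theorem measurePreserving_linearShearHomeo (u : Fin (n + 1) → ℚ_[p]) (hu : u 0 = 0) :
    MeasurePreserving (linearShearHomeo u hu) volume volume := by
  have he := volume_preserving_piFinSuccAbove (fun _ : Fin (n + 1) => ℚ_[p]) 0
  set e := MeasurableEquiv.piFinSuccAbove (fun _ : Fin (n + 1) => ℚ_[p]) 0 with hedef
  have hm : Measurable (Function.uncurry fun (t : ℚ_[p]) (x : Fin n → ℚ_[p]) => x + t • Fin.tail u) := by
    have : Continuous (Function.uncurry fun (t : ℚ_[p]) (x : Fin n → ℚ_[p]) => x + t • Fin.tail u) := by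
      unfold Function.uncurry; fun_prop
    exact this.measurable
  have h1 : MeasurePreserving (fun q : ℚ_[p] × (Fin n → ℚ_[p]) => (q.1, q.2 + q.1 • Fin.tail u))
      volume volume :=
    (MeasurePreserving.id (volume : Measure ℚ_[p])).skew_product hm
      (Eventually.of_forall fun t => map_add_right_eq_self _ _)
  have h2 := (he.symm e).comp (h1.comp he)
  have hfun : ⇑(linearShearHomeo u hu) = e.symm ∘
      ((fun q : ℚ_[p] × (Fin n → ℚ_[p]) => (q.1, q.2 + q.1 • Fin.tail u)) ∘ e) := by
    funext w
    ext k
    refine Fin.cases ?_ (fun k => ?_) k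
    · change w 0 + w 0 * u 0 = w 0
      rw [hu]; ring
    · rfl
  rw [hfun]
  exact h2

theorem volume_eq_map_scale {i j : Fin (n + 1)} (hij : i ≠ j) :
    (volume.withDensity fun y : Fin (n + 1) → ℚ_[p] => ‖y i‖ₑ).map
      (fun y => Function.update y j (y i * y j)) = volume := by
  obtain ⟨i, rfl⟩ := Fin.exists_succAbove_eq hij
  have := volume_eq_sum_map_update (p := p) (n := n) {()} (fun _ => 1) j
    (fun _ w => w (j.succAbove i) * w j) (fun _ w => w (j.succAbove i))
    (fun _ => by fun_prop) (fun _ => by fun_prop) ?_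
  · simpa using this.symm
  · have h0 : ∀ᵐ x : Fin n → ℚ_[p], x i ≠ 0 := by
      rw [ae_iff]
      simp only [ne_eq, not_not]
      exact Measure.pi_hyperplane (fun _ : Fin n => (volume : Measure ℚ_[p])) i 0
    filter_upwards [h0] with x hx S hS
    simp only [Finset.sum_singleton, one_mul, Fin.insertNth_apply_succAbove, lintegral_const,
      Fin.insertNth_apply_same, Measure.restrict_apply_univ]
    exact (volume_preimage_mul hx S).symm

end ChartRules

end

section

open Filter Topology MeasureTheory
open scoped ENNReal NNReal

set_option linter.unusedSectionVars false

section ChartRules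

variable {p : ℕ} [Fact p.Prime] {n : ℕ}
variable [MeasureSpace ℚ_[p]] [BorelSpace ℚ_[p]] [(volume : Measure ℚ_[p]).IsAddHaarMeasure]

theorem LocCov.translate {P : ((Fin n → ℚ_[p]) → Fin n → ℚ_[p]) → ((Fin n → ℚ_[p]) → ℚ_[p]) →
    (Fin n → ℚ_[p]) → Prop} {a b : Fin n → ℚ_[p]}
    (h : LocCov (chartPull (fun x => x + a) (fun _ => 1) P) b) : LocCov P (b + a) :=
  LocCov.of_homeomorph (Homeomorph.addRight a) (measurePreserving_add_right volume a) h

variable {P : ((Fin (n + 1) → ℚ_[p]) → Fin (n + 1) → ℚ_[p]) →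
    ((Fin (n + 1) → ℚ_[p]) → ℚ_[p]) → (Fin (n + 1) → ℚ_[p]) → Prop}

theorem ChartRep.of_scale {i j : Fin (n + 1)} (hij : i ≠ j) {T : Set ℚ_[p]} (hT : IsCompact T)
    (hTo : IsOpen T) {S : Set (Fin (n + 1) → ℚ_[p])} (hS : MeasurableSet S)
    (hST : ∀ y : Fin (n + 1) → ℚ_[p], y i ≠ 0 → (Function.update y j (y i * y j) ∈ S ↔ y j ∈ T))
    (h : ∀ s ∈ T, LocCov (chartPull (fun y => Function.update y j (y i * y j)) (fun y => y i) P)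
      (Pi.single j s)) :
    ∃ N ∈ 𝓝 (0 : Fin (n + 1) → ℚ_[p]), ∀ B ⊆ N, IsCompact B → IsOpen B →
      ChartRep (fun φ k y => φ y ∈ B ∧ P φ k y) (volume.restrict (B ∩ S)) := by
  have hσ : Continuous fun y : Fin (n + 1) → ℚ_[p] => Function.update y j (y i * y j) :=
    continuous_id.update j ((continuous_apply i).mul (continuous_apply j))
  have hG : IsOpen {y | LocCov (chartPull (fun y => Function.update y j (y i * y j))
      (fun y => y i) P) y} :=
    isOpen_iff_eventually.2 fun y hy => LocCov.eventually hy
  have hK : IsCompact (Pi.single j '' T : Set (Fin (n + 1) → ℚ_[p])) :=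
    hT.image (continuous_pi fun l => by
      by_cases hl : l = j
      · subst hl; simpa using continuous_id'
      · simpa [hl] using continuous_const)
  obtain ⟨δ, hδ, hsub⟩ := hK.exists_thickening_subset_open hG (by
    rintro _ ⟨s, hs, rfl⟩
    exact h s hs)
  refine ⟨Metric.ball 0 δ, Metric.ball_mem_nhds _ hδ, fun B hB hBc hBo => ?_⟩
  have hcoord : ∀ y : Fin (n + 1) → ℚ_[p], Function.update y j (y i * y j) ∈ B →
      ∀ l, l ≠ j → ‖y l‖ < δ := by
    intro y hy l hl
    have h1 := hB hy
    rw [mem_ball_zero_iff] at h1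
    have h2 := (norm_le_pi_norm (Function.update y j (y i * y j)) l).trans_lt h1
    rwa [Function.update_of_ne hl] at h2
  rw [← volume_eq_map_scale (p := p) hij]
  refine ChartRep.of_chart (T := {y | y j ∈ T}) hσ (continuous_apply i) hS
    (hTo.preimage (continuous_apply j)) hST hBo ?_ ?_
  · have hcl : IsClosed ((fun y : Fin (n + 1) → ℚ_[p] => Function.update y j (y i * y j)) ⁻¹' B ∩
        {y | y j ∈ T}) :=
      (hBc.isClosed.preimage hσ).inter (hT.isClosed.preimage (continuous_apply j))
    refine IsCompact.of_isClosed_subset (isCompact_univ_pi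
      (s := fun l : Fin (n + 1) => if l = j then T else Metric.closedBall 0 δ) fun l => ?_) hcl ?_
    · split_ifs
      · exact hT
      · exact isCompact_closedBall _ _
    · rintro y ⟨hy, hyT⟩ l -
      by_cases hl : l = j
      · subst hl
        simpa using hyT
      · simpa [hl] using (hcoord y hy l hl).le
  · intro y hy hyT
    refine hsub (Metric.mem_thickening_iff.2 ⟨_, ⟨y j, hyT, rfl⟩, ?_⟩)
    rw [dist_pi_lt_iff hδ]
    intro l
    by_cases hl : l = j
    · subst hl
      simpa using hδ
    · simpa [hl] using hcoord y hy l hl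

theorem LocCov.blowup (k : Fin n) {C : ℝ} (hC : 0 < C)
    (hA : ∀ t : ℚ_[p], ‖t‖ ≤ C → LocCov (chartPull
      (fun y => Function.update y 0 (y k.succ * y 0)) (fun y => y k.succ) P) (Pi.single 0 t))
    (hB : ∀ s : ℚ_[p], ‖s‖ < C⁻¹ → LocCov (chartPull
      (fun y => Function.update y k.succ (y 0 * y k.succ)) (fun y => y 0) P)
      (Pi.single k.succ s)) : LocCov P 0 := by
  have hS : IsClosed {x : Fin (n + 1) → ℚ_[p] | ‖x 0‖ ≤ C * ‖x k.succ‖} :=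
    isClosed_le (by fun_prop) (by fun_prop)
  have hk : k.succ ≠ 0 := Fin.succ_ne_zero k
  obtain ⟨N, hN, h1⟩ := ChartRep.of_scale (P := P) hk
    (isCompact_closedBall (0 : ℚ_[p]) C) (IsUltrametricDist.isOpen_closedBall _ hC.ne')
    hS.measurableSet
    (by
      intro y hy
      have hy' := norm_pos_iff.2 hy
      change ‖_‖ ≤ C * ‖_‖ ↔ _
      rw [Function.update_self, Function.update_of_ne hk, norm_mul, mem_closedBall_zero_iff,
        mul_comm C, mul_le_mul_iff_right₀ hy'])
    (fun s hs => hA s (mem_closedBall_zero_iff.1 hs))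
  obtain ⟨N', hN', h2⟩ := ChartRep.of_scale (P := P) hk.symm
    (T := Metric.ball 0 C⁻¹)
    (Metric.isCompact_of_isClosed_isBounded (IsUltrametricDist.isClosed_ball _ _)
      Metric.isBounded_ball) Metric.isOpen_ball hS.measurableSet.compl
    (by
      intro y hy
      have hy' := norm_pos_iff.2 hy
      change ¬ ‖_‖ ≤ C * ‖_‖ ↔ _
      rw [Function.update_self, Function.update_of_ne hk.symm, norm_mul, mem_ball_zero_iff, not_le,
        ← one_div, lt_div_iff₀ hC]
      constructor <;> intro h <;> nlinarith)
    (fun s hs => hB s (mem_ball_zero_iff.1 hs))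
  refine ⟨N ∩ N', inter_mem hN hN', fun B hB hBc hBo => ?_⟩
  have h3 := (h1 B (hB.trans Set.inter_subset_left) hBc hBo).add
    (h2 B (hB.trans Set.inter_subset_right) hBc hBo)
  rw [← Set.sdiff_eq, Measure.restrict_inter_add_sdiff _ hS.measurableSet] at h3
  exact h3

end ChartRules

end

section

open Filter Topology MeasureTheory
open scoped ENNReal NNReal

set_option linter.unusedSectionVars false

section PowerSubstitution

variable {p : ℕ} [Fact p.Prime]

theorem eventually_eq_pow {𝕜 : Type*} [NontriviallyNormedField 𝕜] [CompleteSpace 𝕜] [CharZero 𝕜]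
    {D : ℕ} (hD : D ≠ 0) : ∀ᶠ x in 𝓝 (1 : 𝕜), ∃ y, y ≠ 0 ∧ y ^ D = x := by
  have h : HasStrictDerivAt (fun y : 𝕜 => y ^ D) ((D : 𝕜) * 1 ^ (D - 1)) 1 :=
    hasStrictDerivAt_pow D 1
  have hm := h.map_nhds_eq (by simpa using hD)
  rw [one_pow] at hm
  rw [← hm, eventually_map]
  filter_upwards [eventually_ne_nhds (one_ne_zero (α := 𝕜))] with y hy
  exact ⟨y, hy, rfl⟩

theorem finite_units_quotient_pow {D : ℕ} (hD : D ≠ 0) :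
    Finite (ℚ_[p]ˣ ⧸ (powMonoidHom D : ℚ_[p]ˣ →* ℚ_[p]ˣ).range) := by
  classical
  set H := (powMonoidHom D : ℚ_[p]ˣ →* ℚ_[p]ˣ).range with hH
  let X : Set ℚ_[p] := {x | ‖x‖ ≤ 1 ∧ (p : ℝ) ^ (-(D : ℤ)) ≤ ‖x‖}
  have hX : IsCompact X := by
    refine Metric.isCompact_of_isClosed_isBounded ?_ ?_
    · exact (isClosed_le continuous_norm continuous_const).inter
        (isClosed_le continuous_const continuous_norm)
    · exact (Metric.isBounded_closedBall (x := (0 : ℚ_[p])) (r := 1)).subset fun x hx => by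
        simpa using hx.1
  have hp0 : (0 : ℝ) < p := by exact_mod_cast (Fact.out : p.Prime).pos
  have hp1 : (1 : ℝ) < p := by exact_mod_cast (Fact.out : p.Prime).one_lt
  have hX0 : ∀ x ∈ X, x ≠ 0 := fun x hx => norm_pos_iff.1 ((zpow_pos hp0 _).trans_le hx.2)
  obtain ⟨t, htX, hcov⟩ := hX.elim_nhds_subcover
    (fun u => {x | ∃ y : ℚ_[p], y ≠ 0 ∧ y ^ D = x * u⁻¹}) fun u hu => by
      have hc : Tendsto (fun x : ℚ_[p] => x * u⁻¹) (𝓝 u) (𝓝 1) := by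
        have : ContinuousAt (fun x : ℚ_[p] => x * u⁻¹) u := by fun_prop
        rw [ContinuousAt, mul_inv_cancel₀ (hX0 u hu)] at this
        exact this
      exact hc.eventually (eventually_eq_pow hD)
  refine Finite.of_surjective (fun u : t => (QuotientGroup.mk (Units.mk0 u.1 (hX0 _ (htX _ u.2))) :
    ℚ_[p]ˣ ⧸ H)) fun q => ?_
  obtain ⟨a, rfl⟩ := QuotientGroup.mk_surjective q
  set v := (a : ℚ_[p]).valuation with hv
  have hpK : (p : ℚ_[p]) ≠ 0 := by exact_mod_cast (Fact.out : p.Prime).ne_zero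
  let b : ℚ_[p]ˣ := a * (Units.mk0 (p : ℚ_[p]) hpK ^ (-(v / (D : ℤ)))) ^ D
  have hbX : (b : ℚ_[p]) ∈ X := by
    have hn : ‖(b : ℚ_[p])‖ = (p : ℝ) ^ (-(v % D)) := by
      simp only [b, Units.val_mul, Units.val_pow_eq_pow_val, Units.val_zpow_eq_zpow_val,
        Units.val_mk0, norm_mul, norm_pow, norm_zpow, Padic.norm_p]
      rw [Padic.norm_eq_zpow_neg_valuation a.ne_zero, ← hv, ← zpow_natCast, ← zpow_mul, inv_zpow,
        ← zpow_neg, ← zpow_add₀ hp0.ne']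
      congr 1
      have := Int.emod_add_mul_ediv v D
      linarith [mul_comm (D : ℤ) (v / D)]
    have h1 := Int.emod_nonneg v (by exact_mod_cast hD : (D : ℤ) ≠ 0)
    have h2 := Int.emod_lt_of_pos v (by positivity : (0 : ℤ) < (D : ℤ))
    refine ⟨?_, ?_⟩
    · rw [hn]
      exact zpow_le_one_of_nonpos₀ hp1.le (by linarith)
    · rw [hn]
      exact zpow_le_zpow_right₀ hp1.le (by linarith)
  obtain ⟨u, hut, y, hy, hyu⟩ := Set.mem_iUnion₂.1 (hcov hbX)
  refine ⟨⟨u, hut⟩, ?_⟩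
  rw [QuotientGroup.eq]
  refine ⟨Units.mk0 y hy * (Units.mk0 (p : ℚ_[p]) hpK ^ (v / (D : ℤ))), ?_⟩
  simp only [powMonoidHom_apply, mul_pow]
  have h1 : (Units.mk0 y hy) ^ D = b * (Units.mk0 u (hX0 _ (htX _ hut)))⁻¹ := by
    ext
    simpa using hyu
  rw [h1]
  simp only [b, zpow_neg, inv_pow]
  rw [mul_right_comm, inv_mul_cancel_right, mul_comm]

variable [MeasureSpace ℚ_[p]] [BorelSpace ℚ_[p]] [(volume : Measure ℚ_[p]).IsAddHaarMeasure]

theorem measure_unit_sphere_mul_eq {m : Measure ℚ_[p]} [SFinite m] (h0 : m {0} = 0)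
    (hm : ∀ a : ℚ_[p], a ≠ 0 → ∀ S, MeasurableSet S → ‖a‖ₑ * m ((a * ·) ⁻¹' S) = m S)
    {S : Set ℚ_[p]} (hS : MeasurableSet S) :
    volume {x : ℚ_[p] | ‖x‖ = 1} * m S = m {x | ‖x‖ = 1} * volume S := by
  have hU : MeasurableSet {x : ℚ_[p] | ‖x‖ = 1} := (measurableSet_singleton 1).preimage measurable_norm
  have hne : ∀ᵐ y ∂m, y ≠ 0 := by simpa [ae_iff] using h0
  have hne' : ∀ᵐ y : ℚ_[p], y ≠ 0 := by simp [ae_iff]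
  have hE : MeasurableSet {q : ℚ_[p] × ℚ_[p] | ‖q.1‖ = 1 ∧ q.1 * q.2 ∈ S} :=
    ((measurableSet_singleton (1 : ℝ)).preimage (measurable_norm.comp measurable_fst)).inter
      (hS.preimage (measurable_fst.mul measurable_snd))
  have hF : MeasurableSet {q : ℚ_[p] × ℚ_[p] | ‖q.1‖ = ‖q.2‖ ∧ q.2 ∈ S} :=
    (measurableSet_eq_fun (measurable_norm.comp measurable_fst)
      (measurable_norm.comp measurable_snd)).inter (hS.preimage measurable_snd)
  have hmn : Measurable fun y : ℚ_[p] => (‖y‖ₑ)⁻¹ := measurable_enorm.inv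
  have h1 : (volume.prod m) {q : ℚ_[p] × ℚ_[p] | ‖q.1‖ = 1 ∧ q.1 * q.2 ∈ S} =
      volume {x : ℚ_[p] | ‖x‖ = 1} * m S := by
    rw [Measure.prod_apply hE, mul_comm, ← lintegral_indicator_const hU]
    refine lintegral_congr fun x => ?_
    by_cases hx : ‖x‖ = 1
    · rw [Set.indicator_of_mem (show x ∈ {x : ℚ_[p] | ‖x‖ = 1} from hx),
        ← hm x (norm_pos_iff.1 (by rw [hx]; exact one_pos)) S hS]
      have : ‖x‖ₑ = 1 := by rw [← ofReal_norm, hx, ENNReal.ofReal_one]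
      rw [this, one_mul]
      congr 1
      ext y
      simp [hx]
    · rw [Set.indicator_of_notMem (show x ∉ {x : ℚ_[p] | ‖x‖ = 1} from hx)]
      simp [hx]
  have h2 : (volume.prod m) {q : ℚ_[p] × ℚ_[p] | ‖q.1‖ = 1 ∧ q.1 * q.2 ∈ S} =
      ((m.withDensity fun y => ‖y‖ₑ⁻¹).prod volume)
        {q : ℚ_[p] × ℚ_[p] | ‖q.1‖ = ‖q.2‖ ∧ q.2 ∈ S} := by
    rw [Measure.prod_apply_symm hE, Measure.prod_apply hF,
      lintegral_withDensity_eq_lintegral_mul _ hmn (measurable_measure_prodMk_left hF)]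
    refine lintegral_congr_ae ?_
    filter_upwards [hne] with y hy
    have hy' : ‖y‖ₑ ≠ 0 := by simpa using hy
    rw [Pi.mul_apply, ← volume_preimage_mul hy
      (Prod.mk y ⁻¹' {q : ℚ_[p] × ℚ_[p] | ‖q.1‖ = ‖q.2‖ ∧ q.2 ∈ S}), ← mul_assoc, ENNReal.inv_mul_cancel hy' (by simp),
      one_mul]
    congr 1
    ext x
    have hy'' : ‖y‖ ≠ 0 := by simpa using hy
    simp [hy'', mul_comm]
  have h3 : ((m.withDensity fun y => ‖y‖ₑ⁻¹).prod volume)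
        {q : ℚ_[p] × ℚ_[p] | ‖q.1‖ = ‖q.2‖ ∧ q.2 ∈ S} = m {x | ‖x‖ = 1} * volume S := by
    rw [Measure.prod_apply_symm hF, ← lintegral_indicator_const hS]
    refine lintegral_congr_ae ?_
    filter_upwards [hne'] with z hz
    by_cases hzS : z ∈ S
    · rw [Set.indicator_of_mem hzS]
      have hz' : ‖z‖ₑ ≠ 0 := by simpa using hz
      have hz'' : ‖z‖ ≠ 0 := by simpa using hz
      have hset : MeasurableSet {y : ℚ_[p] | ‖y‖ = ‖z‖} :=
        (measurableSet_singleton ‖z‖).preimage measurable_norm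
      have heq : ((fun x => (x, z)) ⁻¹' {q : ℚ_[p] × ℚ_[p] | ‖q.1‖ = ‖q.2‖ ∧ q.2 ∈ S}) =
          {y : ℚ_[p] | ‖y‖ = ‖z‖} := by
        ext y; simp [hzS]
      rw [heq, withDensity_apply _ hset]
      have : ∫⁻ y in {y : ℚ_[p] | ‖y‖ = ‖z‖}, ‖y‖ₑ⁻¹ ∂m =
          ∫⁻ y in {y : ℚ_[p] | ‖y‖ = ‖z‖}, ‖z‖ₑ⁻¹ ∂m := by
        refine setLIntegral_congr_fun hset fun y hy => ?_
        have : ‖y‖ = ‖z‖ := hy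
        rw [← ofReal_norm, this, ofReal_norm]
      rw [this, lintegral_const, Measure.restrict_apply_univ, ← hm z hz _ hset, ← mul_assoc,
        ENNReal.inv_mul_cancel hz' (by simp), one_mul]
      congr 1
      ext y
      simp [hz'']
    · rw [Set.indicator_of_notMem hzS]
      simp [hzS]
  rw [← h1, h2, h3]

theorem exists_volume_eq_sum_pow {D : ℕ} (hD : D ≠ 0) :
    ∃ (ι : Type) (Λ : Finset ι) (l : ι → ℚ_[p]) (c : ι → ℝ≥0∞), (∀ i, l i ≠ 0) ∧ (∀ i, c i ≠ ⊤) ∧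
      ∀ S : Set ℚ_[p], MeasurableSet S → volume S =
        ∑ i ∈ Λ, c i * ∫⁻ s in {s | l i * s ^ D ∈ S}, ‖s ^ (D - 1)‖ₑ := by
  classical
  have := finite_units_quotient_pow (p := p) hD
  set H := (powMonoidHom D : ℚ_[p]ˣ →* ℚ_[p]ˣ).range with hH
  have := Fintype.ofFinite (ℚ_[p]ˣ ⧸ H)
  let l : ℚ_[p]ˣ ⧸ H → ℚ_[p] := fun q => (q.out : ℚ_[p]ˣ)
  have hl : ∀ q, l q ≠ 0 := fun q => Units.ne_zero _
  let M : Measure ℚ_[p] := ∑ q : ℚ_[p]ˣ ⧸ H, ‖l q‖ₑ •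
    (volume.withDensity fun s : ℚ_[p] => ‖s ^ (D - 1)‖ₑ).map (fun s => l q * s ^ D)
  have hmeas : ∀ q, Measurable fun s : ℚ_[p] => l q * s ^ D := fun q => by fun_prop
  have hM : ∀ S, MeasurableSet S → M S =
      ∑ q : ℚ_[p]ˣ ⧸ H, ‖l q‖ₑ * ∫⁻ s in {s | l q * s ^ D ∈ S}, ‖s ^ (D - 1)‖ₑ := by
    intro S hS
    simp only [M, Measure.coe_finsetSum, Finset.sum_apply, Measure.smul_apply, smul_eq_mul]
    refine Finset.sum_congr rfl fun q _ => ?_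
    rw [Measure.map_apply (hmeas q) hS, withDensity_apply _ (hmeas q hS)]
    rfl
  have hM0 : M {0} = 0 := by
    rw [hM _ (measurableSet_singleton 0)]
    refine Finset.sum_eq_zero fun q _ => ?_
    have : {s : ℚ_[p] | l q * s ^ D ∈ ({0} : Set ℚ_[p])} = {0} := by
      ext s
      simp [hl q, hD]
    rw [this]
    simp
  have hscale : ∀ a : ℚ_[p], a ≠ 0 → ∀ S, MeasurableSet S → ‖a‖ₑ * M ((a * ·) ⁻¹' S) = M S := by
    intro a ha S hS
    have hS' : MeasurableSet ((a * ·) ⁻¹' S) := hS.preimage (measurable_const_mul a)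
    rw [hM _ hS, hM _ hS', Finset.mul_sum]
    refine Fintype.sum_equiv (MulAction.toPerm (Units.mk0 a ha)) _ _ fun q => ?_
    have hq : ∃ c : ℚ_[p], c ≠ 0 ∧ a * l q = l (Units.mk0 a ha • q) * c ^ D := by
      have h1 : (QuotientGroup.mk (Units.mk0 a ha • q).out : ℚ_[p]ˣ ⧸ H) =
          QuotientGroup.mk (Units.mk0 a ha * q.out) := by
        rw [QuotientGroup.out_eq', ← smul_eq_mul, ← MulAction.Quotient.smul_mk, QuotientGroup.out_eq']
      obtain ⟨c, hc⟩ := QuotientGroup.eq.1 h1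
      refine ⟨c, c.ne_zero, ?_⟩
      have h2 : Units.mk0 a ha * q.out = (Units.mk0 a ha • q).out * c ^ D := by
        rw [eq_comm, ← eq_inv_mul_iff_mul_eq]
        exact hc
      have := congrArg (Units.val) h2
      simpa using this
    obtain ⟨c, hc, hac⟩ := hq
    change ‖a‖ₑ * (‖l q‖ₑ * _) = ‖l (Units.mk0 a ha • q)‖ₑ * _
    set q' := Units.mk0 a ha • q
    have hce : ‖c‖ₑ ≠ 0 := by simpa using hc
    have hcD : (‖c‖ₑ ^ D) ≠ 0 := pow_ne_zero _ hce
    have hTm : MeasurableSet {s : ℚ_[p] | l q' * s ^ D ∈ S} := hmeas q' hS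
    have hmap : (volume : Measure ℚ_[p]).map (c * ·) = ‖c‖ₑ⁻¹ • volume := by
      ext T hT
      rw [Measure.map_apply (measurable_const_mul c) hT, Measure.smul_apply, smul_eq_mul,
        ← volume_preimage_mul hc T, ← mul_assoc, ENNReal.inv_mul_cancel hce (by simp), one_mul]
    have hintg : ∫⁻ s in {s | l q * s ^ D ∈ (a * ·) ⁻¹' S}, ‖s ^ (D - 1)‖ₑ =
        (‖c‖ₑ ^ D)⁻¹ * ∫⁻ s in {s | l q' * s ^ D ∈ S}, ‖s ^ (D - 1)‖ₑ := by
      have hpre : {s | l q * s ^ D ∈ (a * ·) ⁻¹' S} = (c * ·) ⁻¹' {s | l q' * s ^ D ∈ S} := by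
        ext s
        change a * (l q * s ^ D) ∈ S ↔ l q' * (c * s) ^ D ∈ S
        rw [← mul_assoc, hac, mul_pow, mul_assoc]
      have h1 : ∫⁻ s in {s | l q' * s ^ D ∈ S}, ‖s ^ (D - 1)‖ₑ ∂(volume.map (c * ·)) =
          ∫⁻ s in (c * ·) ⁻¹' {s | l q' * s ^ D ∈ S}, ‖(c * s) ^ (D - 1)‖ₑ :=
        setLIntegral_map hTm (by fun_prop) (by fun_prop)
      rw [hmap, Measure.restrict_smul, lintegral_smul_measure] at h1
      simp only [mul_pow, enorm_mul] at h1
      rw [lintegral_const_mul _ (by fun_prop)] at h1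
      rw [hpre]
      have hcD1 : ‖c ^ (D - 1)‖ₑ ≠ 0 := by simpa using fun h => (hc h).elim
      have h2 := congrArg (‖c ^ (D - 1)‖ₑ⁻¹ * ·) h1
      simp only [← mul_assoc, smul_eq_mul] at h2
      rw [ENNReal.inv_mul_cancel hcD1 (by simp), one_mul] at h2
      rw [← h2]
      congr 1
      rw [← ENNReal.mul_inv (Or.inl hcD1) (Or.inl (by simp)), enorm_pow, ← pow_succ,
        Nat.sub_add_cancel (Nat.one_le_iff_ne_zero.2 hD)]
    rw [hintg, ← mul_assoc, ← mul_assoc, ← enorm_mul, hac, enorm_mul, enorm_pow,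
      mul_assoc ‖l q'‖ₑ, ENNReal.mul_inv_cancel hcD (by simp), mul_one]
    rfl
  have : SFinite M := by
    rw [show M = Measure.sum _ from (Measure.sum_fintype _).symm]
    infer_instance
  have hUo : IsOpen {x : ℚ_[p] | ‖x‖ = 1} := by
    simpa [Metric.sphere] using IsUltrametricDist.isOpen_sphere (0 : ℚ_[p]) one_ne_zero
  have hVt : volume {x : ℚ_[p] | ‖x‖ = 1} ≠ ⊤ := by
    refine ne_top_of_le_ne_top (isCompact_closedBall (0 : ℚ_[p]) 1).measure_ne_top
      (measure_mono fun x hx => ?_)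
    rw [mem_closedBall_zero_iff]
    exact le_of_eq hx
  have hV0 : volume {x : ℚ_[p] | ‖x‖ = 1} ≠ 0 := hUo.measure_ne_zero _ ⟨1, norm_one⟩
  have key := fun S hS => measure_unit_sphere_mul_eq hM0 hscale (S := S) hS
  have hMU0 : M {x : ℚ_[p] | ‖x‖ = 1} ≠ 0 := by
    intro h0
    have h1 := key Set.univ MeasurableSet.univ
    rw [h0, zero_mul, mul_eq_zero, or_iff_right hV0, hM _ MeasurableSet.univ,
      Finset.sum_eq_zero_iff] at h1
    have h2 := h1 (1 : ℚ_[p]ˣ ⧸ H) (Finset.mem_univ _)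
    rw [mul_eq_zero, or_iff_right (by simpa using hl _)] at h2
    simp only [Set.mem_univ, Set.ofPred_true, Measure.restrict_univ] at h2
    rw [lintegral_eq_zero_iff (by fun_prop)] at h2
    have h3 : ∀ᵐ s : ℚ_[p], s ≠ 0 := by simp [ae_iff]
    have h4 : ∀ᵐ s : ℚ_[p], False := by
      filter_upwards [h2, h3] with s hs hs'
      exact pow_ne_zero (D - 1) hs' (by simpa using hs)
    simp [ae_iff] at h4
  refine ⟨ℚ_[p]ˣ ⧸ H, Finset.univ, l, fun q => (M {x : ℚ_[p] | ‖x‖ = 1})⁻¹ *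
    volume {x : ℚ_[p] | ‖x‖ = 1} * ‖l q‖ₑ, hl, fun q => ?_, fun S hS => ?_⟩
  · exact ENNReal.mul_ne_top (ENNReal.mul_ne_top (ENNReal.inv_ne_top.2 hMU0) hVt) (by simp)
  · have hMUt : M {x : ℚ_[p] | ‖x‖ = 1} ≠ ⊤ := by
      rw [hM _ hUo.measurableSet]
      refine ENNReal.sum_ne_top.2 fun q _ => ENNReal.mul_ne_top (by simp) ?_
      have hintg : IntegrableOn (fun s : ℚ_[p] => s ^ (D - 1))
          (Metric.closedBall 0 (max 1 ‖l q‖⁻¹)) :=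
        ContinuousOn.integrableOn_compact (isCompact_closedBall _ _) (by fun_prop)
      refine ne_top_of_le_ne_top hintg.2.ne (lintegral_mono_set fun s hs => ?_)
      rw [mem_closedBall_zero_iff, le_max_iff, or_iff_not_imp_left, not_le]
      intro h1
      have h2 : ‖l q * s ^ D‖ = 1 := hs
      rw [norm_mul, norm_pow] at h2
      rw [← eq_inv_of_mul_eq_one_right h2]
      exact le_self_pow₀ h1.le hD
    simp only [mul_assoc]
    rw [← Finset.mul_sum, ← Finset.mul_sum, ← hM S hS, key S hS, ← mul_assoc,
      ENNReal.inv_mul_cancel hMU0 hMUt, one_mul]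

end PowerSubstitution

end

section

open Filter Topology MeasureTheory
open scoped ENNReal NNReal

set_option linter.unusedSectionVars false

section PowerRule

variable {p : ℕ} [Fact p.Prime] {n : ℕ}
variable [MeasureSpace ℚ_[p]] [BorelSpace ℚ_[p]] [(volume : Measure ℚ_[p]).IsAddHaarMeasure]

theorem chartPull_chartPull (P : ((Fin n → ℚ_[p]) → Fin n → ℚ_[p]) →
    ((Fin n → ℚ_[p]) → ℚ_[p]) → (Fin n → ℚ_[p]) → Prop)
    (σ τ : (Fin n → ℚ_[p]) → Fin n → ℚ_[p]) (J j : (Fin n → ℚ_[p]) → ℚ_[p]) :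
    chartPull τ j (chartPull σ J P) = chartPull (fun y => σ (τ y)) (fun y => J (τ y) * j y) P := by
  funext φ k y
  simp only [chartPull, mul_assoc]

theorem ChartRep.sum {P : ((Fin n → ℚ_[p]) → Fin n → ℚ_[p]) →
    ((Fin n → ℚ_[p]) → ℚ_[p]) → (Fin n → ℚ_[p]) → Prop} {ι : Type*} (s : Finset ι)
    (ν : ι → Measure (Fin n → ℚ_[p])) (h : ∀ i ∈ s, ChartRep P (ν i)) :
    ChartRep P (∑ i ∈ s, ν i) := by
  classical
  induction s using Finset.induction_on with
  | empty => simpa using ChartRep.zero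
  | insert i s hi ih =>
    rw [Finset.sum_insert hi]
    exact (h i (Finset.mem_insert_self i s)).add
      (ih fun l hl => h l (Finset.mem_insert_of_mem hl))

theorem LocCov.of_pow_update {P : ((Fin (n + 1) → ℚ_[p]) → Fin (n + 1) → ℚ_[p]) →
    ((Fin (n + 1) → ℚ_[p]) → ℚ_[p]) → (Fin (n + 1) → ℚ_[p]) → Prop} (k : Fin (n + 1))
    {D : ℕ} (hD : D ≠ 0)
    (h : ∀ c : ℚ_[p], c ≠ 0 → LocCov (chartPull (fun y => Function.update y k (c * y k ^ D))
      (fun y => y k ^ (D - 1)) P) 0) : LocCov P 0 := by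
  obtain ⟨ι, Λ, l, c, hl, hc, hvol⟩ := exists_volume_eq_sum_pow (p := p) hD
  have hv := volume_eq_sum_map_update (p := p) (n := n) Λ c k
    (fun i y => l i * y k ^ D) (fun _ y => y k ^ (D - 1)) (fun _ => by fun_prop)
    (fun _ => by fun_prop) (Eventually.of_forall fun x S hS => by
      simp only [Fin.insertNth_apply_same]
      exact hvol S hS)
  have hσ : ∀ i, Continuous fun y : Fin (n + 1) → ℚ_[p] => Function.update y k (l i * y k ^ D) :=
    fun i => continuous_id.update k (by fun_prop)
  have hloc : ∀ i, ∃ N ∈ 𝓝 (0 : Fin (n + 1) → ℚ_[p]), ∀ B ⊆ N, IsCompact B → IsOpen B →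
      ChartRep (fun φ k y => φ y ∈ B ∧ P φ k y)
        (((volume.withDensity fun y => ‖y k ^ (D - 1)‖ₑ).map
          (fun y => Function.update y k (l i * y k ^ D))).restrict B) := by
    intro i
    obtain ⟨δ, hδ, hsub⟩ := Metric.eventually_nhds_iff_ball.1 (h (l i) (hl i)).eventually
    have hli := norm_pos_iff.2 (hl i)
    refine ⟨Metric.ball 0 (min δ (‖l i‖ * δ ^ D)), Metric.ball_mem_nhds _ (by positivity),
      fun B hB hBc hBo => ?_⟩
    have hsub' : ∀ y : Fin (n + 1) → ℚ_[p], Function.update y k (l i * y k ^ D) ∈ B →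
        y ∈ Metric.ball (0 : Fin (n + 1) → ℚ_[p]) δ := by
      intro y hy
      have h1 := hB hy
      rw [mem_ball_zero_iff, lt_min_iff, pi_norm_lt_iff hδ] at h1
      rw [mem_ball_zero_iff, pi_norm_lt_iff hδ]
      intro r
      by_cases hr : r = k
      · subst hr
        have h2 := (norm_le_pi_norm _ r).trans_lt h1.2
        rw [Function.update_self, norm_mul, norm_pow, mul_lt_mul_iff_right₀ hli] at h2
        exact lt_of_pow_lt_pow_left₀ D hδ.le h2
      · simpa [hr] using h1.1 r
    have := ChartRep.of_chart (P := P) (S := Set.univ) (T := Set.univ) (B := B) (hσ i)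
      (j := fun y => y k ^ (D - 1)) (by fun_prop) MeasurableSet.univ isOpen_univ
      (fun _ _ => by simp) hBo
      (by
        rw [Set.inter_univ]
        exact Metric.isCompact_of_isClosed_isBounded (hBc.isClosed.preimage (hσ i))
          (Metric.isBounded_ball.subset hsub'))
      (fun y hy _ => hsub y (hsub' y hy))
    rwa [Set.inter_univ] at this
  choose N hN hrep using hloc
  refine ⟨⋂ i ∈ Λ, N i, (biInter_finset_mem Λ).2 fun i _ => hN i, fun B hB hBc hBo => ?_⟩
  rw [ChartCov, hv]
  have hres : (∑ i ∈ Λ, c i • Measure.map (fun y => Function.update y k (l i * y k ^ D))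
      (volume.withDensity fun y : Fin (n + 1) → ℚ_[p] => ‖y k ^ (D - 1)‖ₑ)).restrict B =
      ∑ i ∈ Λ, c i • (Measure.map (fun y => Function.update y k (l i * y k ^ D))
      (volume.withDensity fun y : Fin (n + 1) → ℚ_[p] => ‖y k ^ (D - 1)‖ₑ)).restrict B := by
    ext S hS
    simp [Measure.restrict_apply hS]
  rw [hres]
  exact ChartRep.sum _ _ fun i hi => (hrep i B (hB.trans (Set.biInter_subset_of_mem hi)) hBc hBo).smul
    (c i) (hc i)

/-- Substitution of `c l * y l ^ D` for the coordinates in `s`. -/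
noncomputable def powSubst (s : Finset (Fin n)) (c : Fin n → ℚ_[p]) (D : ℕ) (y : Fin n → ℚ_[p]) :
    Fin n → ℚ_[p] :=
  fun l => if l ∈ s then c l * y l ^ D else y l

theorem LocCov.of_powSubst {D : ℕ} (hD : D ≠ 0) (s : Finset (Fin (n + 1)))
    {P : ((Fin (n + 1) → ℚ_[p]) → Fin (n + 1) → ℚ_[p]) →
      ((Fin (n + 1) → ℚ_[p]) → ℚ_[p]) → (Fin (n + 1) → ℚ_[p]) → Prop}
    (h : ∀ c : Fin (n + 1) → ℚ_[p], (∀ l, c l ≠ 0) → LocCov (chartPull (powSubst s c D)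
      (fun y => ∏ l ∈ s, y l ^ (D - 1)) P) 0) : LocCov P 0 := by
  induction s using Finset.induction_on with
  | empty =>
    have := h (fun _ => 1) (fun _ => one_ne_zero)
    have e : chartPull (powSubst ∅ (fun _ => 1) D) (fun y => ∏ l ∈ ∅, y l ^ (D - 1)) P = P := by
      funext φ j y
      have h1 : ∀ x : Fin (n + 1) → ℚ_[p], powSubst ∅ (fun _ => 1) D x = x := fun x => by
        funext l
        simp [powSubst]
      simp [chartPull, h1]
    rwa [e] at this
  | insert k s hk ih =>
    refine ih fun c hc => LocCov.of_pow_update k hD fun a ha => ?_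
    rw [chartPull_chartPull]
    have h1 := h (Function.update c k a) fun l => by
      by_cases hl : l = k
      · subst hl; simpa
      · simpa [hl] using hc l
    have e1 : (fun y => powSubst s c D (Function.update y k (a * y k ^ D))) =
        powSubst (insert k s) (Function.update c k a) D := by
      funext y l
      by_cases hl : l = k
      · subst hl; simp [powSubst, hk]
      · simp [powSubst, hl]
    have e2 : (fun y : Fin (n + 1) → ℚ_[p] =>
        (∏ l ∈ s, Function.update y k (a * y k ^ D) l ^ (D - 1)) * y k ^ (D - 1)) =
        fun y => ∏ l ∈ insert k s, y l ^ (D - 1) := by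
      funext y
      rw [Finset.prod_insert hk, mul_comm]
      congr 1
      refine Finset.prod_congr rfl fun l hl => ?_
      rw [Function.update_of_ne (ne_of_mem_of_not_mem hl hk)]
    rw [e1, e2]
    exact h1

end PowerRule

end

section

open Filter Topology MeasureTheory
open scoped ENNReal NNReal

set_option linter.unusedSectionVars false

section Lift

variable {p : ℕ} [Fact p.Prime] {n : ℕ}
variable [MeasureSpace ℚ_[p]] [BorelSpace ℚ_[p]] [(volume : Measure ℚ_[p]).IsAddHaarMeasure]

variable {P : ((Fin n → ℚ_[p]) → Fin n → ℚ_[p]) →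
    ((Fin n → ℚ_[p]) → ℚ_[p]) → (Fin n → ℚ_[p]) → Prop}

theorem ChartRep.sFinite {ν : Measure (Fin n → ℚ_[p])} (h : ChartRep P ν) : SFinite ν := by
  induction h with
  | zero => infer_instance
  | add _ _ h1 h2 => infer_instance
  | smul c hc _ h => infer_instance
  | leaf B φ j hB hBo hφ hj h => infer_instance

theorem ChartRep.restrict {ν : Measure (Fin n → ℚ_[p])} (h : ChartRep P ν)
    {W : Set (Fin n → ℚ_[p])} (hW : IsClopen W) :
    ChartRep (fun φ j y => φ y ∈ W ∧ P φ j y) (ν.restrict W) := by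
  induction h with
  | zero => rw [Measure.restrict_zero]; exact .zero
  | add _ _ h1 h2 => rw [Measure.restrict_add]; exact h1.add h2
  | smul c hc _ h => rw [Measure.restrict_smul]; exact h.smul c hc
  | leaf B φ j hB hBo hφ hj h =>
    have hWp := hW.preimage hφ
    rw [Measure.restrict_map hφ.measurable hW.isOpen.measurableSet,
      restrict_withDensity hWp.isOpen.measurableSet,
      Measure.restrict_restrict hWp.isOpen.measurableSet, Set.inter_comm]
    exact .leaf _ φ j (hB.inter_right hWp.isClosed) (hBo.inter hWp.isOpen) hφ hj
      fun y hy => ⟨hy.2, h y hy.1⟩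

/-- The predicate satisfied by charts in `n + 1` variables that leave the zeroth coordinate fixed
and act on the others by a chart satisfying `P`. -/
def liftChart (P : ((Fin n → ℚ_[p]) → Fin n → ℚ_[p]) →
    ((Fin n → ℚ_[p]) → ℚ_[p]) → (Fin n → ℚ_[p]) → Prop)
    (φ : (Fin (n + 1) → ℚ_[p]) → Fin (n + 1) → ℚ_[p]) (j : (Fin (n + 1) → ℚ_[p]) → ℚ_[p])
    (w : Fin (n + 1) → ℚ_[p]) : Prop :=
  ∃ (ψ : (Fin n → ℚ_[p]) → Fin n → ℚ_[p]) (k : (Fin n → ℚ_[p]) → ℚ_[p]),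
    Continuous ψ ∧ Continuous k ∧ P ψ k (Fin.tail w) ∧
    φ = (fun w => Fin.cons (w 0) (ψ (Fin.tail w))) ∧ j = fun w => k (Fin.tail w)

theorem continuous_tail : Continuous fun w : Fin (n + 1) → ℚ_[p] => Fin.tail w :=
  continuous_pi fun k => continuous_apply k.succ

theorem map_prod_leaf (T : Set ℚ_[p]) (hT : MeasurableSet T) {C : Set (Fin n → ℚ_[p])}
    (hC : MeasurableSet C) {ψ : (Fin n → ℚ_[p]) → Fin n → ℚ_[p]} (hψ : Continuous ψ)
    {k : (Fin n → ℚ_[p]) → ℚ_[p]} (hk : Continuous k) :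
    ((volume.restrict T).prod (((volume.restrict C).withDensity fun y => ‖k y‖ₑ).map ψ)).map
      (MeasurableEquiv.piFinSuccAbove (fun _ : Fin (n + 1) => ℚ_[p]) 0).symm =
    ((volume.restrict {w : Fin (n + 1) → ℚ_[p] | w 0 ∈ T ∧ Fin.tail w ∈ C}).withDensity
      fun w => ‖k (Fin.tail w)‖ₑ).map (fun w => Fin.cons (w 0) (ψ (Fin.tail w))) := by
  have he := volume_preserving_piFinSuccAbove (fun _ : Fin (n + 1) => ℚ_[p]) 0
  set e := MeasurableEquiv.piFinSuccAbove (fun _ : Fin (n + 1) => ℚ_[p]) 0 with hedef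
  have hte : ∀ q : ℚ_[p] × (Fin n → ℚ_[p]), e.symm q = Fin.cons q.1 q.2 := fun q => by
    simp [hedef, MeasurableEquiv.piFinSuccAbove]
    rfl
  have hΨ : Continuous fun w : Fin (n + 1) → ℚ_[p] =>
      (Fin.cons (w 0) (ψ (Fin.tail w)) : Fin (n + 1) → ℚ_[p]) :=
    continuous_pi fun l => by
      refine Fin.cases ?_ (fun l => ?_) l
      · exact continuous_apply 0
      · exact (continuous_apply l).comp (hψ.comp continuous_tail)
  have hset : MeasurableSet {w : Fin (n + 1) → ℚ_[p] | w 0 ∈ T ∧ Fin.tail w ∈ C} :=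
    ((measurable_pi_apply 0) hT).inter (continuous_tail.measurable hC)
  have hpre : e.symm ⁻¹' {w : Fin (n + 1) → ℚ_[p] | w 0 ∈ T ∧ Fin.tail w ∈ C} = T ×ˢ C := by
    ext q
    rw [Set.mem_preimage, hte]
    rfl
  have hkm : Measurable fun w : Fin (n + 1) → ℚ_[p] => ‖k (Fin.tail w)‖ₑ :=
    (hk.comp continuous_tail).measurable.enorm
  nth_rewrite 1 [← Measure.map_id (μ := volume.restrict T)]
  rw [Measure.map_prod_map _ _ measurable_id hψ.measurable,
    Measure.map_map e.symm.measurable (measurable_id.prodMap hψ.measurable),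
    prod_withDensity_right hk.measurable.enorm, Measure.prod_restrict,
    ← he.symm.map_eq, Measure.restrict_map e.symm.measurable hset, hpre,
    withDensity_map_eq e.symm.measurable hkm, Measure.map_map hΨ.measurable e.symm.measurable]
  congr 1
  funext q
  simp [hte]

theorem ChartRep.lift {ν : Measure (Fin n → ℚ_[p])} (h : ChartRep P ν) {T : Set ℚ_[p]}
    (hT : IsCompact T) (hTo : IsOpen T) :
    ChartRep (liftChart P) (((volume.restrict T).prod ν).map
      (MeasurableEquiv.piFinSuccAbove (fun _ : Fin (n + 1) => ℚ_[p]) 0).symm) := by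
  induction h with
  | zero => simpa using ChartRep.zero
  | @add ν₁ ν₂ g1 g2 h1 h2 =>
    have := g1.sFinite
    have := g2.sFinite
    rw [Measure.prod_add, Measure.map_add _ _ (MeasurableEquiv.measurable _)]
    exact h1.add h2
  | @smul ν c hc g h =>
    have := g.sFinite
    rw [Measure.prod_smul_right, Measure.map_smul]
    exact h.smul c hc
  | leaf B φ j hB hBo hφ hj h =>
    rw [map_prod_leaf T hTo.measurableSet hBo.measurableSet hφ hj]
    have hcl : IsClosed {w : Fin (n + 1) → ℚ_[p] | w 0 ∈ T ∧ Fin.tail w ∈ B} :=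
      (hT.isClosed.preimage (continuous_apply 0)).inter (hB.isClosed.preimage continuous_tail)
    refine .leaf _ _ _ ?_ ?_ ?_ (hj.comp continuous_tail) fun y hy =>
      ⟨φ, j, hφ, hj, h _ hy.2, rfl, rfl⟩
    · refine ((hT.prod hB).image (f := fun q : ℚ_[p] × (Fin n → ℚ_[p]) =>
        (Fin.cons q.1 q.2 : Fin (n + 1) → ℚ_[p])) ?_).of_isClosed_subset hcl ?_
      · refine continuous_pi fun l => Fin.cases ?_ (fun l => ?_) l
        · exact continuous_fst
        · exact (continuous_apply l).comp continuous_snd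
      · intro w hw
        exact ⟨(w 0, Fin.tail w), ⟨hw.1, hw.2⟩, Fin.cons_self_tail w⟩
    · exact (hTo.preimage (continuous_apply 0)).inter (hBo.preimage continuous_tail)
    · refine continuous_pi fun l => Fin.cases ?_ (fun l => ?_) l
      · exact continuous_apply 0
      · exact (continuous_apply l).comp (hφ.comp continuous_tail)

theorem LocCov.lift {a : Fin n → ℚ_[p]} (h : LocCov P a) (t : ℚ_[p]) :
    LocCov (liftChart P) (Fin.cons t a : Fin (n + 1) → ℚ_[p]) := by
  obtain ⟨N, hN, h⟩ := h
  obtain ⟨r, hr, hrN⟩ := Metric.nhds_basis_closedBall.mem_iff.1 hN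
  have hrep := h _ hrN (isCompact_closedBall a r) (IsUltrametricDist.isOpen_closedBall a hr.ne')
  have hT : IsCompact (Metric.closedBall t 1) := isCompact_closedBall t 1
  have hTo : IsOpen (Metric.closedBall t 1) := IsUltrametricDist.isOpen_closedBall t one_ne_zero
  have hlift := ChartRep.lift hrep hT hTo
  have he := volume_preserving_piFinSuccAbove (fun _ : Fin (n + 1) => ℚ_[p]) 0
  set e := MeasurableEquiv.piFinSuccAbove (fun _ : Fin (n + 1) => ℚ_[p]) 0 with hedef
  have hte : ∀ q : ℚ_[p] × (Fin n → ℚ_[p]), e.symm q = Fin.cons q.1 q.2 := fun q => by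
    simp [hedef, MeasurableEquiv.piFinSuccAbove]
    rfl
  let W : Set (Fin (n + 1) → ℚ_[p]) :=
    {w | w 0 ∈ Metric.closedBall t 1 ∧ Fin.tail w ∈ Metric.closedBall a r}
  have hWo : IsOpen W := (hTo.preimage (f := fun w : Fin (n + 1) → ℚ_[p] => w 0)
    (continuous_apply 0)).inter
    ((IsUltrametricDist.isOpen_closedBall a hr.ne').preimage continuous_tail)
  have hpre : e.symm ⁻¹' W = Metric.closedBall t 1 ×ˢ Metric.closedBall a r := by
    ext q
    rw [Set.mem_preimage, hte]
    rfl
  refine ⟨W, hWo.mem_nhds ⟨Metric.mem_closedBall_self zero_le_one, ?_⟩, fun B hB hBc hBo => ?_⟩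
  · rw [Fin.tail_cons]
    exact Metric.mem_closedBall_self hr.le
  · have h2 := hlift.restrict (W := B) ⟨hBc.isClosed, hBo⟩
    rw [Measure.prod_restrict, ← hpre, ← Measure.restrict_map e.symm.measurable hWo.measurableSet,
      ← Measure.volume_eq_prod, he.symm.map_eq, Measure.restrict_restrict hBo.measurableSet,
      Set.inter_eq_left.2 hB] at h2
    refine h2.mono fun φ j y _ _ hy => ⟨hy.1, ?_⟩
    obtain ⟨ψ, k, hψ, hk, hP, h1, h2⟩ := hy.2
    exact ⟨ψ, k, hψ, hk, hP.2, h1, h2⟩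

end Lift

end

section

open Filter Topology MeasureTheory
open scoped ENNReal NNReal

set_option linter.unusedSectionVars false

section Resolution

variable {p : ℕ} [Fact p.Prime] {m n : ℕ}

/-- The chart `φ` with Jacobian `j` is analytic at `y` and makes `f` monomial at `y` and the members
of `L` zero or monomial at `y`, unless its Jacobian vanishes near `y`. -/
def IsResolved (f : (Fin n → ℚ_[p]) → ℚ_[p]) (L : List ((Fin n → ℚ_[p]) → ℚ_[p]))
    (φ : (Fin n → ℚ_[p]) → Fin n → ℚ_[p]) (j : (Fin n → ℚ_[p]) → ℚ_[p])
    (y : Fin n → ℚ_[p]) : Prop :=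
  AnalyticAt ℚ_[p] φ y ∧ AnalyticAt ℚ_[p] j y ∧
    ((∀ᶠ x in 𝓝 y, j x = 0) ∨ (IsMono j y ∧ IsMono (fun x => f (φ x)) y ∧
      ∀ g ∈ L, IsZM (fun x => g (φ x)) y))

theorem IsResolved.eventually {f : (Fin n → ℚ_[p]) → ℚ_[p]} {L : List ((Fin n → ℚ_[p]) → ℚ_[p])}
    {φ : (Fin n → ℚ_[p]) → Fin n → ℚ_[p]} {j : (Fin n → ℚ_[p]) → ℚ_[p]} {y : Fin n → ℚ_[p]}
    (h : IsResolved f L φ j y) : ∀ᶠ z in 𝓝 y, IsResolved f L φ j z := by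
  obtain ⟨h1, h2, h3⟩ := h
  have h4 : ∀ᶠ z in 𝓝 y, (∀ᶠ x in 𝓝 z, j x = 0) ∨ (IsMono j z ∧ IsMono (fun x => f (φ x)) z ∧
      ∀ g ∈ L, IsZM (fun x => g (φ x)) z) := by
    rcases h3 with h3 | ⟨h3, h4, h5⟩
    · exact h3.eventually_nhds.mono fun z hz => Or.inl hz
    · have h6 : ∀ᶠ z in 𝓝 y, ∀ g ∈ L, IsZM (fun x => g (φ x)) z := by
        induction L with
        | nil => simp
        | cons g L ih =>
          simp only [List.mem_cons, forall_eq_or_imp] at h5 ⊢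
          exact h5.1.eventually.and (ih h5.2)
      filter_upwards [h3.eventually, h4.eventually, h6] with z a b c
      exact Or.inr ⟨a, b, c⟩
  filter_upwards [h1.eventually_analyticAt, h2.eventually_analyticAt, h4] with z a b c
  exact ⟨a, b, c⟩

theorem IsMono.comp_tail {g : (Fin n → ℚ_[p]) → ℚ_[p]} {w : Fin (n + 1) → ℚ_[p]}
    (h : IsMono g (Fin.tail w)) : IsMono (fun x : Fin (n + 1) → ℚ_[p] => g (Fin.tail x)) w :=
  IsMono.comp h (analyticAt_tail w) fun i => isMono_coord_sub i.succ _ w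

theorem IsZM.comp_tail {g : (Fin n → ℚ_[p]) → ℚ_[p]} {w : Fin (n + 1) → ℚ_[p]}
    (h : IsZM g (Fin.tail w)) : IsZM (fun x : Fin (n + 1) → ℚ_[p] => g (Fin.tail x)) w :=
  IsZM.comp h (analyticAt_tail w) fun i => isMono_coord_sub i.succ _ w

theorem IsZM.analyticAt {g : (Fin n → ℚ_[p]) → ℚ_[p]} {y : Fin n → ℚ_[p]} (h : IsZM g y) :
    AnalyticAt ℚ_[p] g y := by
  rcases h with h | h
  · exact analyticAt_const.congr (h.mono fun x hx => hx.symm)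
  · exact h.analyticAt

variable [MeasureSpace ℚ_[p]] [BorelSpace ℚ_[p]] [(volume : Measure ℚ_[p]).IsAddHaarMeasure]

theorem LocCov.of_isResolved {f : (Fin n → ℚ_[p]) → ℚ_[p]} {L : List ((Fin n → ℚ_[p]) → ℚ_[p])}
    {φ : (Fin n → ℚ_[p]) → Fin n → ℚ_[p]} {j : (Fin n → ℚ_[p]) → ℚ_[p]} {y : Fin n → ℚ_[p]}
    (h : IsResolved f L φ j y) : LocCov (chartPull φ j (IsResolved f L)) y := by
  refine LocCov.of_id (h.eventually.mono fun z hz => ?_)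
  simpa [chartPull] using hz

theorem LocCov.isResolved_comp {f f₁ : (Fin n → ℚ_[p]) → ℚ_[p]}
    {L L₁ : List ((Fin n → ℚ_[p]) → ℚ_[p])} {φ : (Fin n → ℚ_[p]) → Fin n → ℚ_[p]}
    {j : (Fin n → ℚ_[p]) → ℚ_[p]} {a : Fin n → ℚ_[p]} (hφ : AnalyticAt ℚ_[p] φ a)
    (hj : AnalyticAt ℚ_[p] j a) (d : ℕ) (hf : ∀ᶠ x in 𝓝 a, f (φ x) = j x ^ d * f₁ x)
    (hL : ∀ g ∈ L, (fun x => g (φ x)) ∈ L₁) (hjL : j ∈ L₁) (h : LocCov (IsResolved f₁ L₁) a) :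
    LocCov (chartPull φ j (IsResolved f L)) a := by
  refine h.mono ?_
  filter_upwards [hφ.eventually_analyticAt, hj.eventually_analyticAt, hf.eventually_nhds]
    with x h1 h2 h3 ψ k y hψ hk hyx hres
  subst hyx
  obtain ⟨g1, g2, g3⟩ := hres
  refine ⟨h1.comp g1, (h2.comp g1).mul g2, ?_⟩
  rcases g3 with g3 | ⟨g3, g4, g5⟩
  · exact Or.inl (g3.mono fun x hx => by simp [hx])
  · rcases g5 j hjL with h0 | h0
    · exact Or.inl (h0.mono fun x hx => by simp only [hx, zero_mul])
    · refine Or.inr ⟨h0.mul g3, ((h0.pow d).mul g4).congr (hψ.continuousAt.eventually h3),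
        fun g hg => g5 _ (hL g hg)⟩

/-- Local monomialisation of analytic germs in `n` variables. -/
def Resolvable (p n : ℕ) [Fact p.Prime] [MeasureSpace ℚ_[p]] : Prop :=
  ∀ (a : Fin n → ℚ_[p]) (f : (Fin n → ℚ_[p]) → ℚ_[p]) (L : List ((Fin n → ℚ_[p]) → ℚ_[p])),
    AnalyticAt ℚ_[p] f a → (¬ ∀ᶠ x in 𝓝 a, f x = 0) → (∀ g ∈ L, AnalyticAt ℚ_[p] g a) →
    LocCov (IsResolved f L) a

/-- Local monomialisation of germs in `n + 1` variables whose order in the zeroth variable is less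
than `d`. -/
def ResolvableOrder (p n d : ℕ) [Fact p.Prime] [MeasureSpace ℚ_[p]] : Prop :=
  ∀ (w : Fin (n + 1) → ℚ_[p]) (f : (Fin (n + 1) → ℚ_[p]) → ℚ_[p])
    (L : List ((Fin n → ℚ_[p]) → ℚ_[p])), AnalyticAt ℚ_[p] f w → (∃ i < d, (dzero^[i] f) w ≠ 0) →
    (∀ g ∈ L, AnalyticAt ℚ_[p] g (Fin.tail w)) →
    LocCov (IsResolved f (L.map fun g x => g (Fin.tail x))) w

theorem resolvable_zero : Resolvable p 0 := by
  intro a f L hf h0 hL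
  have hn : 𝓝 a = pure a := nhds_discrete (Fin 0 → ℚ_[p]) ▸ rfl
  refine LocCov.of_id ?_
  rw [hn, eventually_pure]
  rw [hn, eventually_pure] at h0
  refine ⟨analyticAt_id, analyticAt_const, Or.inr ⟨isMono_const one_ne_zero a,
    IsMono.of_ne_zero hf h0, fun g hg => ?_⟩⟩
  by_cases h : g a = 0
  · exact Or.inl (by rw [hn, eventually_pure]; exact h)
  · exact Or.inr (IsMono.of_ne_zero (hL g hg) h)

theorem resolvable_succ (h : ∀ d, ResolvableOrder p n d) : Resolvable p (n + 1) := by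
  classical
  intro a f L hf h0 hL
  let M : List ((Fin (n + 1) → ℚ_[p]) → ℚ_[p]) := L.filter fun g => ¬ ∀ᶠ x in 𝓝 a, g x = 0
  have hM : ∀ M' : List ((Fin (n + 1) → ℚ_[p]) → ℚ_[p]), (∀ g ∈ M', AnalyticAt ℚ_[p] g a) →
      (∀ g ∈ M', ¬ ∀ᶠ x in 𝓝 a, g x = 0) → ∃ F : (Fin (n + 1) → ℚ_[p]) → ℚ_[p],
        AnalyticAt ℚ_[p] F a ∧ (¬ ∀ᶠ x in 𝓝 a, F x = 0) ∧
        ∀ᶠ x in 𝓝 a, ∀ (φ : (Fin (n + 1) → ℚ_[p]) → Fin (n + 1) → ℚ_[p]) y, φ y = x →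
          AnalyticAt ℚ_[p] φ y → IsMono (fun x => F (φ x)) y → IsMono (fun x => f (φ x)) y ∧
          ∀ g ∈ M', IsMono (fun x => g (φ x)) y := by
    intro M'
    induction M' with
    | nil => exact fun _ _ => ⟨f, hf, h0, by simp +contextual⟩
    | cons g M' ih =>
      intro h1 h2
      simp only [List.mem_cons, forall_eq_or_imp] at h1 h2
      obtain ⟨F, hF, hF0, hF1⟩ := ih h1.2 h2.2
      refine ⟨fun x => F x * g x, hF.mul h1.1, fun hz => ?_, ?_⟩
      · rcases hF.eventually_eq_zero_of_mul h1.1 hz with h3 | h3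
        · exact hF0 h3
        · exact h2.1 h3
      · filter_upwards [hF1, hF.eventually_analyticAt, h1.1.eventually_analyticAt]
          with x hx a1 a2 φ y hyx hφ hm
        subst hyx
        obtain ⟨m1, m2⟩ := IsMono.of_mul (a1.comp hφ) (a2.comp hφ) hm
        obtain ⟨m3, m4⟩ := hx φ y rfl hφ m1
        refine ⟨m3, ?_⟩
        simp only [List.mem_cons, forall_eq_or_imp]
        exact ⟨m2, m4⟩
  obtain ⟨F, hF, hF0, hF1⟩ := hM M (fun g hg => hL g (List.mem_filter.1 hg).1)
    (fun g hg => by simpa using (List.mem_filter.1 hg).2)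
  obtain ⟨v, hv, hvF⟩ := exists_direction hF hF0
  have hu : (v - Pi.single 0 1 : Fin (n + 1) → ℚ_[p]) 0 = 0 := by simp [hv]
  set Θ := linearShearHomeo (v - Pi.single 0 1) hu with hΘ
  have hΘe : ∀ w, Θ w = w + w 0 • (v - Pi.single 0 1) := fun w => rfl
  obtain ⟨w, rfl⟩ := Θ.surjective a
  have hΘa : AnalyticAt ℚ_[p] Θ w := by
    have : AnalyticAt ℚ_[p] (fun w : Fin (n + 1) → ℚ_[p] => w + w 0 • (v - Pi.single 0 1)) w :=
      analyticAt_id.add ((analyticAt_coord 0 w).smul analyticAt_const)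
    exact this
  have hz : ∀ L : List ((Fin (n + 1) → ℚ_[p]) → ℚ_[p]), ∀ᶠ x in 𝓝 (Θ w), ∀ g ∈ L,
      (∀ᶠ x in 𝓝 (Θ w), g x = 0) → ∀ᶠ x' in 𝓝 x, g x' = 0 := by
    intro L
    induction L with
    | nil => simp
    | cons g L ih =>
      simp only [List.mem_cons, forall_eq_or_imp]
      refine Eventually.and ?_ ih
      by_cases hg : ∀ᶠ x in 𝓝 (Θ w), g x = 0
      · exact hg.eventually_nhds.mono fun x hx _ => hx
      · exact Eventually.of_forall fun x h => (hg h).elim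
  have key : LocCov (IsResolved F []) (Θ w) := by
    refine LocCov.of_homeomorph Θ (measurePreserving_linearShearHomeo _ hu) ?_
    obtain ⟨i, hi⟩ := exists_dzero_ne_zero (F := fun x => F (Θ x)) (hF.comp hΘa) (by
      have : ∀ s : ℚ_[p], Θ (w + s • Pi.single 0 1) = Θ w + s • v := by
        intro s
        rw [hΘe, hΘe]
        simp only [Pi.add_apply, Pi.smul_apply, Pi.single_eq_same, smul_eq_mul, mul_one]
        module
      simpa only [this] using hvF)
    have := h (i + 1) w (fun x => F (Θ x)) [fun _ => 1] (hF.comp hΘa) ⟨i, lt_add_one i, hi⟩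
      (by simpa using analyticAt_const)
    exact LocCov.isResolved_comp hΘa analyticAt_const 0 (Eventually.of_forall fun x => by simp)
      (by simp) (by simp) this
  refine key.mono ?_
  filter_upwards [hF1, hz L] with x h1 h2 φ j y hφ hj hyx hres
  obtain ⟨g1, g2, g3⟩ := hres
  refine ⟨g1, g2, g3.imp_right fun g3 => ?_⟩
  obtain ⟨m1, m2⟩ := h1 φ y hyx g1 g3.2.1
  refine ⟨g3.1, m1, fun g hg => ?_⟩
  by_cases hg0 : ∀ᶠ x in 𝓝 (Θ w), g x = 0
  · subst hyx
    exact Or.inl (hφ.continuousAt.eventually (h2 g hg hg0))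
  · exact Or.inr (m2 g (List.mem_filter.2 ⟨hg, by simpa using hg0⟩))

end Resolution

end

section

open Filter Topology MeasureTheory
open scoped ENNReal NNReal

set_option linter.unusedSectionVars false

section Newton

variable {p : ℕ} [Fact p.Prime] {n : ℕ}

/-- A germ of degree `e + 1` in the zeroth variable, without term of degree `e`, whose coefficients
are divisible by powers of the monomial with exponent `β`. -/
def newtonForm {𝕜 : Type*} [Field 𝕜] (e : ℕ) (β : Fin n → ℕ) (b : ℕ → (Fin n → 𝕜) → 𝕜)
    (U : (Fin (n + 1) → 𝕜) → 𝕜) (x : Fin (n + 1) → 𝕜) : 𝕜 :=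
  ∑ i ∈ Finset.range e, (∏ l : Fin n, x l.succ ^ β l) ^ (e + 1 - i) * b i (Fin.tail x) * x 0 ^ i
    + x 0 ^ (e + 1) * U x

theorem analyticAt_newtonForm {e : ℕ} {β : Fin n → ℕ} {b : ℕ → (Fin n → ℚ_[p]) → ℚ_[p]}
    {U : (Fin (n + 1) → ℚ_[p]) → ℚ_[p]} {w : Fin (n + 1) → ℚ_[p]}
    (hb : ∀ i, AnalyticAt ℚ_[p] (b i) (Fin.tail w)) (hU : AnalyticAt ℚ_[p] U w) :
    AnalyticAt ℚ_[p] (newtonForm e β b U) w := by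
  unfold newtonForm
  refine AnalyticAt.add (Finset.analyticAt_fun_sum _ fun i _ => ?_)
    (((analyticAt_coord 0 w).pow _).mul hU)
  exact (((Finset.analyticAt_fun_prod _ fun l _ => (analyticAt_coord l.succ w).pow _).pow _).mul
    ((hb i).comp (analyticAt_tail w))).mul ((analyticAt_coord 0 w).pow _)

theorem prod_pow_eq_mul_prod_update {𝕜 : Type*} [Field 𝕜] (x : Fin n → 𝕜) (β : Fin n → ℕ)
    {k : Fin n} (h : β k ≠ 0) :
    ∏ l, x l ^ β l = x k * ∏ l, x l ^ (Function.update β k (β k - 1) l) := by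
  rw [← Finset.mul_prod_erase _ _ (Finset.mem_univ k),
    ← Finset.mul_prod_erase _ (fun l => x l ^ (Function.update β k (β k - 1) l))
      (Finset.mem_univ k), ← mul_assoc]
  congr 1
  · simp only [Function.update_self]
    rw [← pow_succ']
    congr 1
    omega
  · refine Finset.prod_congr rfl fun l hl => ?_
    rw [Function.update_of_ne (Finset.ne_of_mem_erase hl)]

theorem newtonForm_update_zero {𝕜 : Type*} [Field 𝕜] (e : ℕ) {β : Fin n → ℕ}
    (b : ℕ → (Fin n → 𝕜) → 𝕜) (U : (Fin (n + 1) → 𝕜) → 𝕜) {k : Fin n} (h : β k ≠ 0)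
    (y : Fin (n + 1) → 𝕜) :
    newtonForm e β b U (Function.update y 0 (y k.succ * y 0)) = y k.succ ^ (e + 1) *
      newtonForm e (Function.update β k (β k - 1)) b
        (fun y => U (Function.update y 0 (y k.succ * y 0))) y := by
  unfold newtonForm
  have ht : Fin.tail (Function.update y 0 (y k.succ * y 0)) = Fin.tail y := by
    simp
  simp only [ht, Function.update_self]
  rw [mul_add, Finset.mul_sum]
  congr 1
  · refine Finset.sum_congr rfl fun i hi => ?_
    have hi' : i < e := Finset.mem_range.1 hi
    have h1 : ∏ l : Fin n, (Function.update y 0 (y k.succ * y 0)) l.succ ^ β l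
        = y k.succ * ∏ l : Fin n, y l.succ ^ (Function.update β k (β k - 1) l) := by
      rw [← prod_pow_eq_mul_prod_update (fun l : Fin n => y l.succ) β h]
      exact Finset.prod_congr rfl fun l _ => by rw [Function.update_of_ne (Fin.succ_ne_zero l)]
    have h2 : y k.succ ^ (e + 1) = y k.succ ^ (e + 1 - i) * y k.succ ^ i := by
      rw [← pow_add]; congr 1; omega
    rw [h1, mul_pow, mul_pow, h2]
    ring
  · ring

theorem newtonForm_update_succ {𝕜 : Type*} [Field 𝕜] (e : ℕ) {β : Fin n → ℕ}
    (b : ℕ → (Fin n → 𝕜) → 𝕜) (U : (Fin (n + 1) → 𝕜) → 𝕜) {k : Fin n} (h : β k ≠ 0)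
    (y : Fin (n + 1) → 𝕜) :
    newtonForm e β b U (Function.update y k.succ (y 0 * y k.succ)) = y 0 ^ (e + 1) *
      (∑ i ∈ Finset.range e, (y 0 ^ (β k - 1) * ∏ l : Fin n, y l.succ ^ β l) ^ (e + 1 - i) *
        b i (Fin.tail (Function.update y k.succ (y 0 * y k.succ))) +
        U (Function.update y k.succ (y 0 * y k.succ))) := by
  unfold newtonForm
  rw [mul_add, Finset.mul_sum, Function.update_of_ne (Fin.succ_ne_zero k).symm]
  congr 1
  refine Finset.sum_congr rfl fun i hi => ?_
  have hi' : i < e := Finset.mem_range.1 hi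
  have h1 : ∏ l : Fin n, (Function.update y k.succ (y 0 * y k.succ)) l.succ ^ β l
      = y 0 * (y 0 ^ (β k - 1) * ∏ l : Fin n, y l.succ ^ β l) := by
    rw [← mul_assoc, ← pow_succ', ← Finset.mul_prod_erase _ _ (Finset.mem_univ k),
      ← Finset.mul_prod_erase _ (fun l : Fin n => y l.succ ^ β l) (Finset.mem_univ k), ← mul_assoc]
    congr 1
    · rw [Function.update_self, mul_pow]
      congr 2
      omega
    · refine Finset.prod_congr rfl fun l hl => ?_
      rw [Function.update_of_ne fun hh => Finset.ne_of_mem_erase hl (Fin.succ_injective _ hh)]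
  have h2 : y 0 ^ (e + 1) = y 0 ^ (e + 1 - i) * y 0 ^ i := by
    rw [← pow_add]; congr 1; omega
  rw [h1, mul_pow _ _ (e + 1 - i), h2]
  ring

theorem iteratedDeriv_polynomial_eval (P : Polynomial ℚ_[p]) (k : ℕ) (s : ℚ_[p]) :
    iteratedDeriv k (fun s => P.eval s) s = (Polynomial.derivative^[k] P).eval s := by
  induction k generalizing P with
  | zero => simp
  | succ k ih =>
    rw [iteratedDeriv_succ', Function.iterate_succ_apply, ← ih]
    congr 1
    ext s
    exact P.deriv

theorem dzero_ne_zero_of_polynomial {F : (Fin (n + 1) → ℚ_[p]) → ℚ_[p]} {e : ℕ} {c : ℕ → ℚ_[p]}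
    {u t : ℚ_[p]} {w : Fin (n + 1) → ℚ_[p]} (hu : u ≠ 0) (ht : t ≠ 0)
    (h : ∀ s : ℚ_[p], F (w + s • Pi.single 0 1)
      = ∑ i ∈ Finset.range e, c i * (t + s) ^ i + (t + s) ^ (e + 1) * u) :
    (dzero^[e] F) w ≠ 0 := by
  open Polynomial in
  let P : ℚ_[p][X] := ∑ i ∈ Finset.range e, C (c i) * X ^ i + C u * X ^ (e + 1)
  have hP : ∀ s, P.eval (t + s) = F (w + s • Pi.single 0 1) := by
    intro s
    rw [h s]
    simp [P, Polynomial.eval_finsetSum]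
    ring
  rw [dzero_iterate_zero]
  have h1 : (fun s : ℚ_[p] => F (w + s • Pi.single 0 1)) = fun s => (fun s => P.eval s) (t + s) := by
    ext s; rw [← hP]
  rw [h1, congrFun (iteratedDeriv_comp_const_add e (fun s => P.eval s) t) 0]
  simp only [add_zero]
  rw [iteratedDeriv_polynomial_eval]
  simp only [P]
  rw [iterate_map_add, Polynomial.iterate_derivative_sum, Finset.sum_eq_zero, zero_add, Polynomial.iterate_derivative_C_mul,
    Polynomial.iterate_derivative_X_pow_eq_smul]
  · simp only [Nat.add_sub_cancel_left, pow_one]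
    simp only [Polynomial.eval_mul, Polynomial.eval_C, Polynomial.eval_smul, Polynomial.eval_X]
    refine mul_ne_zero hu ?_
    rw [smul_eq_mul]
    refine mul_ne_zero ?_ ht
    exact_mod_cast (Nat.descFactorial_pos.2 (Nat.le_succ e)).ne'
  · intro i hi
    refine Polynomial.iterate_derivative_eq_zero ?_
    exact (Polynomial.natDegree_C_mul_X_pow_le _ _).trans_lt (Finset.mem_range.1 hi)

theorem analyticAt_update_coord {m : ℕ} (i : Fin m) {g : (Fin m → ℚ_[p]) → ℚ_[p]}
    {y : Fin m → ℚ_[p]} (hg : AnalyticAt ℚ_[p] g y) :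
    AnalyticAt ℚ_[p] (fun x => Function.update x i (g x)) y := by
  rw [analyticAt_pi_iff]
  intro l
  by_cases h : l = i
  · subst h; simpa using hg
  · simpa [h] using analyticAt_coord l y

variable [MeasureSpace ℚ_[p]] [BorelSpace ℚ_[p]] [(volume : Measure ℚ_[p]).IsAddHaarMeasure]

theorem locCov_newtonForm {e : ℕ} (hIR : ResolvableOrder p n (e + 1)) (N : ℕ) :
    ∀ (β : Fin n → ℕ), ∑ l, β l = N → ∀ (f : (Fin (n + 1) → ℚ_[p]) → ℚ_[p])
      (b : ℕ → (Fin n → ℚ_[p]) → ℚ_[p]) (U : (Fin (n + 1) → ℚ_[p]) → ℚ_[p])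
      (L : List ((Fin n → ℚ_[p]) → ℚ_[p])), (∀ i, AnalyticAt ℚ_[p] (b i) 0) →
      AnalyticAt ℚ_[p] U 0 → U 0 ≠ 0 → (∃ i < e, b i 0 ≠ 0) → (∀ g ∈ L, IsZM g 0) →
      (∀ᶠ x in 𝓝 0, f x = newtonForm e β b U x) →
      LocCov (IsResolved f (L.map fun g x => g (Fin.tail x))) 0 := by
  have ht0 : (Fin.tail (0 : Fin (n + 1) → ℚ_[p])) = 0 := rfl
  induction N with
  | zero =>
    intro β hβ f b U L hb hU hU0 hi hL hf
    have hβ0 : ∀ l, β l = 0 := by simpa using hβ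
    obtain ⟨i, hie, hi⟩ := hi
    have hfa : AnalyticAt ℚ_[p] f 0 :=
      (analyticAt_newtonForm (w := 0) hb hU).congr (hf.mono fun x hx => hx.symm)
    refine hIR 0 f L hfa ⟨i, by omega, ?_⟩ fun g hg => (hL g hg).analyticAt
    have hc : (Fin.cons 0 0 : Fin (n + 1) → ℚ_[p]) = 0 := Fin.cons_self_tail (0 : Fin (n + 1) → ℚ_[p])
    have := (dzero_of_expansion (F := f) (U := fun x => x 0 * U x) (A := b) (x := 0) (d := e)
      (by rw [hc]; exact (analyticAt_coord 0 _).mul hU) (by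
        rw [hc]
        filter_upwards [hf] with x hx
        rw [hx]
        simp [newtonForm, hβ0]
        ring)).1 i hie
    rw [hc] at this
    rw [this]
    exact mul_ne_zero (by exact_mod_cast i.factorial_ne_zero) hi
  | succ N ih =>
    intro β hβ f b U L hb hU hU0 hi hL hf
    obtain ⟨k, hk⟩ : ∃ k, β k ≠ 0 := by
      by_contra! h
      simp [h] at hβ
    have hβ' : ∑ l, (Function.update β k (β k - 1)) l = N := by
      rw [Finset.sum_update_of_mem (Finset.mem_univ k)]
      rw [← Finset.add_sum_erase _ _ (Finset.mem_univ k), ← Finset.sdiff_singleton_eq_erase] at hβ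
      omega
    set G : (Fin (n + 1) → ℚ_[p]) → ℚ_[p] := fun y => ∑ i ∈ Finset.range e,
        (y 0 ^ (β k - 1) * ∏ l : Fin n, y l.succ ^ β l) ^ (e + 1 - i) *
        b i (Fin.tail (Function.update y k.succ (y 0 * y k.succ))) +
        U (Function.update y k.succ (y 0 * y k.succ)) with hG
    have hσB : ∀ s : ℚ_[p], Function.update (Pi.single k.succ s : Fin (n + 1) → ℚ_[p]) k.succ
        ((Pi.single k.succ s : Fin (n + 1) → ℚ_[p]) 0 *
          (Pi.single k.succ s : Fin (n + 1) → ℚ_[p]) k.succ) = 0 := by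
      intro s
      ext l
      by_cases hl : l = k.succ
      · subst hl; simp
      · simp [hl]
    have hσBa : ∀ y : Fin (n + 1) → ℚ_[p], AnalyticAt ℚ_[p]
        (fun y : Fin (n + 1) → ℚ_[p] => Function.update y k.succ (y 0 * y k.succ)) y := fun y =>
      analyticAt_update_coord _ ((analyticAt_coord 0 y).mul (analyticAt_coord k.succ y))
    have hGa : ∀ s : ℚ_[p], AnalyticAt ℚ_[p] G (Pi.single k.succ s) := by
      intro s
      have hU' : AnalyticAt ℚ_[p] U (Function.update (Pi.single k.succ s : Fin (n + 1) → ℚ_[p])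
          k.succ ((Pi.single k.succ s : Fin (n + 1) → ℚ_[p]) 0 *
          (Pi.single k.succ s : Fin (n + 1) → ℚ_[p]) k.succ)) := by rw [hσB s]; exact hU
      refine AnalyticAt.add (Finset.analyticAt_fun_sum _ fun i _ => ?_)
        (AnalyticAt.comp hU' (hσBa _))
      refine AnalyticAt.mul ((((analyticAt_coord 0 _).pow _).mul
        (Finset.analyticAt_fun_prod _ fun l _ => (analyticAt_coord l.succ _).pow _)).pow _) ?_
      have hb' : AnalyticAt ℚ_[p] (b i) (Fin.tail (Function.update
          (Pi.single k.succ s : Fin (n + 1) → ℚ_[p])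
          k.succ ((Pi.single k.succ s : Fin (n + 1) → ℚ_[p]) 0 *
          (Pi.single k.succ s : Fin (n + 1) → ℚ_[p]) k.succ))) := by rw [hσB s]; exact hb i
      exact AnalyticAt.comp hb' ((analyticAt_tail _).comp (hσBa _))
    have hG0 : G 0 = U 0 := by
      have h1 : (∏ l : Fin n, (0 : ℚ_[p]) ^ β l) = 0 :=
        Finset.prod_eq_zero (Finset.mem_univ k) (zero_pow hk)
      have h2 : Function.update (0 : Fin (n + 1) → ℚ_[p]) k.succ 0 = 0 := Function.update_eq_self k.succ 0
      simp only [hG, Pi.zero_apply, h1, mul_zero, h2]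
      rw [Finset.sum_eq_zero, zero_add]
      intro i hi
      have := Finset.mem_range.1 hi
      rw [zero_pow (by omega), zero_mul]
    have hGc : ContinuousAt (fun s : ℚ_[p] => G (Pi.single k.succ s)) 0 := by
      have h1 : ContinuousAt G (Pi.single k.succ (0 : ℚ_[p])) := (hGa 0).continuousAt
      exact ContinuousAt.comp (f := fun s : ℚ_[p] => (Pi.single k.succ s : Fin (n + 1) → ℚ_[p])) h1
        (continuous_single k.succ).continuousAt
    have hGne : ∀ᶠ s in 𝓝 (0 : ℚ_[p]), G (Pi.single k.succ s) ≠ 0 :=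
      hGc.eventually_ne (by rw [Pi.single_zero, hG0]; exact hU0)
    obtain ⟨ε, hε, hGε⟩ := Metric.eventually_nhds_iff.1 hGne
    refine LocCov.blowup k (inv_pos.2 hε) (fun t _ => ?_) (fun s hs => ?_)
    · set w : Fin (n + 1) → ℚ_[p] := Pi.single 0 t with hw
      have hwk : w k.succ = 0 := by simp [hw]
      have hσ : Function.update w 0 (w k.succ * w 0) = 0 := by
        rw [hwk, zero_mul]
        ext l
        by_cases hl : l = 0
        · subst hl; simp
        · simp [hw, hl]
      have htw : Fin.tail w = 0 := by
        ext l; simp [hw, Fin.tail]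
      have hσa : AnalyticAt ℚ_[p]
          (fun y : Fin (n + 1) → ℚ_[p] => Function.update y 0 (y k.succ * y 0)) w :=
        analyticAt_update_coord _ ((analyticAt_coord k.succ w).mul (analyticAt_coord 0 w))
      have hU1 : AnalyticAt ℚ_[p] (fun y => U (Function.update y 0 (y k.succ * y 0))) w := by
        have : AnalyticAt ℚ_[p] U (Function.update w 0 (w k.succ * w 0)) := by rw [hσ]; exact hU
        exact AnalyticAt.comp this hσa
      refine LocCov.isResolved_comp
        (f₁ := newtonForm e (Function.update β k (β k - 1)) b
          (fun y => U (Function.update y 0 (y k.succ * y 0))))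
        (L₁ := (L ++ [fun x : Fin n → ℚ_[p] => x k]).map fun g x => g (Fin.tail x)) hσa
        (analyticAt_coord k.succ w) (e + 1) ?_ ?_ ?_ ?_
      · have hc := hσa.continuousAt.tendsto
        simp only [hσ] at hc
        filter_upwards [hc.eventually hf] with y hy
        rw [hy, newtonForm_update_zero e b U hk]
      · intro g hg
        obtain ⟨g, hgL, rfl⟩ := List.mem_map.1 hg
        refine List.mem_map.2 ⟨g, List.mem_append_left _ hgL, ?_⟩
        ext x
        simp [update_zero_eq_cons]
      · exact List.mem_map.2 ⟨_, List.mem_append_right _ (List.mem_singleton_self _), rfl⟩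
      · have hL' : ∀ g ∈ L ++ [fun x => x k], IsZM g 0 := by
          intro g hg
          rcases List.mem_append.1 hg with hg | hg
          · exact hL g hg
          · rw [List.mem_singleton.1 hg]
            exact Or.inr (isMono_coord k 0)
        by_cases ht : t = 0
        · have hw0 : w = 0 := by rw [hw, ht, Pi.single_zero]
          rw [hw0]
          rw [hw0] at hU1
          refine ih _ hβ' _ b _ _ hb hU1 ?_ hi hL' (Eventually.of_forall fun x => rfl)
          rw [← hw0, hσ]
          exact hU0
        · refine hIR w _ _ (analyticAt_newtonForm (by rw [htw]; exact hb) hU1)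
            ⟨e, lt_add_one e, ?_⟩ (by rw [htw]; exact fun g hg => (hL' g hg).analyticAt)
          refine dzero_ne_zero_of_polynomial (u := U 0) (t := t) hU0 ht (c := fun i =>
            (∏ l : Fin n, (0 : ℚ_[p]) ^ (Function.update β k (β k - 1) l)) ^ (e + 1 - i) * b i 0) ?_
          intro s
          have h1 : w + s • Pi.single 0 1 = Pi.single 0 (t + s) := by
            ext l
            by_cases hl : l = 0
            · subst hl; simp [hw]
            · simp [hw, hl]
          have h2 : Fin.tail (Pi.single 0 (t + s) : Fin (n + 1) → ℚ_[p]) = 0 := by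
            ext l; simp [Fin.tail]
          have h3 : Function.update (Pi.single 0 (t + s) : Fin (n + 1) → ℚ_[p]) 0 0 = 0 := by
            ext l
            by_cases hl : l = 0
            · subst hl; simp
            · simp [hl]
          rw [h1]
          simp [newtonForm, h2, h3]
    · set w : Fin (n + 1) → ℚ_[p] := Pi.single k.succ s with hw
      rw [inv_inv] at hs
      have hσ := hσB s
      rw [← hw] at hσ
      refine LocCov.of_isResolved ⟨hσBa w, analyticAt_coord 0 w, Or.inr ⟨isMono_coord 0 w, ?_, ?_⟩⟩
      · have h1 : IsMono (fun y : Fin (n + 1) → ℚ_[p] => y 0 ^ (e + 1) * G y) w :=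
          ((isMono_coord 0 w).pow (e + 1)).mul
            (IsMono.of_ne_zero (hGa s) (hGε (by rw [dist_zero_right]; exact hs)))
        refine h1.congr ?_
        have hc := (hσBa w).continuousAt.tendsto
        simp only [hσ] at hc
        filter_upwards [hc.eventually hf] with y hy
        rw [hy, newtonForm_update_succ e b U hk]
      · intro g hg
        obtain ⟨g, hgL, rfl⟩ := List.mem_map.1 hg
        refine IsZM.comp (g := g) (φ := fun y : Fin (n + 1) → ℚ_[p] =>
          Fin.tail (Function.update y k.succ (y 0 * y k.succ)))
          (by rw [hσ]; exact hL g hgL) ((analyticAt_tail _).comp (hσBa w)) fun i => ?_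
        rw [hσ]
        have h0 : (0 : Fin (n + 1) → ℚ_[p]) i.succ = 0 := rfl
        simp only [Fin.tail, h0, sub_zero]
        by_cases hik : i = k
        · subst hik
          simpa using (isMono_coord 0 w).mul (isMono_coord i.succ w)
        · have : ∀ y : Fin (n + 1) → ℚ_[p],
              Function.update y k.succ (y 0 * y k.succ) i.succ = y i.succ := fun y =>
            Function.update_of_ne (fun hh => hik (Fin.succ_injective _ hh)) _ _
          simpa only [this] using isMono_coord i.succ w

end Newton

end

section

open Filter Topology MeasureTheory
open scoped ENNReal NNReal

set_option linter.unusedSectionVars false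

section Core

variable {p : ℕ} [Fact p.Prime] {n : ℕ}

theorem exists_minimal_exponent {ι : Type*} (M : Finset ι) (hM : M.Nonempty)
    (γ : ι → Fin n → ℕ) (h : ∀ i ∈ M, ∀ j ∈ M, γ i ≤ γ j ∨ γ j ≤ γ i) :
    ∃ i ∈ M, ∀ j ∈ M, γ i ≤ γ j := by
  obtain ⟨i, hi, hmin⟩ := M.exists_min_image (fun i => ∑ l, γ i l) hM
  refine ⟨i, hi, fun j hj => ?_⟩
  rcases h i hi j hj with h1 | h1
  · exact h1
  · have h2 : ∑ l, γ j l = ∑ l, γ i l :=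
      le_antisymm (Finset.sum_le_sum fun l _ => h1 l) (hmin j hj)
    exact fun l => ((Finset.sum_eq_sum_iff_of_le fun l _ => h1 l).1 h2 l (Finset.mem_univ l)).ge

variable [MeasureSpace ℚ_[p]] [BorelSpace ℚ_[p]] [(volume : Measure ℚ_[p]).IsAddHaarMeasure]

theorem locCov_of_coefficients {e : ℕ} (hIR : ResolvableOrder p n (e + 1))
    {y : Fin n → ℚ_[p]} {f U : (Fin (n + 1) → ℚ_[p]) → ℚ_[p]} {a : ℕ → (Fin n → ℚ_[p]) → ℚ_[p]}
    {L : List ((Fin n → ℚ_[p]) → ℚ_[p])} (hU : AnalyticAt ℚ_[p] U (Fin.cons 0 y))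
    (hU0 : U (Fin.cons 0 y) ≠ 0) (ha : ∀ i < e, IsZM (a i) y)
    (hd : ∀ i < e, ∀ j < e, IsZM (fun x => a i x ^ ((e + 1).factorial / (e + 1 - i))
      - a j x ^ ((e + 1).factorial / (e + 1 - j))) y)
    (hL : ∀ g ∈ L, IsZM g y) (hM : ∃ i < e, IsMono (a i) y)
    (hf : ∀ᶠ x in 𝓝 (Fin.cons 0 y : Fin (n + 1) → ℚ_[p]),
      f x = ∑ i ∈ Finset.range e, a i (Fin.tail x) * x 0 ^ i + x 0 ^ (e + 1) * U x) :
    LocCov (IsResolved f (L.map fun g x => g (Fin.tail x))) (Fin.cons 0 y) := by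
  classical
  set D := (e + 1).factorial with hD
  have hD0 : D ≠ 0 := Nat.factorial_ne_zero _
  have hDi : ∀ i < e, (e + 1 - i) * (D / (e + 1 - i)) = D := fun i hi =>
    Nat.mul_div_cancel' (Nat.dvd_factorial (by omega) (by omega))
  set w : Fin (n + 1) → ℚ_[p] := Fin.cons 0 y with hw
  have key : ∀ i, ∃ (α : Fin n → ℕ) (u : (Fin n → ℚ_[p]) → ℚ_[p]), (i < e → IsMono (a i) y →
      AnalyticAt ℚ_[p] u y ∧ u y ≠ 0 ∧ ∀ᶠ x in 𝓝 y, a i x = u x * ∏ l, (x l - y l) ^ α l) := by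
    intro i
    by_cases h : IsMono (a i) y
    · obtain ⟨α, u, h⟩ := h
      exact ⟨α, u, fun _ _ => h⟩
    · exact ⟨0, 0, fun _ h' => (h h').elim⟩
  choose α u hαu using key
  set M := (Finset.range e).filter fun i => IsMono (a i) y with hMdef
  have hMm : ∀ i, i ∈ M ↔ i < e ∧ IsMono (a i) y := by simp [M]
  obtain ⟨i₀, hi₀, hmin⟩ := exists_minimal_exponent M
    (by obtain ⟨i, hi, him⟩ := hM; exact ⟨i, (hMm i).2 ⟨hi, him⟩⟩)
    (fun i l => (D / (e + 1 - i)) * α i l) (by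
      intro i hi j hj
      obtain ⟨hi1, hi2⟩ := (hMm i).1 hi
      obtain ⟨hj1, hj2⟩ := (hMm j).1 hj
      obtain ⟨u1, u2, u3⟩ := hαu i hi1 hi2
      obtain ⟨v1, v2, v3⟩ := hαu j hj1 hj2
      refine exponents_le_or_le (u1.pow (D / (e + 1 - i))) (v1.pow (D / (e + 1 - j)))
        (pow_ne_zero _ u2) (pow_ne_zero _ v2) ((hd i hi1 j hj1).congr ?_)
      filter_upwards [u3, v3] with x hx1 hx2
      simp only [hx1, hx2, mul_pow, ← Finset.prod_pow, ← pow_mul, Pi.pow_apply,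
        mul_comm (D / _)])
  obtain ⟨hi₀e, hi₀M⟩ := (hMm i₀).1 hi₀
  set β : Fin n → ℕ := fun l => (D / (e + 1 - i₀)) * α i₀ l with hβ
  have hβle : ∀ i ∈ M, ∀ l, (e + 1 - i) * β l ≤ D * α i l := by
    intro i hi l
    have h1 := hmin i hi l
    calc (e + 1 - i) * β l ≤ (e + 1 - i) * ((D / (e + 1 - i)) * α i l) :=
          Nat.mul_le_mul_left _ h1
      _ = D * α i l := by rw [← mul_assoc, hDi i ((hMm i).1 hi).1]
  have hβeq : ∀ l, (e + 1 - i₀) * β l = D * α i₀ l := fun l => by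
    rw [hβ, ← mul_assoc, hDi i₀ hi₀e]
  rw [show w = 0 + w from (zero_add w).symm]
  refine LocCov.translate (LocCov.of_powSubst hD0 (Finset.univ.erase 0) fun c hc => ?_)
  rw [chartPull_chartPull]
  set s : Finset (Fin (n + 1)) := Finset.univ.erase 0 with hs
  have h0s : (0 : Fin (n + 1)) ∉ s := by simp [hs]
  have hls : ∀ l : Fin n, l.succ ∈ s := fun l => by simp [hs, Fin.succ_ne_zero]
  set φ : (Fin (n + 1) → ℚ_[p]) → Fin (n + 1) → ℚ_[p] := fun x => powSubst s c D x + w with hφ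
  set θ : (Fin n → ℚ_[p]) → Fin n → ℚ_[p] := fun x l => c l.succ * x l ^ D + y l with hθ
  have hφ0 : ∀ x, φ x 0 = x 0 := fun x => by simp [hφ, powSubst, h0s, hw]
  have hφt : ∀ x, Fin.tail (φ x) = θ (Fin.tail x) := fun x => by
    ext l
    simp [hφ, hθ, Fin.tail, powSubst, hls, hw]
  have hθ0 : θ 0 = y := by ext l; simp [hθ, hD0]
  have hφz : φ 0 = w := by
    rw [← Fin.cons_self_tail (φ 0), hφ0, hφt]
    change Fin.cons 0 (θ 0) = w
    rw [hθ0]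
  have hθa : ∀ x, AnalyticAt ℚ_[p] θ x := fun x => by
    rw [analyticAt_pi_iff]
    exact fun l => (analyticAt_const.mul ((analyticAt_coord l x).pow D)).add analyticAt_const
  have hφa : ∀ x, AnalyticAt ℚ_[p] φ x := fun x => by
    rw [analyticAt_pi_iff]
    refine Fin.cases ?_ fun l => ?_
    · have : (fun x => φ x 0) = fun x => x 0 := funext hφ0
      rw [this]
      exact analyticAt_coord 0 x
    · have : (fun x => φ x l.succ) = fun x => θ (Fin.tail x) l := by
        ext x; rw [← hφt]; rfl
      rw [this]
      exact (analyticAt_coord l _).comp ((hθa _).comp (analyticAt_tail x))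
  set b : ℕ → (Fin n → ℚ_[p]) → ℚ_[p] := fun i x => if i ∈ M then
    u i (θ x) * (∏ l : Fin n, c l.succ ^ α i l) * ∏ l : Fin n, x l ^ (D * α i l - (e + 1 - i) * β l)
    else 0 with hb
  have hθt : Tendsto (fun x : Fin (n + 1) → ℚ_[p] => θ (Fin.tail x)) (𝓝 0) (𝓝 y) := by
    have h1 := (hθa 0).continuousAt.tendsto
    rw [hθ0] at h1
    exact h1.comp (analyticAt_tail (0 : Fin (n + 1) → ℚ_[p])).continuousAt.tendsto
  have hcoef : ∀ i < e, ∀ᶠ x : Fin (n + 1) → ℚ_[p] in 𝓝 0, a i (θ (Fin.tail x))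
      = (∏ l : Fin n, x l.succ ^ β l) ^ (e + 1 - i) * b i (Fin.tail x) := by
    intro i hi
    by_cases him : i ∈ M
    · obtain ⟨u1, u2, u3⟩ := hαu i hi ((hMm i).1 him).2
      filter_upwards [hθt.eventually u3] with x hx
      rw [hx]
      simp only [hb, him, if_true]
      have h1 : ∏ l : Fin n, (θ (Fin.tail x) l - y l) ^ α i l = (∏ l : Fin n, c l.succ ^ α i l) *
          ((∏ l : Fin n, x l.succ ^ β l) ^ (e + 1 - i) *
            ∏ l : Fin n, Fin.tail x l ^ (D * α i l - (e + 1 - i) * β l)) := by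
        rw [← Finset.prod_pow, ← Finset.prod_mul_distrib, ← Finset.prod_mul_distrib]
        refine Finset.prod_congr rfl fun l _ => ?_
        simp only [hθ, add_sub_cancel_right, mul_pow, ← pow_mul, Fin.tail]
        rw [← pow_add]
        congr 2
        have := hβle i him l
        rw [mul_comm (β l)]
        omega
      rw [h1]
      ring
    · have hz : ∀ᶠ x in 𝓝 y, a i x = 0 :=
        (ha i hi).resolve_right fun h => him ((hMm i).2 ⟨hi, h⟩)
      filter_upwards [hθt.eventually hz] with x hx
      simp [hx, hb, him]
  refine LocCov.isResolved_comp (f₁ := newtonForm e β b fun x => U (φ x))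
    (L₁ := (L.map (fun g x => g (θ x)) ++ [fun x : Fin n → ℚ_[p] => ∏ l, x l ^ (D - 1)]).map
      fun g x => g (Fin.tail x)) (hφa 0) ?_ 0 ?_ ?_ ?_ ?_
  · exact analyticAt_const.mul (Finset.analyticAt_fun_prod _ fun l _ => (analyticAt_coord l 0).pow _)
  · have hφc := (hφa 0).continuousAt.tendsto
    rw [hφz] at hφc
    have h2 : ∀ᶠ x : Fin (n + 1) → ℚ_[p] in 𝓝 0, ∀ i ∈ Finset.range e, a i (θ (Fin.tail x))
      = (∏ l : Fin n, x l.succ ^ β l) ^ (e + 1 - i) * b i (Fin.tail x) :=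
      (Filter.eventually_all_finset _).2 fun i hi => hcoef i (Finset.mem_range.1 hi)
    filter_upwards [hφc.eventually hf, h2] with x hx1 hx2
    rw [pow_zero, one_mul, hx1, hφ0, hφt]
    unfold newtonForm
    congr 1
    exact Finset.sum_congr rfl fun i hi => by rw [hx2 i hi]
  · intro g hg
    obtain ⟨g, hgL, rfl⟩ := List.mem_map.1 hg
    refine List.mem_map.2 ⟨fun x => g (θ x), List.mem_append_left _ (List.mem_map.2 ⟨g, hgL, rfl⟩), ?_⟩
    ext x
    change g (θ (Fin.tail x)) = g (Fin.tail (φ x))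
    rw [hφt]
  · refine List.mem_map.2 ⟨_, List.mem_append_right _ (List.mem_singleton_self _), ?_⟩
    ext x
    have : ∏ l ∈ s, x l ^ (D - 1) = ∏ l : Fin n, x l.succ ^ (D - 1) := by
      have h3 := Fin.prod_univ_succ (fun l => if l ∈ s then x l ^ (D - 1) else 1)
      simpa [h0s, hls] using h3
    rw [this, one_mul]
    rfl
  · refine locCov_newtonForm hIR _ β rfl _ b _ _ ?_ ?_ ?_ ⟨i₀, hi₀e, ?_⟩ ?_
      (Eventually.of_forall fun x => rfl)
    · intro i
      by_cases him : i ∈ M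
      · obtain ⟨u1, u2, u3⟩ := hαu i ((hMm i).1 him).1 ((hMm i).1 him).2
        simp only [hb, him, if_true]
        have hu : AnalyticAt ℚ_[p] (u i) (θ 0) := by rw [hθ0]; exact u1
        exact ((AnalyticAt.comp hu (hθa 0)).mul analyticAt_const).mul
          (Finset.analyticAt_fun_prod _ fun l _ => (analyticAt_coord l 0).pow _)
      · simp only [hb, him, if_false]
        exact analyticAt_const
    · have : AnalyticAt ℚ_[p] U (φ 0) := by rw [hφz]; exact hU
      exact AnalyticAt.comp this (hφa 0)
    · rw [hφz]; exact hU0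
    · obtain ⟨u1, u2, u3⟩ := hαu i₀ hi₀e hi₀M
      simp only [hb, hi₀, if_true, hβeq, Nat.sub_self, pow_zero, Finset.prod_const_one, mul_one, hθ0]
      exact mul_ne_zero u2 (Finset.prod_ne_zero_iff.2 fun l _ => pow_ne_zero _ (hc _))
    · intro g hg
      rcases List.mem_append.1 hg with hg | hg
      · obtain ⟨g, hgL, rfl⟩ := List.mem_map.1 hg
        refine IsZM.comp (g := g) (φ := θ) (by rw [hθ0]; exact hL g hgL) (hθa 0) fun l => ?_
        simp only [hθ0]
        simp only [hθ, add_sub_cancel_right]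
        exact (isMono_const (hc _) 0).mul ((isMono_coord l 0).pow D)
      · rw [List.mem_singleton.1 hg]
        exact Or.inr (IsMono.prod _ fun l _ => (isMono_coord l 0).pow _)

end Core

end

section

open Filter Topology MeasureTheory
open scoped ENNReal NNReal

set_option linter.unusedSectionVars false

section Monomialise

variable {p : ℕ} [Fact p.Prime] {n : ℕ}

theorem exists_continuous_eventuallyEq {b : (Fin n → ℚ_[p]) → ℚ_[p]} {y : Fin n → ℚ_[p]}
    (hb : AnalyticAt ℚ_[p] b y) : ∃ b' : (Fin n → ℚ_[p]) → ℚ_[p], Continuous b' ∧ b' =ᶠ[𝓝 y] b := by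
  obtain ⟨r, hr, h⟩ := Metric.nhds_basis_closedBall.eventually_iff.1
    (hb.eventually_analyticAt.mono fun x hx => hx.continuousAt)
  have ho : IsOpen (Metric.closedBall y r) := IsUltrametricDist.isOpen_closedBall y hr.ne'
  refine ⟨(Metric.closedBall y r).indicator b, ?_, ?_⟩
  · refine continuous_indicator (fun x hx => ?_) (fun x hx => ?_)
    · rw [IsClopen.frontier_eq ⟨Metric.isClosed_closedBall, ho⟩] at hx
      exact hx.elim
    · rw [Metric.isClosed_closedBall.closure_eq] at hx
      exact (h hx).continuousWithinAt
  · filter_upwards [ho.mem_nhds (Metric.mem_closedBall_self hr.le)] with x hx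
    exact Set.indicator_of_mem hx b

theorem analyticAt_cons_tail {ψ : (Fin n → ℚ_[p]) → Fin n → ℚ_[p]} {w : Fin (n + 1) → ℚ_[p]}
    (hψ : AnalyticAt ℚ_[p] ψ (Fin.tail w)) :
    AnalyticAt ℚ_[p] (fun x : Fin (n + 1) → ℚ_[p] =>
      (Fin.cons (x 0) (ψ (Fin.tail x)) : Fin (n + 1) → ℚ_[p])) w := by
  rw [analyticAt_pi_iff]
  refine Fin.cases ?_ fun l => ?_
  · simpa using analyticAt_coord 0 w
  · simpa [Function.comp_def] using (analyticAt_coord l _).comp (hψ.comp (analyticAt_tail w))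

theorem cons_tail_add_smul (ψ : (Fin n → ℚ_[p]) → Fin n → ℚ_[p]) (w : Fin (n + 1) → ℚ_[p])
    (s : ℚ_[p]) : (Fin.cons ((w + s • Pi.single 0 1 : Fin (n + 1) → ℚ_[p]) 0)
      (ψ (Fin.tail (w + s • Pi.single 0 1 : Fin (n + 1) → ℚ_[p]))) : Fin (n + 1) → ℚ_[p])
      = Fin.cons (w 0) (ψ (Fin.tail w)) + s • Pi.single 0 1 := by
  rw [cons_add_smul]
  have : Fin.tail (w + s • Pi.single 0 1 : Fin (n + 1) → ℚ_[p]) = Fin.tail w := by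
    ext l; simp [Fin.tail]
  rw [this]
  simp

variable [MeasureSpace ℚ_[p]] [BorelSpace ℚ_[p]] [(volume : Measure ℚ_[p]).IsAddHaarMeasure]

theorem locCov_of_liftChart {e : ℕ} (hIR : ResolvableOrder p n (e + 1))
    {f U : (Fin (n + 1) → ℚ_[p]) → ℚ_[p]} {A : ℕ → (Fin n → ℚ_[p]) → ℚ_[p]}
    {L : List ((Fin n → ℚ_[p]) → ℚ_[p])} {ψ : (Fin n → ℚ_[p]) → Fin n → ℚ_[p]}
    {k : (Fin n → ℚ_[p]) → ℚ_[p]} {y : Fin (n + 1) → ℚ_[p]}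
    (hf : AnalyticAt ℚ_[p] f (Fin.cons (y 0) (ψ (Fin.tail y))))
    (hU : AnalyticAt ℚ_[p] U (Fin.cons (y 0) (ψ (Fin.tail y))))
    (hU0 : U (Fin.cons (y 0) (ψ (Fin.tail y))) ≠ 0)
    (hfe : ∀ᶠ x in 𝓝 (Fin.cons (y 0) (ψ (Fin.tail y)) : Fin (n + 1) → ℚ_[p]),
      f x = ∑ i ∈ Finset.range e, A i (Fin.tail x) * x 0 ^ i + x 0 ^ (e + 1) * U x)
    (h0 : y 0 ≠ 0 → (dzero^[e] f) (Fin.cons (y 0) (ψ (Fin.tail y))) ≠ 0)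
    (hψ : AnalyticAt ℚ_[p] ψ (Fin.tail y)) (hk : IsMono k (Fin.tail y))
    (hL : ∀ g ∈ L, IsZM (fun x => g (ψ x)) (Fin.tail y))
    (hA : ∀ i < e, IsZM (fun x => A i (ψ x)) (Fin.tail y))
    (hd : ∀ i < e, ∀ j < e, IsZM (fun x => A i (ψ x) ^ ((e + 1).factorial / (e + 1 - i))
      - A j (ψ x) ^ ((e + 1).factorial / (e + 1 - j))) (Fin.tail y)) :
    LocCov (chartPull (fun w => Fin.cons (w 0) (ψ (Fin.tail w))) (fun w => k (Fin.tail w))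
      (IsResolved f (L.map fun g x => g (Fin.tail x)))) y := by
  set φ : (Fin (n + 1) → ℚ_[p]) → Fin (n + 1) → ℚ_[p] :=
    fun w => Fin.cons (w 0) (ψ (Fin.tail w)) with hφ
  have hφa : AnalyticAt ℚ_[p] φ y := analyticAt_cons_tail hψ
  have hφt : ∀ x, Fin.tail (φ x) = ψ (Fin.tail x) := fun x => Fin.tail_cons _ _
  have hφ0 : ∀ x, φ x 0 = x 0 := fun x => Fin.cons_zero _ _
  have hka : AnalyticAt ℚ_[p] (fun w : Fin (n + 1) → ℚ_[p] => k (Fin.tail w)) y :=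
    (IsMono.comp_tail hk).analyticAt
  set L₁ := L.map (fun g x => g (ψ x)) ++ [k] with hL₁
  have hL₁z : ∀ g ∈ L₁, IsZM g (Fin.tail y) := by
    intro g hg
    rcases List.mem_append.1 hg with hg | hg
    · obtain ⟨g, hgL, rfl⟩ := List.mem_map.1 hg
      exact hL g hgL
    · rw [List.mem_singleton.1 hg]; exact Or.inr hk
  have hmem : ∀ g ∈ L.map (fun g (x : Fin (n + 1) → ℚ_[p]) => g (Fin.tail x)),
      (fun x => g (φ x)) ∈ L₁.map fun g (x : Fin (n + 1) → ℚ_[p]) => g (Fin.tail x) := by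
    intro g hg
    obtain ⟨g, hgL, rfl⟩ := List.mem_map.1 hg
    refine List.mem_map.2 ⟨_, List.mem_append_left _ (List.mem_map.2 ⟨g, hgL, rfl⟩), ?_⟩
    ext x
    simp only [hφt]
  have hkm : (fun w : Fin (n + 1) → ℚ_[p] => k (Fin.tail w)) ∈
      L₁.map fun g (x : Fin (n + 1) → ℚ_[p]) => g (Fin.tail x) :=
    List.mem_map.2 ⟨k, List.mem_append_right _ (List.mem_singleton_self _), rfl⟩
  have hfφ : ∀ᶠ x in 𝓝 y, f (φ x) = ∑ i ∈ Finset.range e, A i (ψ (Fin.tail x)) * x 0 ^ i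
      + x 0 ^ (e + 1) * U (φ x) := by
    filter_upwards [hφa.continuousAt.eventually hfe] with x hx
    rw [hx, hφt, hφ0]
  have hUφ : AnalyticAt ℚ_[p] (fun x => U (φ x)) y := AnalyticAt.comp hU hφa
  by_cases hD : ∃ i < e + 1, (dzero^[i] f) (φ y) ≠ 0
  · refine LocCov.isResolved_comp (f₁ := fun x => f (φ x)) hφa hka 0
      (Eventually.of_forall fun x => by simp) hmem hkm ?_
    refine hIR y _ _ (AnalyticAt.comp hf hφa) ?_ fun g hg => (hL₁z g hg).analyticAt
    obtain ⟨i, hi, h⟩ := hD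
    exact ⟨i, hi, by rwa [dzero_iterate_comp f φ (cons_tail_add_smul ψ)]⟩
  have hy0 : y 0 = 0 := by
    by_contra h
    exact hD ⟨e, lt_add_one e, h0 h⟩
  by_cases hM : ∃ i < e, IsMono (fun x => A i (ψ x)) (Fin.tail y)
  · refine LocCov.isResolved_comp (f₁ := fun x => f (φ x)) hφa hka 0
      (Eventually.of_forall fun x => by simp) hmem hkm ?_
    have hyc : y = Fin.cons 0 (Fin.tail y) := by rw [← hy0]; exact (Fin.cons_self_tail y).symm
    have := locCov_of_coefficients (p := p) hIR (y := Fin.tail y) (f := fun x => f (φ x))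
      (U := fun x => U (φ x)) (a := fun i x => A i (ψ x)) (L := L₁)
    rw [← hyc] at this
    exact this hUφ hU0 hA hd hL₁z hM hfφ
  · refine LocCov.of_isResolved ⟨hφa, hka, Or.inr ⟨IsMono.comp_tail hk, ?_, ?_⟩⟩
    · refine (((isMono_coord 0 y).pow (e + 1)).mul (IsMono.of_ne_zero hUφ hU0)).congr ?_
      have h2 : ∀ᶠ x : Fin (n + 1) → ℚ_[p] in 𝓝 y, ∀ i ∈ Finset.range e,
          A i (ψ (Fin.tail x)) = 0 := by
        refine (Filter.eventually_all_finset _).2 fun i hi => ?_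
        have hz : ∀ᶠ x in 𝓝 (Fin.tail y), A i (ψ x) = 0 := (hA i (Finset.mem_range.1 hi)).resolve_right
          fun h => hM ⟨i, Finset.mem_range.1 hi, h⟩
        exact (analyticAt_tail y).continuousAt.eventually hz
      filter_upwards [hfφ, h2] with x hx1 hx2
      rw [hx1, Finset.sum_eq_zero fun i hi => by rw [hx2 i hi, zero_mul], zero_add]
    · intro g hg
      obtain ⟨g, hgL, rfl⟩ := List.mem_map.1 hg
      simp only [hφt]
      exact IsZM.comp_tail (hL g hgL)

theorem locCov_of_dzero {e : ℕ} (hR : Resolvable p n) (hIR : ResolvableOrder p n (e + 1))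
    {f : (Fin (n + 1) → ℚ_[p]) → ℚ_[p]} {L : List ((Fin n → ℚ_[p]) → ℚ_[p])} {y : Fin n → ℚ_[p]}
    (hf : AnalyticAt ℚ_[p] f (Fin.cons 0 y)) (h1 : (dzero^[e + 1] f) (Fin.cons 0 y) ≠ 0)
    (h0 : ∀ᶠ x in 𝓝 y, (dzero^[e] f) (Fin.cons 0 x) = 0) (hL : ∀ g ∈ L, AnalyticAt ℚ_[p] g y) :
    LocCov (IsResolved f (L.map fun g x => g (Fin.tail x))) (Fin.cons 0 y) := by
  set w : Fin (n + 1) → ℚ_[p] := Fin.cons 0 y with hw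
  have hwt : Fin.tail w = y := Fin.tail_cons _ _
  have hcy : Tendsto (fun x : Fin n → ℚ_[p] => (Fin.cons 0 x : Fin (n + 1) → ℚ_[p])) (𝓝 y) (𝓝 w) :=
    (analyticAt_cons_const 0 y).continuousAt
  obtain ⟨A, U, hA, hU, hfe⟩ := exists_taylor (w := w) (Fin.cons_zero _ _) hf (e + 1)
  rw [hwt] at hA
  have hU0 : U w ≠ 0 := by
    have := (dzero_of_expansion (x := y) hU hfe).2
    rw [this] at h1
    exact right_ne_zero_of_mul h1
  have hAe : ∀ᶠ x in 𝓝 y, A e x = 0 := by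
    filter_upwards [h0, hcy.eventually hU.eventually_analyticAt, hcy.eventually hfe.eventually_nhds]
      with x hx1 hx2 hx3
    have := (dzero_of_expansion (x := x) hx2 hx3).1 e (lt_add_one e)
    rw [hx1] at this
    exact (mul_eq_zero.1 this.symm).resolve_left (by exact_mod_cast e.factorial_ne_zero)
  have hfe' : ∀ᶠ x in 𝓝 w, f x = ∑ i ∈ Finset.range e, A i (Fin.tail x) * x 0 ^ i
      + x 0 ^ (e + 1) * U x := by
    have ht : Tendsto (fun x : Fin (n + 1) → ℚ_[p] => Fin.tail x) (𝓝 w) (𝓝 y) := by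
      have := (analyticAt_tail w).continuousAt.tendsto
      rwa [hwt] at this
    filter_upwards [hfe, ht.eventually hAe] with x hx1 hx2
    rw [hx1, Finset.sum_range_succ, hx2, zero_mul, add_zero]
  have hne := eventually_ne_zero_of_dzero (G := dzero^[e] f) (w := w) (Fin.cons_zero _ _)
    (analyticAt_dzero_iterate hf e) (by rwa [Function.iterate_succ_apply'] at h1) (by rwa [hwt])
  set M : List ((Fin n → ℚ_[p]) → ℚ_[p]) := L ++ ((List.range e).map A ++
    (List.range e ×ˢ List.range e).map fun q x => A q.1 x ^ ((e + 1).factorial / (e + 1 - q.1))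
      - A q.2 x ^ ((e + 1).factorial / (e + 1 - q.2))) with hM
  have hMa : ∀ g ∈ M, AnalyticAt ℚ_[p] g y := by
    intro g hg
    rcases List.mem_append.1 hg with hg | hg
    · exact hL g hg
    rcases List.mem_append.1 hg with hg | hg
    · obtain ⟨i, -, rfl⟩ := List.mem_map.1 hg
      exact hA i
    · obtain ⟨q, -, rfl⟩ := List.mem_map.1 hg
      exact ((hA q.1).pow _).sub ((hA q.2).pow _)
  have hres := (hR y (fun _ => 1) M analyticAt_const (fun h => one_ne_zero h.exists.choose_spec) hMa).lift 0
  refine LocCov.bind hres ?_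
  filter_upwards [hf.eventually_analyticAt, hU.eventually_analyticAt,
    hU.continuousAt.eventually_ne hU0, hfe'.eventually_nhds, hne] with x x1 x2 x3 x4 x5 φ j y' _ _ hyx hP
  obtain ⟨ψ, k, hψc, hkc, ⟨hψ, hk, hres⟩, rfl, rfl⟩ := hP
  subst hyx
  rcases hres with hres | ⟨hres, -, hz⟩
  · refine LocCov.of_isResolved ⟨analyticAt_cons_tail hψ, AnalyticAt.comp hk (analyticAt_tail y'), Or.inl ?_⟩
    exact (analyticAt_tail y').continuousAt.eventually hres
  · refine locCov_of_liftChart (A := A) hIR x1 x2 x3 x4 x5 hψ hres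
      (fun g hg => hz g (List.mem_append_left _ hg)) (fun i hi => ?_) (fun i hi j hj => ?_)
    · exact hz (A i) (List.mem_append_right _ (List.mem_append_left _
        (List.mem_map.2 ⟨i, List.mem_range.2 hi, rfl⟩)))
    · exact hz _ (List.mem_append_right _ (List.mem_append_right _
        (List.mem_map.2 ⟨(i, j), List.mem_product.2 ⟨List.mem_range.2 hi, List.mem_range.2 hj⟩, rfl⟩)))

theorem resolvableOrder_succ {d : ℕ} (hR : Resolvable p n) (hIR : ResolvableOrder p n d) :
    ResolvableOrder p n (d + 1) := by
  intro w f L hf hi hL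
  by_cases hd : ∃ i < d, (dzero^[i] f) w ≠ 0
  · exact hIR w f L hf hd hL
  have hfd : (dzero^[d] f) w ≠ 0 := by
    obtain ⟨i, hi, h⟩ := hi
    rcases Nat.lt_succ_iff_lt_or_eq.1 hi with h1 | rfl
    · exact (hd ⟨i, h1, h⟩).elim
    · exact h
  push Not at hd
  rcases d with _ | e
  · have hres := (hR (Fin.tail w) (fun _ => 1) L analyticAt_const (fun h => one_ne_zero h.exists.choose_spec) hL).lift (w 0)
    rw [Fin.cons_self_tail] at hres
    refine hres.mono ?_
    filter_upwards [hf.eventually_analyticAt, hf.continuousAt.eventually_ne hfd]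
      with x x1 x2 φ j y' _ _ hyx hP
    obtain ⟨ψ, k, hψc, hkc, ⟨hψ, hk, hres⟩, rfl, rfl⟩ := hP
    subst hyx
    have hφ := analyticAt_cons_tail hψ
    refine ⟨hφ, AnalyticAt.comp hk (analyticAt_tail y'), ?_⟩
    rcases hres with hres | ⟨hres, -, hz⟩
    · exact Or.inl ((analyticAt_tail y').continuousAt.eventually hres)
    · refine Or.inr ⟨hres.comp_tail, IsMono.of_ne_zero (AnalyticAt.comp x1 hφ) x2, fun g hg => ?_⟩
      obtain ⟨g, hgL, rfl⟩ := List.mem_map.1 hg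
      simpa using IsZM.comp_tail (hz g hgL)
  · obtain ⟨b, hb, hbw, hbz⟩ := exists_implicit (analyticAt_dzero_iterate hf e) (hd e (lt_add_one e))
      (by rwa [Function.iterate_succ_apply'] at hfd)
    obtain ⟨b', hb'c, hb'⟩ := exists_continuous_eventuallyEq hb
    have hb'a : AnalyticAt ℚ_[p] b' (Fin.tail w) := hb.congr hb'.symm
    set σ := shearHomeo b' hb'c with hσ
    have hσe : ∀ x, σ x = Fin.cons (x 0 + b' (Fin.tail x)) (Fin.tail x) := fun x =>
      update_zero_eq_cons _ _
    set w' : Fin (n + 1) → ℚ_[p] := Fin.cons 0 (Fin.tail w) with hw'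
    have hσw : σ w' = w := by
      rw [hσe, hw', Fin.tail_cons, Fin.cons_zero, zero_add, hb'.eq_of_nhds, hbw, Fin.cons_self_tail]
    have hσa : AnalyticAt ℚ_[p] σ w' := by
      have : AnalyticAt ℚ_[p] (fun x : Fin (n + 1) → ℚ_[p] =>
          Function.update x 0 (x 0 + b' (Fin.tail x))) w' :=
        analyticAt_update_coord 0 ((analyticAt_coord 0 w').add
          (AnalyticAt.comp (by rw [hw', Fin.tail_cons]; exact hb'a) (analyticAt_tail w')))
      exact this
    have hσs : ∀ x (s : ℚ_[p]), σ (x + s • Pi.single 0 1) = σ x + s • Pi.single 0 1 := by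
      intro x s
      have : Fin.tail (x + s • Pi.single 0 1 : Fin (n + 1) → ℚ_[p]) = Fin.tail x := by
        ext l; simp [Fin.tail]
      rw [hσe, hσe, cons_add_smul, this]
      congr 1
      simp
      ring
    rw [← hσw]
    refine LocCov.of_homeomorph σ (measurePreserving_shearHomeo b' hb'c) ?_
    have hfσ : AnalyticAt ℚ_[p] (fun x => f (σ x)) w' := by
      have : AnalyticAt ℚ_[p] f (σ w') := by rw [hσw]; exact hf
      exact AnalyticAt.comp this hσa
    refine LocCov.isResolved_comp (f₁ := fun x => f (σ x))
      (L₁ := (L ++ [fun _ : Fin n → ℚ_[p] => (1 : ℚ_[p])]).map fun g x => g (Fin.tail x)) hσa analyticAt_const 0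
      (Eventually.of_forall fun x => by simp) ?_ ?_ ?_
    · intro g hg
      obtain ⟨g, hgL, rfl⟩ := List.mem_map.1 hg
      refine List.mem_map.2 ⟨g, List.mem_append_left _ hgL, ?_⟩
      ext x
      simp only [hσe, Fin.tail_cons]
    · exact List.mem_map.2 ⟨_, List.mem_append_right _ (List.mem_singleton_self _), rfl⟩
    · refine locCov_of_dzero hR hIR hfσ ?_ ?_ ?_
      · rw [dzero_iterate_comp f σ hσs, hσw]
        exact hfd
      · filter_upwards [hbz, hb'] with x hx1 hx2
        rw [dzero_iterate_comp f σ hσs, hσe, Fin.cons_zero, Fin.tail_cons, zero_add, hx2]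
        exact hx1
      · intro g hg
        rcases List.mem_append.1 hg with hg | hg
        · exact hL g hg
        · rw [List.mem_singleton.1 hg]; exact analyticAt_const

theorem resolvable (p : ℕ) [Fact p.Prime] [MeasureSpace ℚ_[p]] [BorelSpace ℚ_[p]]
    [(volume : Measure ℚ_[p]).IsAddHaarMeasure] (n : ℕ) : Resolvable p n := by
  induction n with
  | zero => exact resolvable_zero
  | succ n ih =>
    refine resolvable_succ fun d => ?_
    induction d with
    | zero => exact fun w f L _ h _ => by obtain ⟨i, hi, -⟩ := h; omega
    | succ d hd => exact resolvableOrder_succ ih hd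

end Monomialise

end

section

open Filter Topology Polynomial

/-- The shift operator on sequences. -/
def seqShift : Module.End ℂ (ℕ → ℂ) where
  toFun b L := b (L + 1)
  map_add' _ _ := rfl
  map_smul' _ _ := rfl

theorem exists_shift_sub_eq {ρ σ : ℂ} (hρ : ρ ≠ 0) (N : ℕ) (Q : ℂ[X]) (hQ : Q.degree < N) :
    ∃ Q' : ℂ[X], Q'.degree < (N + 1 : ℕ) ∧
      C ρ * Q'.comp (X + 1) - C σ * Q' = Q := by
  induction N generalizing Q with
  | zero =>
    have : Q = 0 := by
      rw [← degree_eq_bot]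
      simpa [Nat.WithBot.lt_zero_iff] using hQ
    exact ⟨0, by simp, by simp [this]⟩
  | succ N ih =>
    obtain ⟨a, d, hd, hM⟩ : ∃ (a : ℂ) (d : ℕ), d < N + 2 ∧
        (Q - (C ρ * (C a * X ^ d).comp (X + 1) - C σ * (C a * X ^ d))).degree < (N : WithBot ℕ) := by
      have key : ∀ (a : ℂ) (d j : ℕ), (C ρ * (C a * X ^ d).comp (X + 1) -
          C σ * (C a * X ^ d)).coeff j = ρ * a * (d.choose j) - σ * a * (if j = d then 1 else 0) := by
        intro a d j
        simp only [mul_comp, C_comp, pow_comp, X_comp, coeff_sub, coeff_C_mul,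
          coeff_X_add_one_pow, coeff_X_pow]
        ring
      have hQ0 : ∀ j, N + 1 ≤ j → Q.coeff j = 0 := (degree_lt_iff_coeff_zero _ _).1 hQ
      by_cases h : ρ = σ
      · refine ⟨Q.coeff N / (ρ * (N + 1)), N + 1, by omega, ?_⟩
        rw [degree_lt_iff_coeff_zero]
        intro j hj
        rw [coeff_sub, key]
        rcases eq_or_lt_of_le hj with rfl | hj
        · have : ((N : ℂ) + 1) ≠ 0 := by exact_mod_cast N.succ_ne_zero
          simp
          field_simp
          ring
        · rw [hQ0 j hj]
          rcases eq_or_lt_of_le (Nat.succ_le_of_lt hj) with h1 | h1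
          · rw [← h1, ← h]; simp
          · rw [Nat.choose_eq_zero_of_lt h1]
            have : ¬ j = N + 1 := by omega
            simp [this]
      · refine ⟨Q.coeff N / (ρ - σ), N, by omega, ?_⟩
        rw [degree_lt_iff_coeff_zero]
        intro j hj
        rw [coeff_sub, key]
        rcases eq_or_lt_of_le hj with rfl | hj
        · have : ρ - σ ≠ 0 := sub_ne_zero.2 h
          simp
          field_simp
          ring
        · rw [hQ0 j hj, Nat.choose_eq_zero_of_lt hj]
          have : ¬ j = N := by omega
          simp [this]
    obtain ⟨Q', hQ', e⟩ := ih _ hM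
    refine ⟨Q' + C a * X ^ d, ?_, ?_⟩
    · refine (degree_add_le _ _).trans_lt (max_lt ?_ ?_)
      · exact hQ'.trans (by exact_mod_cast Nat.lt_succ_self _)
      · exact (degree_C_mul_X_pow_le _ _).trans_lt (by exact_mod_cast hd)
    · rw [eq_sub_iff_add_eq] at e
      rw [← e, add_comp]
      ring

theorem seq_eq_of_recurrence (T : Finset ℂ) (hT : ∀ ρ ∈ T, ρ ≠ 0) (L₀ : ℕ) (s : Multiset ℂ)
    (hs : ∀ ρ ∈ s, ρ ∈ T) (b : ℕ → ℂ)
    (hb : ∀ L, L₀ ≤ L → aeval seqShift (s.map fun ρ => X - C ρ).prod b L = 0) :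
    ∃ Q : ℂ → ℂ[X], (∀ ρ, (Q ρ).degree < (s.card + 1 : ℕ)) ∧
      ∀ L, L₀ ≤ L → b L = ∑ ρ ∈ T, (Q ρ).eval (L : ℂ) * ρ ^ L := by
  induction s using Multiset.induction_on generalizing b with
  | empty =>
    refine ⟨0, fun ρ => by simp, fun L hL => ?_⟩
    simpa using hb L hL
  | cons σ t ih =>
    obtain ⟨Q, hQ, e⟩ := ih (fun ρ h => hs ρ (Multiset.mem_cons_of_mem h))
      (fun L => b (L + 1) - σ * b L) (by
        intro L hL
        have := hb L hL
        rw [Multiset.map_cons, Multiset.prod_cons, mul_comm, map_mul] at this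
        rw [← this, Module.End.mul_apply]
        refine congrFun (congrArg _ (funext fun L => ?_)) L
        simp [seqShift])
    have hσT : σ ∈ T := hs σ (Multiset.mem_cons_self _ _)
    have hσ := hT σ hσT
    have hex : ∀ ρ : ℂ, ∃ Q' : ℂ[X], Q'.degree < (t.card + 1 + 1 : ℕ) ∧
        (ρ ≠ 0 → C ρ * Q'.comp (X + 1) - C σ * Q' = Q ρ) := by
      intro ρ
      by_cases hρ : ρ = 0
      · exact ⟨0, by simp, fun h => absurd hρ h⟩
      · obtain ⟨Q', h1, h2⟩ := exists_shift_sub_eq (σ := σ) hρ _ (Q ρ) (hQ ρ)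
        exact ⟨Q', h1, fun _ => h2⟩
    choose Q' hd hQ' using hex
    set d : ℕ → ℂ := fun L => b L - ∑ ρ ∈ T, (Q' ρ).eval (L : ℂ) * ρ ^ L with hdd
    have hstep : ∀ L, L₀ ≤ L → d (L + 1) = σ * d L := by
      intro L hL
      have h1 := e L hL
      have h2 : ∀ ρ ∈ T, (Q ρ).eval (L : ℂ) * ρ ^ L =
          (Q' ρ).eval ((L + 1 : ℕ) : ℂ) * ρ ^ (L + 1) - σ * ((Q' ρ).eval (L : ℂ) * ρ ^ L) := by
        intro ρ hρ
        rw [← hQ' ρ (hT ρ hρ)]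
        simp [eval_comp]
        ring
      rw [Finset.sum_congr rfl h2, Finset.sum_sub_distrib, ← Finset.mul_sum] at h1
      simp only [hdd]
      linear_combination h1
    have hsol : ∀ L, L₀ ≤ L → d L = d L₀ * (σ ^ L₀)⁻¹ * σ ^ L := by
      intro L hL
      induction L, hL using Nat.le_induction with
      | base => field_simp
      | succ L hL ih => rw [hstep L hL, ih]; ring
    refine ⟨fun ρ => Q' ρ + if ρ = σ then C (d L₀ * (σ ^ L₀)⁻¹) else 0, fun ρ => ?_,
      fun L hL => ?_⟩
    · refine (degree_add_le _ _).trans_lt (max_lt (by simpa using hd ρ) ?_)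
      split_ifs
      · exact degree_C_le.trans_lt (by
          exact_mod_cast Nat.succ_pos _)
      · simp
    · have h1 := hsol L hL
      have h2 : ∑ ρ ∈ T, (if ρ = σ then C (d L₀ * (σ ^ L₀)⁻¹) else 0 : ℂ[X]).eval (L : ℂ) * ρ ^ L =
          d L₀ * (σ ^ L₀)⁻¹ * σ ^ L := by
        rw [Finset.sum_eq_single_of_mem σ hσT (fun ρ _ h => by simp [h])]
        simp
      simp only [eval_add, add_mul, Finset.sum_add_distrib]
      rw [h2, ← h1]
      simp only [hdd]
      ring

end

section

open Filter Topology Polynomial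

variable {p : ℕ} [Fact p.Prime]

/-- The operator `G ↦ G (· / p)` on functions on `ℚ_[p]`. -/
noncomputable def fnShift (p : ℕ) [Fact p.Prime] : Module.End ℂ (ℚ_[p] → ℂ) where
  toFun G z := G (z * (p : ℚ_[p])⁻¹)
  map_add' _ _ := rfl
  map_smul' _ _ := rfl

/-- Invariance under multiplication by units close to `1` together with a linear recurrence along
powers of `p`, both for large arguments only. -/
def IsTame (G : ℚ_[p] → ℂ) : Prop :=
  (∃ R : ℝ, ∀ᶠ u in 𝓝 (1 : ℚ_[p]), ∀ z, R < ‖z‖ → G (z * u) = G z) ∧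
    ∃ P : ℂ[X], P ≠ 0 ∧ (∀ ρ, P.IsRoot ρ → ρ ≠ 0 ∧ ‖ρ‖ < 1) ∧
      ∃ R : ℝ, ∀ z, R < ‖z‖ → aeval (fnShift p) P G z = 0

theorem aeval_fnShift_eq_zero {G : ℚ_[p] → ℂ} {R : ℝ} (h : ∀ z, R < ‖z‖ → G z = 0) (P : ℂ[X])
    {z : ℚ_[p]} (hz : R < ‖z‖) : aeval (fnShift p) P G z = 0 := by
  induction P using Polynomial.induction_on' with
  | add P Q hP hQ => simp [hP, hQ]
  | monomial k a =>
    have : ∀ k : ℕ, ∀ z, R < ‖z‖ → ((fnShift p) ^ k) G z = 0 := by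
      intro k
      induction k with
      | zero => simpa using h
      | succ k ih =>
        intro z hz
        rw [pow_succ', Module.End.mul_apply]
        refine ih _ ?_
        rw [norm_mul, norm_inv, Padic.norm_p, inv_inv]
        have : (1 : ℝ) ≤ p := by exact_mod_cast (Fact.out : p.Prime).one_lt.le
        nlinarith [norm_nonneg z]
    simp [aeval_monomial, this k z hz]

theorem aeval_fnShift_congr {G G' : ℚ_[p] → ℂ} {R : ℝ} (h : ∀ z, R < ‖z‖ → G z = G' z)
    (P : ℂ[X]) {z : ℚ_[p]} (hz : R < ‖z‖) :
    aeval (fnShift p) P G z = aeval (fnShift p) P G' z := by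
  rw [← sub_eq_zero, ← Pi.sub_apply, ← map_sub]
  exact aeval_fnShift_eq_zero (R := R) (fun z hz => by simp [h z hz]) P hz

theorem eventually_norm_eq_one : ∀ᶠ u in 𝓝 (1 : ℚ_[p]), ‖u‖ = 1 := by
  filter_upwards [Metric.ball_mem_nhds (1 : ℚ_[p]) one_pos] with u hu
  rw [mem_ball_iff_norm] at hu
  have := IsUltrametricDist.norm_add_eq_max_of_norm_ne_norm (x := u - 1) (y := 1)
    (by rw [norm_one]; exact hu.ne)
  rw [sub_add_cancel, norm_one, max_eq_right hu.le] at this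
  exact this

theorem IsTame.congr {G G' : ℚ_[p] → ℂ} (hG : IsTame G) {R : ℝ}
    (h : ∀ z, R < ‖z‖ → G z = G' z) : IsTame G' := by
  obtain ⟨⟨R₁, h1⟩, P, hP, hr, R₂, h2⟩ := hG
  refine ⟨⟨max R R₁, ?_⟩, P, hP, hr, max R R₂, ?_⟩
  · filter_upwards [h1, eventually_norm_eq_one] with u hu hu1 z hz
    rw [max_lt_iff] at hz
    rw [← h z hz.1, ← h _ (by rw [norm_mul, hu1, mul_one]; exact hz.1), hu z hz.2]
  · intro z hz
    rw [max_lt_iff] at hz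
    rw [← aeval_fnShift_congr h P hz.1, h2 z hz.2]

theorem isTame_zero : IsTame (0 : ℚ_[p] → ℂ) :=
  ⟨⟨0, by simp⟩, 1, one_ne_zero, by simp, 0, by simp⟩

theorem isTame_of_eventually_zero {G : ℚ_[p] → ℂ} {R : ℝ} (h : ∀ z, R < ‖z‖ → G z = 0) :
    IsTame G :=
  isTame_zero.congr (R := R) fun z hz => (h z hz).symm

theorem IsTame.add {G G' : ℚ_[p] → ℂ} (hG : IsTame G) (hG' : IsTame G') :
    IsTame (fun z => G z + G' z) := by
  obtain ⟨⟨R₁, h1⟩, P, hP, hr, R₂, h2⟩ := hG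
  obtain ⟨⟨R₁', h1'⟩, P', hP', hr', R₂', h2'⟩ := hG'
  refine ⟨⟨max R₁ R₁', ?_⟩, P * P', mul_ne_zero hP hP', ?_, max R₂ R₂', ?_⟩
  · filter_upwards [h1, h1'] with u hu hu' z hz
    rw [max_lt_iff] at hz
    rw [hu z hz.1, hu' z hz.2]
  · intro ρ hρ
    rcases root_mul.1 hρ with h | h
    · exact hr ρ h
    · exact hr' ρ h
  · intro z hz
    rw [max_lt_iff] at hz
    change aeval (fnShift p) (P * P') (G + G') z = 0
    rw [map_add]
    nth_rewrite 1 [mul_comm P P']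
    simp only [map_mul, Module.End.mul_apply, Pi.add_apply]
    rw [aeval_fnShift_eq_zero h2 P' hz.1, aeval_fnShift_eq_zero h2' P hz.2, add_zero]

theorem IsTame.smul {G : ℚ_[p] → ℂ} (hG : IsTame G) (c : ℂ) : IsTame (fun z => c * G z) := by
  obtain ⟨⟨R₁, h1⟩, P, hP, hr, R₂, h2⟩ := hG
  refine ⟨⟨R₁, ?_⟩, P, hP, hr, R₂, fun z hz => ?_⟩
  · filter_upwards [h1] with u hu z hz
    rw [hu z hz]
  · change aeval (fnShift p) P (c • G) z = 0
    rw [map_smul, Pi.smul_apply, h2 z hz, smul_zero]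

/-- The values of a function along `u * p ^ (-L)`. -/
noncomputable def fnRay (u : ℚ_[p]) : (ℚ_[p] → ℂ) →ₗ[ℂ] (ℕ → ℂ) where
  toFun G L := G (u * ((p : ℚ_[p]) ^ L)⁻¹)
  map_add' _ _ := rfl
  map_smul' _ _ := rfl

theorem fnRay_aeval (u : ℚ_[p]) (P : ℂ[X]) (G : ℚ_[p] → ℂ) :
    fnRay u (aeval (fnShift p) P G) = aeval seqShift P (fnRay u G) := by
  induction P using Polynomial.induction_on' with
  | add P Q hP hQ => simp [hP, hQ]
  | monomial k a =>
    have : ∀ k : ℕ, ∀ G, fnRay u (((fnShift p) ^ k) G) = (seqShift ^ k) (fnRay u G) := by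
      intro k
      induction k with
      | zero => simp
      | succ k ih =>
        intro G
        rw [pow_succ, pow_succ, Module.End.mul_apply, Module.End.mul_apply, ih]
        congr 1
        funext L
        simp only [fnRay, fnShift, seqShift, LinearMap.coe_mk, AddHom.coe_mk]
        rw [pow_succ, mul_inv, mul_assoc]
    simp [aeval_monomial, this]

theorem IsTame.exists_expansion {G : ℚ_[p] → ℂ} (hG : IsTame G) :
    ∃ (Γ : Finset ℂ) (m : ℕ) (e : ℂ → ℕ → ℚ_[p] → ℂ) (R : ℝ), 1 ≤ m ∧ (∀ γ ∈ Γ, γ.re < 0) ∧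
      (∀ γ i, IsLocallyConstant (e γ i)) ∧ ∀ z : ℚ_[p], R < ‖z‖ →
        G z = ∑ γ ∈ Γ, ∑ i ∈ Finset.Icc 1 m, e γ i (z * (p : ℚ_[p]) ^ (-z.valuation)) *
          ((‖z‖ : ℝ) : ℂ) ^ γ * ((Real.log ‖z‖ : ℝ) : ℂ) ^ (i - 1) := by
  classical
  have hp1 : (1 : ℝ) < p := by exact_mod_cast (Fact.out : p.Prime).one_lt
  have hlog : 0 < Real.log p := Real.log_pos hp1
  obtain ⟨⟨R₁, h1⟩, P, hP, hr, R₂, h2⟩ := hG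
  set R := max (max R₁ R₂) 1 with hR
  set G' : ℚ_[p] → ℂ := fun z => if R < ‖z‖ then G z else 0 with hG'
  have hGG : ∀ z, R < ‖z‖ → G z = G' z := fun z hz => by simp [hG', hz]
  have hinv : ∀ᶠ u in 𝓝 (1 : ℚ_[p]), ∀ z, G' (z * u) = G' z := by
    filter_upwards [h1, eventually_norm_eq_one] with u hu hu1 z
    simp only [hG', norm_mul, hu1, mul_one]
    split_ifs with h
    · exact hu z (by simp only [hR, max_lt_iff] at h; exact h.1.1)
    · rfl
  have hrec : ∀ z, R < ‖z‖ → aeval (fnShift p) P G' z = 0 := fun z hz => by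
    rw [← aeval_fnShift_congr hGG P hz]
    exact h2 z (by simp only [hR, max_lt_iff] at hz; exact hz.1.2)
  obtain ⟨L₀, hL₀⟩ := pow_unbounded_of_one_lt R hp1
  set T := P.roots.toFinset with hT
  have hTr : ∀ ρ ∈ T, ρ ≠ 0 ∧ ‖ρ‖ < 1 := fun ρ hρ => by
    simp only [hT, Multiset.mem_toFinset, mem_roots hP] at hρ
    exact hr ρ hρ
  set N := P.roots.card + 1 with hN
  have hseq : ∀ u : ℚ_[p], ‖u‖ = 1 → ∃ Q : ℂ → ℂ[X], (∀ ρ, (Q ρ).degree < (N : ℕ)) ∧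
      ∀ L, L₀ ≤ L → fnRay u G' L = ∑ ρ ∈ T, (Q ρ).eval (L : ℂ) * ρ ^ L := by
    intro u hu
    refine seq_eq_of_recurrence T (fun ρ h => (hTr ρ h).1) L₀ P.roots (fun ρ h => by
      simpa [hT] using h) _ ?_
    intro L hL
    have h3 : aeval seqShift P (fnRay u G') L = 0 := by
      rw [← fnRay_aeval]
      refine hrec _ (hL₀.trans_le ?_)
      rw [norm_mul, hu, one_mul, norm_inv, norm_pow, Padic.norm_p, inv_pow, inv_inv]
      exact pow_le_pow_right₀ hp1.le hL
    rw [(IsAlgClosed.splits P).eq_prod_roots] at h3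
    simpa [hP] using h3
  let cQ : (ℕ → ℂ) → ℂ → ℂ[X] := fun b =>
    if h : ∃ Q : ℂ → ℂ[X], (∀ ρ, (Q ρ).degree < (N : ℕ)) ∧
      ∀ L, L₀ ≤ L → b L = ∑ ρ ∈ T, (Q ρ).eval (L : ℂ) * ρ ^ L then h.choose else 0
  have hcQ : ∀ u : ℚ_[p], ‖u‖ = 1 → (∀ ρ, (cQ (fnRay u G') ρ).degree < (N : ℕ)) ∧
      ∀ L, L₀ ≤ L → fnRay u G' L = ∑ ρ ∈ T, (cQ (fnRay u G') ρ).eval (L : ℂ) * ρ ^ L := by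
    intro u hu
    simp only [cQ, dif_pos (hseq u hu)]
    exact (hseq u hu).choose_spec
  have hexp : ∀ ρ : ℂ, ρ ≠ 0 → Complex.exp (Complex.log ρ / (Real.log p : ℂ) * (Real.log p : ℂ)) = ρ := by
    intro ρ hρ
    rw [div_mul_cancel₀ _ (by exact_mod_cast hlog.ne'), Complex.exp_log hρ]
  refine ⟨T.image fun ρ => Complex.log ρ / (Real.log p : ℂ), N,
    fun γ i u => if ‖u‖ = 1 then
      (cQ (fnRay u G') (Complex.exp (γ * (Real.log p : ℂ)))).coeff (i - 1) /
      (Real.log p : ℂ) ^ (i - 1) else 0, (p : ℝ) ^ L₀, by omega, ?_, ?_, ?_⟩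
  · intro γ hγ
    obtain ⟨ρ, hρ, rfl⟩ := Finset.mem_image.1 hγ
    rw [Complex.div_ofReal_re, Complex.log_re]
    exact div_neg_of_neg_of_pos (Real.log_neg (norm_pos_iff.2 (hTr ρ hρ).1) (hTr ρ hρ).2) hlog
  · intro γ i
    rw [IsLocallyConstant.iff_eventually_eq]
    intro u
    rcases eq_or_ne u 0 with rfl | hu
    · filter_upwards [Metric.ball_mem_nhds (0 : ℚ_[p]) one_pos] with y hy
      rw [mem_ball_zero_iff] at hy
      simp [hy.ne]
    · have ht : Tendsto (fun y => u⁻¹ * y) (𝓝 u) (𝓝 1) := by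
        have : ContinuousAt (fun y => u⁻¹ * y) u := by fun_prop
        simpa [ContinuousAt, hu] using this
      filter_upwards [ht.eventually hinv, ht.eventually eventually_norm_eq_one] with y hy hy1
      have hn : ‖y‖ = ‖u‖ := by
        rw [norm_mul, norm_inv] at hy1
        have := norm_pos_iff.2 hu
        field_simp at hy1
        exact hy1
      have hray : fnRay y G' = fnRay u G' := by
        funext L
        simp only [fnRay, LinearMap.coe_mk, AddHom.coe_mk]
        rw [← hy (u * _)]
        congr 1
        field_simp
      simp only [hn, hray]
  · intro z hz
    have hz0 : z ≠ 0 := by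
      rintro rfl
      rw [norm_zero] at hz
      exact absurd hz (not_lt.2 (by positivity))
    have hp0 : (p : ℚ_[p]) ≠ 0 := by exact_mod_cast (Fact.out : p.Prime).ne_zero
    have hnz : ‖z‖ = (p : ℝ) ^ (-z.valuation) := Padic.norm_eq_zpow_neg_valuation hz0
    rw [hnz, ← zpow_natCast, zpow_lt_zpow_iff_right₀ hp1] at hz
    obtain ⟨L, hL⟩ : ∃ L : ℕ, (L : ℤ) = -z.valuation := ⟨(-z.valuation).toNat, by omega⟩
    have hLL : L₀ ≤ L := by omega
    rw [← hL] at hnz ⊢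
    rw [zpow_natCast] at hnz ⊢
    set u := z * (p : ℚ_[p]) ^ L with hu
    have hu1 : ‖u‖ = 1 := by
      rw [hu, norm_mul, hnz, norm_pow, Padic.norm_p, inv_pow]
      exact mul_inv_cancel₀ (by positivity)
    have hGz : G z = fnRay u G' L := by
      simp only [fnRay, LinearMap.coe_mk, AddHom.coe_mk]
      rw [hu, mul_inv_cancel_right₀ (pow_ne_zero _ hp0)]
      exact hGG z (by rw [hnz]; exact hL₀.trans_le (pow_le_pow_right₀ hp1.le hLL))
    rw [hGz, (hcQ u hu1).2 L hLL, Finset.sum_image]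
    · refine Finset.sum_congr rfl fun ρ hρ => ?_
      have hln : Real.log ‖z‖ = L * Real.log p := by rw [hnz, Real.log_pow]
      have hpow : ((‖z‖ : ℝ) : ℂ) ^ (Complex.log ρ / (Real.log p : ℂ)) = ρ ^ L := by
        rw [Complex.cpow_def_of_ne_zero (by exact_mod_cast norm_ne_zero_iff.2 hz0),
          ← Complex.ofReal_log (norm_nonneg _), hln]
        conv_rhs => rw [← hexp ρ (hTr ρ hρ).1]
        rw [← Complex.exp_nat_mul]
        congr 1
        push_cast
        ring
      have hIcc : ∀ F : ℕ → ℂ, ∑ i ∈ Finset.Icc 1 N, F i = ∑ i ∈ Finset.range N, F (i + 1) := by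
        intro F
        rw [Finset.range_eq_Ico, Finset.sum_Ico_add']
        rfl
      simp only [hpow, hln, hexp ρ (hTr ρ hρ).1, hu1, if_true, hIcc, Nat.add_sub_cancel]
      have hnd : (cQ (fnRay u G') ρ).natDegree < N := by
        rcases eq_or_ne (cQ (fnRay u G') ρ) 0 with h | h
        · rw [h, natDegree_zero]; omega
        · exact (natDegree_lt_iff_degree_lt h).2 ((hcQ u hu1).1 ρ)
      rw [Polynomial.eval_eq_sum_range' hnd, Finset.sum_mul]
      refine Finset.sum_congr rfl fun i _ => ?_
      have : (Real.log p : ℂ) ≠ 0 := by exact_mod_cast hlog.ne'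
      rw [Complex.ofReal_mul, Complex.ofReal_natCast, mul_pow]
      field_simp
    · intro ρ hρ ρ' hρ' h
      rw [← hexp ρ (hTr ρ hρ).1, ← hexp ρ' (hTr ρ' hρ').1]
      exact congrArg (fun x => Complex.exp (x * (Real.log p : ℂ))) h

end

section

open Filter Topology MeasureTheory
open scoped ENNReal NNReal

section Ultrametric

variable {X : Type*} [NormedAddCommGroup X] [IsUltrametricDist X]

theorem exists_isometryEquiv_add [CompleteSpace X] {c : ℝ≥0} (hc : c < 1) {g : X → X}
    (hg : LipschitzWith c g) : ∃ T : X ≃ᵢ X, ∀ x, T x = x + g x := by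
  have hiso : Isometry fun x => x + g x := by
    refine Isometry.of_dist_eq fun x y => ?_
    rcases eq_or_ne x y with rfl | hxy
    · simp
    have hlt : ‖g x - g y‖ < ‖x - y‖ := by
      have h1 := hg.dist_le_mul x y
      rw [dist_eq_norm, dist_eq_norm] at h1
      have h2 : 0 < ‖x - y‖ := norm_pos_iff.2 (sub_ne_zero.2 hxy)
      have h3 : (c : ℝ) < 1 := hc
      nlinarith
    rw [dist_eq_norm, dist_eq_norm, show x + g x - (y + g y) = (x - y) + (g x - g y) by abel,
      IsUltrametricDist.norm_add_eq_max_of_norm_ne_norm hlt.ne', max_eq_left hlt.le]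
  have hsurj : Function.Surjective fun x => x + g x := by
    intro y
    have hK : ContractingWith c fun x => y - g x :=
      ⟨hc, LipschitzWith.of_dist_le_mul fun a b => by
        rw [dist_sub_left]; exact hg.dist_le_mul a b⟩
    refine ⟨hK.fixedPoint _, ?_⟩
    have := hK.fixedPoint_isFixedPt
    rw [Function.IsFixedPt] at this
    exact (eq_sub_iff_add_eq.1 this.symm)
  exact ⟨⟨Equiv.ofBijective _ ⟨hiso.injective, hsurj⟩, hiso⟩, fun x => rfl⟩

theorem IsometryEquiv.measurePreserving_of_isUltrametricDist [ProperSpace X] [MeasurableSpace X]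
    [BorelSpace X] (μ : Measure X) [μ.IsAddHaarMeasure] (T : X ≃ᵢ X) : MeasurePreserving T μ μ := by
  have : SecondCountableTopology X := secondCountable_of_proper
  refine ⟨T.continuous.measurable, ?_⟩
  set 𝒞 : Set (Set X) := {S | ∃ (x : X) (r : ℝ), 0 < r ∧ S = Metric.closedBall x r} with h𝒞
  have hbasis : TopologicalSpace.IsTopologicalBasis 𝒞 := by
    refine TopologicalSpace.isTopologicalBasis_of_isOpen_of_nhds ?_ ?_
    · rintro _ ⟨x, r, hr, rfl⟩
      exact IsUltrametricDist.isOpen_closedBall x hr.ne'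
    · intro a U ha hU
      obtain ⟨r, hr, h⟩ := Metric.nhds_basis_closedBall.mem_iff.1 (hU.mem_nhds ha)
      exact ⟨_, ⟨a, r, hr, rfl⟩, Metric.mem_closedBall_self hr.le, h⟩
  have hball : ∀ x r, Measure.map T μ (Metric.closedBall x r) = μ (Metric.closedBall x r) := by
    intro x r
    rw [Measure.map_apply T.continuous.measurable measurableSet_closedBall,
      T.preimage_closedBall]
    have h : ∀ a : X, μ (Metric.closedBall a r) = μ (Metric.closedBall 0 r) := by
      intro a
      rw [← measure_preimage_add μ a (Metric.closedBall a r)]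
      congr 1
      ext y
      simp [dist_eq_norm]
    rw [h, h x]
  refine Measure.ext_of_generateFrom_of_iUnion 𝒞 (fun k : ℕ => Metric.closedBall (0 : X) (k + 1))
    ?_ ?_ ?_ ?_ ?_ ?_
  · rw [‹BorelSpace X›.measurable_eq, hbasis.borel_eq_generateFrom]
  · rintro _ ⟨x, r, hr, rfl⟩ _ ⟨y, s, hs, rfl⟩ hne
    rcases IsUltrametricDist.closedBall_subset_trichotomy x y r s with h | h | h
    · exact ⟨x, r, hr, Set.inter_eq_left.2 h⟩
    · exact ⟨y, s, hs, Set.inter_eq_right.2 h⟩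
    · exact absurd hne (Set.not_nonempty_iff_eq_empty.2 (Set.disjoint_iff_inter_eq_empty.1 h))
  · exact Set.eq_univ_of_forall fun x => by
      obtain ⟨k, hk⟩ := exists_nat_ge ‖x‖
      exact Set.mem_iUnion.2 ⟨k, by rw [mem_closedBall_zero_iff]; linarith⟩
  · exact fun k => ⟨0, k + 1, by positivity, rfl⟩
  · intro k
    rw [hball]
    exact (isCompact_closedBall _ _).measure_ne_top
  · rintro _ ⟨x, r, hr, rfl⟩
    exact hball x r

end Ultrametric

section Straighten

variable {p : ℕ} [Fact p.Prime] {n : ℕ}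

/-- A root of an analytic germ close to `1`. -/
theorem exists_root_lipschitz {w : (Fin n → ℚ_[p]) → ℚ_[p]} (hw : AnalyticAt ℚ_[p] w 0)
    (hw0 : w 0 ≠ 0) {N : ℕ} (hN : N ≠ 0) :
    ∃ θ : (Fin n → ℚ_[p]) → ℚ_[p], θ 0 = 1 ∧ (∀ᶠ y in 𝓝 0, w y = w 0 * θ y ^ N) ∧
      ∃ (c : ℝ≥0), ∃ s ∈ 𝓝 (0 : Fin n → ℚ_[p]), LipschitzOnWith c θ s := by
  have h : HasStrictDerivAt (fun y : ℚ_[p] => y ^ N) ((N : ℚ_[p]) * 1 ^ (N - 1)) 1 :=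
    hasStrictDerivAt_pow N 1
  have hne : (N : ℚ_[p]) * 1 ^ (N - 1) ≠ 0 := by simpa using hN
  set ρ := h.localInverse _ _ _ hne with hρ
  have hρd := h.to_localInverse hne
  have hρ1 : ρ (1 ^ N) = 1 := (h.hasStrictFDerivAt_equiv hne).localInverse_apply_image
  have hρi : ∀ᶠ x in 𝓝 ((1 : ℚ_[p]) ^ N), ρ x ^ N = x :=
    (h.hasStrictFDerivAt_equiv hne).eventually_right_inverse
  rw [one_pow] at hρ1 hρi
  have hq : HasStrictFDerivAt (fun y => w y / w 0) _ 0 :=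
    (hw.div_const (c := w 0)).hasStrictFDerivAt
  have hq0 : w 0 / w 0 = 1 := div_self hw0
  simp only [one_pow] at hρd
  have hθ := HasStrictDerivAt.comp_hasStrictFDerivAt (h₂ := ρ) (f := fun y => w y / w 0) 0
    (by rw [hq0]; exact hρd) hq
  refine ⟨fun y => ρ (w y / w 0), by simp only [hq0, hρ1], ?_, ?_⟩
  · have hc : Tendsto (fun y => w y / w 0) (𝓝 0) (𝓝 1) := by
      have := hq.continuousAt
      rwa [ContinuousAt, hq0] at this
    filter_upwards [hc.eventually hρi] with y hy
    rw [hy]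
    field_simp
  · obtain ⟨c, s, hs, hl⟩ := hθ.exists_lipschitzOnWith
    exact ⟨c, s, hs, hl⟩

theorem exists_straighten {w : (Fin n → ℚ_[p]) → ℚ_[p]} (hw : AnalyticAt ℚ_[p] w 0)
    (hw0 : w 0 ≠ 0) {e : Fin n → ℕ} {k : Fin n} (hk : e k ≠ 0) :
    ∃ r₀ : ℝ, 0 < r₀ ∧ ∀ r, 0 < r → r ≤ r₀ → ∃ T : (Fin n → ℚ_[p]) ≃ᵢ (Fin n → ℚ_[p]),
      (∀ y l, ‖T y l‖ = ‖y l‖) ∧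
      ∀ y, ‖y‖ ≤ r → w y * ∏ l, y l ^ e l = w 0 * ∏ l, T y l ^ e l := by
  classical
  obtain ⟨θ, hθ0, hθ, c, s, hs, hl⟩ := exists_root_lipschitz hw hw0 hk
  obtain ⟨r₁, hr₁, hb⟩ := Metric.nhds_basis_closedBall.mem_iff.1 (Filter.inter_mem hs hθ)
  refine ⟨min r₁ (2⁻¹ * (c + 1 : ℝ)⁻¹), by positivity, fun r hr hrr => ?_⟩
  rw [le_min_iff] at hrr
  have hcr : (c : ℝ) * r ≤ 2⁻¹ := by
    have h1 := hrr.2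
    have : (0 : ℝ) ≤ c := c.2
    have h2 : (c + 1 : ℝ) * r ≤ 2⁻¹ := by
      calc (c + 1 : ℝ) * r ≤ (c + 1) * (2⁻¹ * (c + 1 : ℝ)⁻¹) := by gcongr
        _ = 2⁻¹ := by field_simp
    nlinarith
  have hmem : ∀ y : Fin n → ℚ_[p], ‖y‖ ≤ r → y ∈ s ∧ w y = w 0 * θ y ^ e k := fun y hy =>
    hb (mem_closedBall_zero_iff.2 (hy.trans hrr.1))
  have h0s : (0 : Fin n → ℚ_[p]) ∈ s := (hmem 0 (by simpa using hr.le)).1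
  have hη : ∀ y : Fin n → ℚ_[p], ‖y‖ ≤ r → ‖θ y - 1‖ ≤ 2⁻¹ := by
    intro y hy
    have := hl.dist_le_mul y (hmem y hy).1 0 h0s
    rw [hθ0, dist_eq_norm, dist_eq_norm, sub_zero] at this
    refine this.trans (le_trans ?_ hcr)
    gcongr
  set g : (Fin n → ℚ_[p]) → (Fin n → ℚ_[p]) :=
    fun y => if ‖y‖ ≤ r then Pi.single k (y k * (θ y - 1)) else 0 with hg
  have hsingle : ∀ a : ℚ_[p], ‖(Pi.single k a : Fin n → ℚ_[p])‖ = ‖a‖ := fun a =>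
    Pi.norm_single (G := fun _ : Fin n => ℚ_[p]) a
  have hgn : ∀ y, ‖g y‖ ≤ 2⁻¹ * ‖y‖ := by
    intro y
    simp only [hg]
    split_ifs with h
    · rw [hsingle, norm_mul, mul_comm]
      exact mul_le_mul (hη y h) (norm_le_pi_norm y k) (norm_nonneg _) (by norm_num)
    · rw [norm_zero]; positivity
  have hout : ∀ x y : Fin n → ℚ_[p], ‖x‖ ≤ r → ¬ ‖y‖ ≤ r → ‖g x - g y‖ ≤ 2⁻¹ * ‖x - y‖ := by
    intro x y hx hy
    have h1 : g y = 0 := by simp only [hg, if_neg hy]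
    rw [h1, sub_zero]
    refine (hgn x).trans ?_
    push Not at hy
    have : ‖x - y‖ = ‖y‖ := by
      rw [sub_eq_add_neg, IsUltrametricDist.norm_add_eq_max_of_norm_ne_norm
        (by rw [norm_neg]; exact (hx.trans_lt hy).ne), norm_neg, max_eq_right (hx.trans hy.le)]
    rw [this]
    linarith
  have hlip : LipschitzWith 2⁻¹ g := by
    refine LipschitzWith.of_dist_le_mul fun x y => ?_
    rw [dist_eq_norm, dist_eq_norm]
    push_cast
    by_cases hx : ‖x‖ ≤ r <;> by_cases hy : ‖y‖ ≤ r
    · have e1 : g x - g y = Pi.single k (x k * (θ x - θ y) + (x k - y k) * (θ y - 1)) := by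
        simp only [hg, if_pos hx, if_pos hy]
        rw [← Pi.single_sub]
        congr 1
        ring
      rw [e1, hsingle]
      refine (IsUltrametricDist.norm_add_le_max _ _).trans (max_le ?_ ?_)
      · rw [norm_mul]
        have h1 := hl.dist_le_mul x (hmem x hx).1 y (hmem y hy).1
        rw [dist_eq_norm, dist_eq_norm] at h1
        calc ‖x k‖ * ‖θ x - θ y‖ ≤ r * (c * ‖x - y‖) :=
              mul_le_mul ((norm_le_pi_norm x k).trans hx) h1 (norm_nonneg _) hr.le
          _ = (c * r) * ‖x - y‖ := by ring
          _ ≤ 2⁻¹ * ‖x - y‖ := by gcongr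
      · rw [norm_mul, mul_comm]
        refine mul_le_mul (hη y hy) ?_ (norm_nonneg _) (by norm_num)
        exact norm_le_pi_norm (x - y) k
    · exact hout x y hx hy
    · rw [norm_sub_rev, norm_sub_rev x]
      exact hout y x hy hx
    · simp only [hg, if_neg hx, if_neg hy, sub_zero, norm_zero]
      positivity
  obtain ⟨T, hT⟩ := exists_isometryEquiv_add (by
    rw [← NNReal.coe_lt_coe]; push_cast; norm_num) hlip
  have hTl : ∀ y l, l ≠ k → T y l = y l := by
    intro y l hlk
    rw [hT]
    simp only [hg]
    split_ifs <;> simp [hlk]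
  have hTk : ∀ y, ‖y‖ ≤ r → T y k = y k * θ y := by
    intro y hy
    rw [hT]
    simp only [hg, if_pos hy, Pi.add_apply, Pi.single_eq_same]
    ring
  refine ⟨T, fun y l => ?_, fun y hy => ?_⟩
  · by_cases hlk : l = k
    · subst hlk
      by_cases hy : ‖y‖ ≤ r
      · have : ‖θ y‖ = 1 := by
          have h1 := IsUltrametricDist.norm_add_eq_max_of_norm_ne_norm (x := θ y - 1) (y := 1)
            (by rw [norm_one]; exact ((hη y hy).trans_lt (by norm_num)).ne)
          rw [sub_add_cancel, norm_one, max_eq_right ((hη y hy).trans (by norm_num))] at h1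
          exact h1
        rw [hTk y hy, norm_mul, this, mul_one]
      · rw [hT]
        simp [hg, hy]
    · rw [hTl y l hlk]
  · rw [(hmem y hy).2, mul_assoc]
    congr 1
    rw [← Finset.mul_prod_erase _ _ (Finset.mem_univ k), ← Finset.mul_prod_erase _ _ (Finset.mem_univ k),
      hTk y hy, mul_pow]
    rw [Finset.prod_congr rfl fun l hl => by rw [← hTl y l (Finset.ne_of_mem_erase hl)]]
    ring

end Straighten

end

section

open Filter Topology MeasureTheory
open scoped ENNReal NNReal

set_option linter.unusedSectionVars false

section Oscillation

variable {p : ℕ} [Fact p.Prime] {n : ℕ}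

/-- Multiplication of one coordinate by a constant. -/
noncomputable def scaleCoord (k : Fin n) (v : ℚ_[p]) (y : Fin n → ℚ_[p]) : Fin n → ℚ_[p] :=
  Function.update y k (v * y k)

@[simp] theorem scaleCoord_same (k : Fin n) (v : ℚ_[p]) (y : Fin n → ℚ_[p]) :
    scaleCoord k v y k = v * y k := by simp [scaleCoord]

theorem scaleCoord_of_ne {k l : Fin n} (h : l ≠ k) (v : ℚ_[p]) (y : Fin n → ℚ_[p]) :
    scaleCoord k v y l = y l := by simp [scaleCoord, h]

theorem norm_scaleCoord_apply {k : Fin n} {v : ℚ_[p]} (hv : ‖v‖ = 1) (y : Fin n → ℚ_[p])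
    (l : Fin n) : ‖scaleCoord k v y l‖ = ‖y l‖ := by
  by_cases h : l = k
  · subst h; simp [hv]
  · rw [scaleCoord_of_ne h]

theorem prod_pow_scaleCoord (k : Fin n) (v : ℚ_[p]) (y : Fin n → ℚ_[p]) (e : Fin n → ℕ) :
    ∏ l, scaleCoord k v y l ^ e l = v ^ e k * ∏ l, y l ^ e l := by
  classical
  rw [← Finset.mul_prod_erase _ _ (Finset.mem_univ k),
    ← Finset.mul_prod_erase _ (fun l => y l ^ e l) (Finset.mem_univ k), scaleCoord_same, mul_pow,
    mul_assoc]
  congr 2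
  exact Finset.prod_congr rfl fun l hl => by rw [scaleCoord_of_ne (Finset.ne_of_mem_erase hl)]

theorem scaleCoord_scaleCoord (k : Fin n) (v v' : ℚ_[p]) (y : Fin n → ℚ_[p]) :
    scaleCoord k v (scaleCoord k v' y) = scaleCoord k (v * v') y := by
  simp [scaleCoord, mul_assoc]

theorem scaleCoord_one (k : Fin n) (y : Fin n → ℚ_[p]) : scaleCoord k 1 y = y := by
  simp [scaleCoord]

theorem continuous_scaleCoord (k : Fin n) (v : ℚ_[p]) : Continuous (scaleCoord k v) := by
  unfold scaleCoord
  exact continuous_id.update k (by fun_prop)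

variable [MeasureSpace ℚ_[p]] [BorelSpace ℚ_[p]] [(volume : Measure ℚ_[p]).IsAddHaarMeasure]

theorem volume_eq_smul_map_scaleCoord (k : Fin n) {v : ℚ_[p]} (hv : v ≠ 0) :
    (volume : Measure (Fin n → ℚ_[p])) = ‖v‖ₑ • volume.map (scaleCoord k v) := by
  obtain ⟨n, rfl⟩ : ∃ m, n = m + 1 := ⟨n - 1, by have := k.pos; omega⟩
  have := volume_eq_sum_map_update (p := p) (n := n) {()} (fun _ => 1) k
    (fun _ w => v * w k) (fun _ _ => v) (fun _ => by fun_prop) (fun _ => by fun_prop) ?_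
  · simp only [Finset.sum_singleton, one_smul, withDensity_const] at this
    rw [Measure.map_smul] at this
    exact this
  · refine Eventually.of_forall fun x S hS => ?_
    simp only [Finset.sum_singleton, one_mul, Fin.insertNth_apply_same, lintegral_const,
      Measure.restrict_apply_univ]
    exact (volume_preimage_mul hv S).symm

theorem integral_scaleCoord (k : Fin n) {v : ℚ_[p]} (hv : v ≠ 0) (F : (Fin n → ℚ_[p]) → ℂ) :
    ∫ y, F y = (‖v‖ : ℂ) * ∫ y, F (scaleCoord k v y) := by
  let e : (Fin n → ℚ_[p]) ≃ₜ (Fin n → ℚ_[p]) :=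
    { toFun := scaleCoord k v
      invFun := scaleCoord k v⁻¹
      left_inv := fun y => by rw [scaleCoord_scaleCoord, inv_mul_cancel₀ hv, scaleCoord_one]
      right_inv := fun y => by rw [scaleCoord_scaleCoord, mul_inv_cancel₀ hv, scaleCoord_one]
      continuous_toFun := continuous_scaleCoord k v
      continuous_invFun := continuous_scaleCoord k v⁻¹ }
  conv_lhs => rw [volume_eq_smul_map_scaleCoord k hv]
  rw [integral_smul_measure]
  have := e.measurableEmbedding.integral_map (μ := volume) F
  change ∫ y, F y ∂(volume.map (scaleCoord k v)) = ∫ y, F (scaleCoord k v y) at this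
  rw [this, toReal_enorm, Complex.real_smul]

/-- Continuous unitary characters of `ℚ_[p]` which are nontrivial on the ball of radius `p`. -/
structure IsStandardChar (Ψ : ℚ_[p] → ℂ) : Prop where
  map_add : ∀ a b, Ψ (a + b) = Ψ a * Ψ b
  cont : Continuous Ψ
  norm_eq : ∀ x, ‖Ψ x‖ = 1
  nontriv : ∃ x : ℚ_[p], ‖x‖ ≤ p ∧ Ψ x ≠ 1

variable {Ψ : ℚ_[p] → ℂ}

theorem IsStandardChar.integral_eq_zero (hΨ : IsStandardChar Ψ) {x : ℚ_[p]} (hx : 1 < ‖x‖) :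
    ∫ i in Metric.closedBall (0 : ℚ_[p]) 1, Ψ (x * i) = 0 := by
  obtain ⟨x₁, hx₁, hne⟩ := hΨ.nontriv
  have hxp : (p : ℝ) ≤ ‖x‖ := by
    by_contra h
    push Not at h
    have := (Padic.norm_le_pow_iff_norm_lt_pow_add_one x 0).2 (by simpa using h)
    rw [zpow_zero] at this
    exact absurd hx (not_lt.2 this)
  have hx0 : x ≠ 0 := norm_pos_iff.1 (by linarith)
  set i₀ := x₁ / x with hi₀
  have hi₀n : ‖i₀‖ ≤ 1 := by
    rw [hi₀, norm_div]
    exact div_le_one_of_le₀ (hx₁.trans hxp) (norm_nonneg _)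
  set B := Metric.closedBall (0 : ℚ_[p]) 1 with hB
  have hmem : ∀ i : ℚ_[p], i + i₀ ∈ B ↔ i ∈ B := by
    intro i
    simp only [hB, mem_closedBall_zero_iff]
    refine ⟨fun h => ?_, fun h => (IsUltrametricDist.norm_add_le_max _ _).trans (max_le h hi₀n)⟩
    have := (IsUltrametricDist.norm_add_le_max (i + i₀) (-i₀)).trans
      (max_le h (by rwa [norm_neg]))
    rwa [add_neg_cancel_right] at this
  have key : ∫ i in B, Ψ (x * i) = Ψ x₁ * ∫ i in B, Ψ (x * i) := by
    have hBm : MeasurableSet B := measurableSet_closedBall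
    rw [← integral_indicator hBm, ← integral_const_mul,
      ← integral_add_right_eq_self (B.indicator fun i => Ψ (x * i)) i₀]
    refine integral_congr_ae (Eventually.of_forall fun i => ?_)
    by_cases hi : i ∈ B
    · simp only [Set.indicator_of_mem hi, Set.indicator_of_mem ((hmem i).2 hi)]
      rw [mul_add, hΨ.map_add, hi₀, mul_div_cancel₀ _ hx0, mul_comm]
    · simp only [Set.indicator_of_notMem hi, Set.indicator_of_notMem (mt (hmem i).1 hi), mul_zero]
  have : (1 - Ψ x₁) * ∫ i in B, Ψ (x * i) = 0 := by linear_combination key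
  exact (mul_eq_zero.1 this).resolve_left (sub_ne_zero.2 hne.symm)

section Averaging

variable {k : Fin n} {W : (Fin n → ℚ_[p]) → ℂ} {t : (Fin n → ℚ_[p]) → ℚ_[p]}

theorem integral_mul_unit (hW : ∀ v : ℚ_[p], ‖v‖ = 1 → ∀ y, W (scaleCoord k v y) = W y)
    {u : ℚ_[p]} (ht : ∃ v : ℚ_[p], ‖v‖ = 1 ∧ ∀ y, t (scaleCoord k v y) = u * t y) (z : ℚ_[p]) :
    ∫ y, W y * Ψ (z * u * t y) = ∫ y, W y * Ψ (z * t y) := by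
  obtain ⟨v, hv, h⟩ := ht
  have hv0 : v ≠ 0 := norm_pos_iff.1 (by rw [hv]; exact one_pos)
  rw [integral_scaleCoord k hv0 (fun y => W y * Ψ (z * t y)), hv]
  simp only [Complex.ofReal_one, one_mul]
  refine integral_congr_ae (Eventually.of_forall fun y => ?_)
  simp only [hW v hv, h, mul_assoc]

theorem integral_eq_zero_of_large (hΨ : IsStandardChar Ψ) (hWi : Integrable W)
    (hW : ∀ v : ℚ_[p], ‖v‖ = 1 → ∀ y, W (scaleCoord k v y) = W y) (htm : Measurable t)
    (ht : ∀ᶠ u in 𝓝 (1 : ℚ_[p]), ∃ v : ℚ_[p], ‖v‖ = 1 ∧ ∀ y, t (scaleCoord k v y) = u * t y)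
    {a : ℝ} (ha : 0 < a) (hta : ∀ y, W y ≠ 0 → a ≤ ‖t y‖) :
    ∃ R : ℝ, ∀ z : ℚ_[p], R < ‖z‖ → ∫ y, W y * Ψ (z * t y) = 0 := by
  obtain ⟨r, hr, hb⟩ := Metric.eventually_nhds_iff_ball.1 ht
  obtain ⟨q, hq0, hqr⟩ := NormedField.exists_norm_lt ℚ_[p] hr
  refine ⟨(a * ‖q‖)⁻¹, fun z hz => ?_⟩
  set B := Metric.closedBall (0 : ℚ_[p]) 1 with hB
  have hintg : ∀ i ∈ B, ∫ y, W y * Ψ (z * t y) = ∫ y, W y * Ψ (z * t y) * Ψ (z * t y * q * i) := by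
    intro i hi
    rw [hB, mem_closedBall_zero_iff] at hi
    rw [← integral_mul_unit hW (hb (1 + q * i) ?_) z]
    · refine integral_congr_ae (Eventually.of_forall fun y => ?_)
      simp only
      rw [mul_assoc (W y), ← hΨ.map_add]
      congr 2
      ring
    · rw [mem_ball_iff_norm, add_sub_cancel_left, norm_mul]
      exact (mul_le_of_le_one_right (norm_nonneg _) hi).trans_lt hqr
  have hmeas : AEStronglyMeasurable
      (fun x : ℚ_[p] × (Fin n → ℚ_[p]) => W x.2 * Ψ (z * t x.2) * Ψ (z * t x.2 * q * x.1))
      ((volume.restrict B).prod volume) := by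
    refine (AEStronglyMeasurable.mul ?_ ?_).mul ?_
    · exact hWi.aestronglyMeasurable.comp_snd
    · exact (hΨ.cont.measurable.comp (by fun_prop)).aestronglyMeasurable
    · exact (hΨ.cont.measurable.comp (by fun_prop)).aestronglyMeasurable
  have : IsFiniteMeasure ((volume : Measure ℚ_[p]).restrict B) :=
    ⟨by rw [Measure.restrict_apply_univ]; exact (isCompact_closedBall _ _).measure_lt_top⟩
  have hprod : Integrable
      (fun x : ℚ_[p] × (Fin n → ℚ_[p]) => W x.2 * Ψ (z * t x.2) * Ψ (z * t x.2 * q * x.1))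
      ((volume.restrict B).prod volume) := by
    refine (hWi.comp_snd (volume.restrict B)).mono hmeas (Eventually.of_forall fun x => ?_)
    simp [hΨ.norm_eq]
  have h1 : ∫ i in B, ∫ y, W y * Ψ (z * t y) * Ψ (z * t y * q * i) =
      ∫ i in B, ∫ y, W y * Ψ (z * t y) :=
    setIntegral_congr_fun measurableSet_closedBall fun i hi => (hintg i hi).symm
  rw [integral_integral_swap (f := fun i y => W y * Ψ (z * t y) * Ψ (z * t y * q * i)) hprod,
    setIntegral_const] at h1
  have h2 : ∀ y, ∫ i in B, W y * Ψ (z * t y) * Ψ (z * t y * q * i) = 0 := by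
    intro y
    rw [integral_const_mul]
    by_cases hy : W y = 0
    · simp [hy]
    · rw [hΨ.integral_eq_zero, mul_zero]
      rw [norm_mul, norm_mul]
      have h3 := hta y hy
      have hq := hq0
      rw [inv_lt_iff_one_lt_mul₀ (by positivity)] at hz
      nlinarith [mul_le_mul_of_nonneg_left h3 (mul_nonneg (norm_nonneg z) hq.le)]
  simp only [h2, integral_zero] at h1
  have hv : (volume : Measure ℚ_[p]).real B ≠ 0 :=
    (ENNReal.toReal_pos (Metric.measure_closedBall_pos _ _ one_pos).ne'
      (isCompact_closedBall _ _).measure_ne_top).ne'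
  exact (smul_eq_zero.1 h1.symm).resolve_left hv

end Averaging

end Oscillation

end

section

open Filter Topology MeasureTheory
open scoped ENNReal NNReal

set_option linter.unusedSectionVars false

section Monomial

variable {p : ℕ} [Fact p.Prime] {n : ℕ}

/-- A monomial in the norms of the coordinates. -/
noncomputable def normMonomial (δ : Fin n → ℕ) (y : Fin n → ℚ_[p]) : ℂ :=
  ((∏ l, ‖y l‖ ^ δ l : ℝ) : ℂ)

/-- Points of a polydisc whose coordinates in a given set have maximal norm. -/
def polyShell (p : ℕ) [Fact p.Prime] (r : ℝ) (s : Finset (Fin n)) : Set (Fin n → ℚ_[p]) :=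
  {y | ‖y‖ ≤ r ∧ ∀ l ∈ s, r / p < ‖y l‖}

theorem continuous_normMonomial (δ : Fin n → ℕ) :
    Continuous (normMonomial δ : (Fin n → ℚ_[p]) → ℂ) := by
  unfold normMonomial
  fun_prop

theorem normMonomial_congr {δ : Fin n → ℕ} {x y : Fin n → ℚ_[p]} (h : ∀ l, ‖x l‖ = ‖y l‖) :
    normMonomial δ x = normMonomial δ y := by
  simp only [normMonomial, h]

theorem normMonomial_scaleCoord (δ : Fin n → ℕ) (k : Fin n) (v : ℚ_[p]) (y : Fin n → ℚ_[p]) :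
    normMonomial δ (scaleCoord k v y) = (‖v‖ : ℂ) ^ δ k * normMonomial δ y := by
  have := congrArg (fun x : ℚ_[p] => ((‖x‖ : ℝ) : ℂ)) (prod_pow_scaleCoord k v y δ)
  simpa [normMonomial, norm_prod] using this

theorem norm_congr_coord {x y : Fin n → ℚ_[p]} (h : ∀ l, ‖x l‖ = ‖y l‖) : ‖x‖ = ‖y‖ := by
  simp only [Pi.norm_def, nnnorm, h]

theorem eventually_exists_scale {e : Fin n → ℕ} {k : Fin n} (hk : e k ≠ 0) (w₀ : ℚ_[p]) :
    ∀ᶠ u in 𝓝 (1 : ℚ_[p]), ∃ v : ℚ_[p], ‖v‖ = 1 ∧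
      ∀ y : Fin n → ℚ_[p], w₀ * ∏ l, scaleCoord k v y l ^ e l = u * (w₀ * ∏ l, y l ^ e l) := by
  filter_upwards [eventually_eq_pow (𝕜 := ℚ_[p]) hk, eventually_norm_eq_one] with u hu hu1
  obtain ⟨v, -, rfl⟩ := hu
  refine ⟨v, ?_, fun y => by rw [prod_pow_scaleCoord]; ring⟩
  rw [norm_pow] at hu1
  exact (pow_eq_one_iff_of_nonneg (norm_nonneg v) hk).1 hu1

theorem eventually_exists_scale_inv {e : Fin n → ℕ} {k : Fin n} (hk : e k ≠ 0) (w₀ : ℚ_[p]) :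
    ∀ᶠ u in 𝓝 (1 : ℚ_[p]), ∃ v : ℚ_[p], ‖v‖ = 1 ∧ ∀ y : Fin n → ℚ_[p],
      (w₀ * ∏ l, scaleCoord k v y l ^ e l)⁻¹ = u * (w₀ * ∏ l, y l ^ e l)⁻¹ := by
  have ht : Tendsto (fun u : ℚ_[p] => u⁻¹) (𝓝 1) (𝓝 1) := by
    simpa using (continuousAt_inv₀ (one_ne_zero (α := ℚ_[p]))).tendsto
  filter_upwards [ht.eventually (eventually_exists_scale hk w₀)] with u ⟨v, hv, h⟩
  exact ⟨v, hv, fun y => by rw [h, mul_inv, inv_inv]⟩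

variable [MeasureSpace ℚ_[p]] [BorelSpace ℚ_[p]] [(volume : Measure ℚ_[p]).IsAddHaarMeasure]

theorem measurableSet_polyShell (r : ℝ) (s : Finset (Fin n)) :
    MeasurableSet (polyShell p r s) := by
  have h1 : MeasurableSet {y : Fin n → ℚ_[p] | ‖y‖ ≤ r} :=
    measurableSet_le continuous_norm.measurable measurable_const
  have h2 : {y : Fin n → ℚ_[p] | ∀ l ∈ s, r / p < ‖y l‖} = ⋂ l ∈ s, {y | r / p < ‖y l‖} := by
    ext y
    simp
  have h3 : MeasurableSet {y : Fin n → ℚ_[p] | ∀ l ∈ s, r / p < ‖y l‖} := by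
    rw [h2]
    exact s.measurableSet_biInter fun l _ => measurableSet_lt (by fun_prop) (by fun_prop)
  exact h1.inter h3

theorem integrable_indicator_normMonomial {S : Set (Fin n → ℚ_[p])} (hS : MeasurableSet S) {r : ℝ}
    (hr : ∀ y ∈ S, ‖y‖ ≤ r) (δ : Fin n → ℕ) :
    Integrable (S.indicator (normMonomial δ)) := by
  rw [integrable_indicator_iff hS]
  refine IntegrableOn.mono_set (t := Metric.closedBall 0 r) ?_ fun y hy =>
    mem_closedBall_zero_iff.2 (hr y hy)
  exact (continuous_normMonomial δ).continuousOn.integrableOn_compact (isCompact_closedBall _ _)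

theorem indicator_normMonomial_scaleCoord {S : Set (Fin n → ℚ_[p])}
    (hS : ∀ x y : Fin n → ℚ_[p], (∀ l, ‖x l‖ = ‖y l‖) → x ∈ S → y ∈ S) (δ : Fin n → ℕ)
    (k : Fin n) {v : ℚ_[p]} (hv : ‖v‖ = 1) (y : Fin n → ℚ_[p]) :
    S.indicator (normMonomial δ) (scaleCoord k v y) = S.indicator (normMonomial δ) y := by
  have h := norm_scaleCoord_apply (k := k) hv y
  by_cases hy : y ∈ S
  · rw [Set.indicator_of_mem hy, Set.indicator_of_mem (hS _ _ (fun l => (h l).symm) hy),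
      normMonomial_congr h]
  · rw [Set.indicator_of_notMem hy, Set.indicator_of_notMem fun h' => hy (hS _ _ h h')]

theorem polyShell_congr {r : ℝ} {s : Finset (Fin n)} (x y : Fin n → ℚ_[p])
    (h : ∀ l, ‖x l‖ = ‖y l‖) (hx : x ∈ polyShell p r s) : y ∈ polyShell p r s := by
  refine ⟨?_, fun l hl => ?_⟩
  · rw [← norm_congr_coord h]; exact hx.1
  · rw [← h l]; exact hx.2 l hl

theorem polyShell_scaleCoord {r : ℝ} (hr : 0 ≤ r) {s : Finset (Fin n)} {k : Fin n} (hk : k ∉ s)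
    (y : Fin n → ℚ_[p]) :
    scaleCoord k (p : ℚ_[p]) y ∈ polyShell p r s \ polyShell p r (insert k s) ↔
      y ∈ polyShell p r s := by
  have hp1 : (1 : ℝ) < p := by exact_mod_cast (Fact.out : p.Prime).one_lt
  have hl : ∀ l, l ≠ k → scaleCoord k (p : ℚ_[p]) y l = y l := fun l h => scaleCoord_of_ne h _ _
  have hk' : ‖scaleCoord k (p : ℚ_[p]) y k‖ = ‖y k‖ / p := by
    rw [scaleCoord_same, norm_mul, Padic.norm_p]; ring
  have hs : (∀ l ∈ s, r / p < ‖scaleCoord k (p : ℚ_[p]) y l‖) ↔ ∀ l ∈ s, r / p < ‖y l‖ :=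
    forall₂_congr fun l h => by rw [hl l (fun e => hk (e ▸ h))]
  simp only [polyShell, Set.mem_sdiff, Set.mem_ofPred_eq, Finset.forall_mem_insert, hs,
    pi_norm_le_iff_of_nonneg hr]
  constructor
  · rintro ⟨⟨h1, h2⟩, h3⟩
    refine ⟨fun l => ?_, h2⟩
    by_cases h : l = k
    · subst h
      by_contra h'
      push Not at h'
      exact h3 ⟨h1, by rw [hk']; gcongr, h2⟩
    · rw [← hl l h]; exact h1 l
  · rintro ⟨h1, h2⟩
    refine ⟨⟨fun l => ?_, h2⟩, fun h3 => ?_⟩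
    · by_cases h : l = k
      · subst h
        rw [hk']
        exact (div_le_self (norm_nonneg _) hp1.le).trans (h1 l)
      · rw [hl l h]; exact h1 l
    · have := h3.2.1
      rw [hk', div_lt_div_iff_of_pos_right (by linarith)] at this
      exact absurd (h1 k) (not_le.2 this)

variable {Ψ : ℚ_[p] → ℂ}

/-- The oscillatory integral of a monomial phase over a shell. -/
noncomputable def shellIntegral (Ψ : ℚ_[p] → ℂ) (w₀ : ℚ_[p]) (e δ : Fin n → ℕ) (r : ℝ)
    (s : Finset (Fin n)) (z : ℚ_[p]) : ℂ :=
  ∫ y, (polyShell p r s).indicator (normMonomial δ) y * Ψ (z * (w₀ * ∏ l, y l ^ e l))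

theorem IsStandardChar.integrable_mul (hΨ : IsStandardChar Ψ) {W : (Fin n → ℚ_[p]) → ℂ}
    (hW : Integrable W) {t : (Fin n → ℚ_[p]) → ℚ_[p]} (ht : Measurable t) :
    Integrable fun y => W y * Ψ (t y) := by
  refine hW.mono (hW.aestronglyMeasurable.mul
    (hΨ.cont.measurable.comp ht).aestronglyMeasurable) (Eventually.of_forall fun y => ?_)
  simp [hΨ.norm_eq]

theorem measurable_monomial (w₀ : ℚ_[p]) (e : Fin n → ℕ) :
    Measurable fun y : Fin n → ℚ_[p] => w₀ * ∏ l, y l ^ e l := by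
  fun_prop

theorem shellIntegral_recurrence (hΨ : IsStandardChar Ψ) (w₀ : ℚ_[p]) (e δ : Fin n → ℕ) {r : ℝ}
    (hr : 0 ≤ r) {s : Finset (Fin n)} {k : Fin n} (hk : k ∉ s) (z : ℚ_[p]) :
    shellIntegral Ψ w₀ e δ r s z = shellIntegral Ψ w₀ e δ r (insert k s) z +
      ((p : ℂ)⁻¹) ^ (δ k + 1) * shellIntegral Ψ w₀ e δ r s (z * (p : ℚ_[p]) ^ e k) := by
  have hp0 : (p : ℚ_[p]) ≠ 0 := by exact_mod_cast (Fact.out : p.Prime).ne_zero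
  set S := polyShell p r s with hS
  set S' := polyShell p r (insert k s) with hS'
  have hSm : MeasurableSet S := measurableSet_polyShell r s
  have hSm' : MeasurableSet S' := measurableSet_polyShell r _
  have hsub : S' ⊆ S := fun y hy => ⟨hy.1, fun l hl => hy.2 l (Finset.mem_insert_of_mem hl)⟩
  have hdec : ∀ y, S.indicator (normMonomial δ) y =
      S'.indicator (normMonomial δ) y + (S \ S').indicator (normMonomial δ) y := by
    intro y
    by_cases h1 : y ∈ S' <;> by_cases h2 : y ∈ S
    · simp [h1, h2]
    · exact absurd (hsub h1) h2
    · simp [h1, h2]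
    · simp [h1, h2]
  have hm : Measurable fun y : Fin n → ℚ_[p] => z * (w₀ * ∏ l, y l ^ e l) :=
    (measurable_monomial w₀ e).const_mul z
  have hi1 := hΨ.integrable_mul
    (integrable_indicator_normMonomial hSm' (r := r) (fun y hy => hy.1) δ) hm
  have hi2 := hΨ.integrable_mul
    (integrable_indicator_normMonomial (hSm.diff hSm') (r := r) (fun y hy => hy.1.1) δ) hm
  have h1 : shellIntegral Ψ w₀ e δ r s z = shellIntegral Ψ w₀ e δ r (insert k s) z +
      ∫ y, (S \ S').indicator (normMonomial δ) y * Ψ (z * (w₀ * ∏ l, y l ^ e l)) := by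
    rw [shellIntegral, shellIntegral, ← integral_add hi1 hi2]
    simp only [← hS, hdec, add_mul]
  rw [h1, integral_scaleCoord k hp0, Padic.norm_p]
  congr 1
  rw [shellIntegral, ← integral_const_mul, ← integral_const_mul]
  refine integral_congr_ae (Eventually.of_forall fun y => ?_)
  simp only
  rw [prod_pow_scaleCoord]
  by_cases hy : y ∈ S
  · rw [Set.indicator_of_mem hy, Set.indicator_of_mem ((polyShell_scaleCoord hr hk y).2 hy),
      normMonomial_scaleCoord, Padic.norm_p, show z * (w₀ * ((p : ℚ_[p]) ^ e k * ∏ l, y l ^ e l)) =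
        z * (p : ℚ_[p]) ^ e k * (w₀ * ∏ l, y l ^ e l) by ring, pow_succ]
    push_cast
    ring
  · rw [Set.indicator_of_notMem hy,
      Set.indicator_of_notMem (mt (polyShell_scaleCoord hr hk y).1 hy)]
    simp

end Monomial

end

section

open Filter Topology MeasureTheory Polynomial
open scoped ENNReal NNReal

set_option linter.unusedSectionVars false

section MonomialTame

variable {p : ℕ} [Fact p.Prime] {n : ℕ}

theorem fnShift_pow_apply (N : ℕ) (G : ℚ_[p] → ℂ) (z : ℚ_[p]) :
    ((fnShift p) ^ N) G z = G (z * ((p : ℚ_[p]) ^ N)⁻¹) := by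
  induction N generalizing z with
  | zero => simp
  | succ N ih =>
    rw [pow_succ', Module.End.mul_apply]
    change ((fnShift p) ^ N) G (z * (p : ℚ_[p])⁻¹) = _
    rw [ih, pow_succ, mul_inv]
    congr 1
    ring

/-- A recurrence with a tame inhomogeneous term transports annihilating polynomials. -/
theorem exists_annihilator_of_recurrence {G G' : ℚ_[p] → ℂ} {N : ℕ} (hN : N ≠ 0) {c : ℂ}
    (hc0 : c ≠ 0) (hc : ‖c‖ < 1) (h : ∀ z, G z = G' z + c * G (z * (p : ℚ_[p]) ^ N))
    (hG' : ∃ P : ℂ[X], P ≠ 0 ∧ (∀ ρ, P.IsRoot ρ → ρ ≠ 0 ∧ ‖ρ‖ < 1) ∧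
      ∃ R : ℝ, ∀ z, R < ‖z‖ → aeval (fnShift p) P G' z = 0) :
    ∃ P : ℂ[X], P ≠ 0 ∧ (∀ ρ, P.IsRoot ρ → ρ ≠ 0 ∧ ‖ρ‖ < 1) ∧
      ∃ R : ℝ, ∀ z, R < ‖z‖ → aeval (fnShift p) P G z = 0 := by
  obtain ⟨P, hP, hr, R, hR⟩ := hG'
  refine ⟨P * (X ^ N - C c), mul_ne_zero hP (X_pow_sub_C_ne_zero (Nat.pos_of_ne_zero hN) c), ?_,
    R, fun z hz => ?_⟩
  · intro ρ hρ
    rw [IsRoot.def, eval_mul, mul_eq_zero] at hρ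
    rcases hρ with hρ | hρ
    · exact hr ρ hρ
    · simp only [eval_sub, eval_pow, eval_X, eval_C, sub_eq_zero] at hρ
      refine ⟨fun h0 => hc0 (by rw [← hρ, h0, zero_pow hN]), ?_⟩
      rw [← hρ, norm_pow] at hc
      exact (pow_lt_one_iff_of_nonneg (norm_nonneg _) hN).1 hc
  · have hp0 : (p : ℚ_[p]) ≠ 0 := by exact_mod_cast (Fact.out : p.Prime).ne_zero
    have h1 : aeval (fnShift p) (X ^ N - C c : ℂ[X]) G = aeval (fnShift p) (X ^ N : ℂ[X]) G' := by
      funext z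
      simp only [map_sub, aeval_X_pow, aeval_C, LinearMap.sub_apply, Pi.sub_apply,
        Module.algebraMap_end_apply, Pi.smul_apply, smul_eq_mul, fnShift_pow_apply]
      rw [h (z * ((p : ℚ_[p]) ^ N)⁻¹), inv_mul_cancel_right₀ (pow_ne_zero _ hp0)]
      ring
    rw [map_mul, Module.End.mul_apply, h1, ← Module.End.mul_apply, ← map_mul, mul_comm, map_mul,
      Module.End.mul_apply]
    exact aeval_fnShift_eq_zero hR _ hz

variable [MeasureSpace ℚ_[p]] [BorelSpace ℚ_[p]] [(volume : Measure ℚ_[p]).IsAddHaarMeasure]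
  {Ψ : ℚ_[p] → ℂ} {w₀ : ℚ_[p]} {e δ : Fin n → ℕ} {k : Fin n} {r : ℝ}

theorem shellIntegral_eventually_eq_zero (hΨ : IsStandardChar Ψ) (hw₀ : w₀ ≠ 0) (hk : e k ≠ 0)
    (hr : 0 < r) (δ : Fin n → ℕ) {s : Finset (Fin n)} (hs : ∀ l, e l ≠ 0 → l ∈ s) :
    ∃ R : ℝ, ∀ z, R < ‖z‖ → shellIntegral Ψ w₀ e δ r s z = 0 := by
  have hp0 : (0 : ℝ) < p := by exact_mod_cast (Fact.out : p.Prime).pos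
  refine integral_eq_zero_of_large hΨ
    (integrable_indicator_normMonomial (measurableSet_polyShell r s) (r := r) (fun y hy => hy.1) δ)
    (fun v hv y => indicator_normMonomial_scaleCoord polyShell_congr δ k hv y)
    (measurable_monomial w₀ e) (eventually_exists_scale hk w₀)
    (a := ‖w₀‖ * ∏ l, (r / p) ^ e l) (by have := norm_pos_iff.2 hw₀; positivity) fun y hy => ?_
  have hy' : y ∈ polyShell p r s := by
    by_contra h
    exact hy (Set.indicator_of_notMem h _)
  rw [norm_mul, norm_prod]
  gcongr with l
  rw [norm_pow]
  by_cases hl : e l = 0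
  · simp [hl]
  · gcongr
    exact (hy'.2 l (hs l hl)).le

theorem isTame_shellIntegral (hΨ : IsStandardChar Ψ) (hw₀ : w₀ ≠ 0) (hk : e k ≠ 0)
    (hr : 0 < r) (δ : Fin n → ℕ) : IsTame (shellIntegral Ψ w₀ e δ r ∅) := by
  classical
  refine ⟨⟨0, ?_⟩, ?_⟩
  · filter_upwards [eventually_exists_scale hk w₀] with u hu z _
    exact integral_mul_unit
      (fun v hv y => indicator_normMonomial_scaleCoord polyShell_congr δ k hv y) hu z
  · have key : ∀ t s : Finset (Fin n), (∀ l ∈ t, e l ≠ 0) → (∀ l, e l ≠ 0 → l ∈ s ∪ t) →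
        Disjoint s t → ∃ P : ℂ[X], P ≠ 0 ∧ (∀ ρ, P.IsRoot ρ → ρ ≠ 0 ∧ ‖ρ‖ < 1) ∧
        ∃ R : ℝ, ∀ z, R < ‖z‖ → aeval (fnShift p) P (shellIntegral Ψ w₀ e δ r s) z = 0 := by
      intro t
      induction t using Finset.induction_on with
      | empty =>
        intro s _ hs _
        obtain ⟨R, hR⟩ := shellIntegral_eventually_eq_zero hΨ hw₀ hk hr δ
          (s := s) (by simpa using hs)
        exact ⟨1, one_ne_zero, by simp, R, fun z hz => by simpa using hR z hz⟩
      | insert a t ha ih =>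
        intro s ht hs hd
        rw [Finset.disjoint_insert_right] at hd
        have hp1 : (1 : ℝ) < p := by exact_mod_cast (Fact.out : p.Prime).one_lt
        refine exists_annihilator_of_recurrence (ht a (Finset.mem_insert_self _ _)) ?_ ?_
          (shellIntegral_recurrence hΨ w₀ e δ hr.le hd.1)
          (ih (insert a s) (fun l hl => ht l (Finset.mem_insert_of_mem hl)) ?_ ?_)
        · have : (p : ℂ) ≠ 0 := by exact_mod_cast (Fact.out : p.Prime).ne_zero
          positivity
        · rw [norm_pow, norm_inv, Complex.norm_natCast]
          exact pow_lt_one₀ (by positivity) (inv_lt_one_of_one_lt₀ hp1) (by omega)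
        · intro l hl
          have := hs l hl
          simp only [Finset.mem_union, Finset.mem_insert] at this ⊢
          tauto
        · rw [Finset.disjoint_insert_left]
          exact ⟨ha, hd.2⟩
    exact key (Finset.univ.filter fun l => e l ≠ 0) ∅ (by simp) (by simp) (by simp)

theorem measurableSet_norm_le_and {t : (Fin n → ℚ_[p]) → ℚ_[p]} (ht : Measurable t) {s : Set ℝ}
    (hs : MeasurableSet s) : MeasurableSet {y : Fin n → ℚ_[p] | ‖y‖ ≤ r ∧ ‖t y‖ ∈ s} :=
  (measurableSet_le continuous_norm.measurable measurable_const).inter (ht.norm hs)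

theorem norm_monomial_congr {x y : Fin n → ℚ_[p]} (h : ∀ l, ‖x l‖ = ‖y l‖) :
    ‖w₀ * ∏ l, x l ^ e l‖ = ‖w₀ * ∏ l, y l ^ e l‖ := by
  simp only [norm_mul, norm_prod, norm_pow, h]

theorem mem_norm_le_and_congr {s : Set ℝ} (x y : Fin n → ℚ_[p]) (h : ∀ l, ‖x l‖ = ‖y l‖)
    (hx : x ∈ {y : Fin n → ℚ_[p] | ‖y‖ ≤ r ∧ ‖w₀ * ∏ l, y l ^ e l‖ ∈ s}) :
    y ∈ {y : Fin n → ℚ_[p] | ‖y‖ ≤ r ∧ ‖w₀ * ∏ l, y l ^ e l‖ ∈ s} :=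
  ⟨norm_congr_coord h ▸ hx.1, by
    have := hx.2
    rwa [norm_monomial_congr (w₀ := w₀) (e := e) h] at this⟩

theorem isTame_monomialIntegral (hΨ : IsStandardChar Ψ) (hw₀ : w₀ ≠ 0) (hk : e k ≠ 0)
    (hr : 0 < r) {b : ℝ} (hb : 0 < b) (δ : Fin n → ℕ) :
    IsTame fun z => ∫ y, {y : Fin n → ℚ_[p] | ‖y‖ ≤ r ∧ ‖w₀ * ∏ l, y l ^ e l‖ ∈ Set.Iic b}.indicator
      (normMonomial δ) y * Ψ (z * (w₀ * ∏ l, y l ^ e l)) := by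
  have hm := measurable_monomial (n := n) w₀ e
  have hi : ∀ s : Set ℝ, MeasurableSet s → Integrable ({y : Fin n → ℚ_[p] | ‖y‖ ≤ r ∧
      ‖w₀ * ∏ l, y l ^ e l‖ ∈ s}.indicator (normMonomial δ)) := fun s hs =>
    integrable_indicator_normMonomial (measurableSet_norm_le_and hm hs) (r := r)
      (fun y hy => hy.1) δ
  obtain ⟨R, hR⟩ := integral_eq_zero_of_large hΨ (hi (Set.Ioi b) measurableSet_Ioi)
    (fun v hv y => indicator_normMonomial_scaleCoord mem_norm_le_and_congr δ k hv y) hm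
    (eventually_exists_scale hk w₀) hb fun y hy => by
      by_contra h
      exact hy (Set.indicator_of_notMem (fun h' => h (le_of_lt h'.2)) _)
  refine (isTame_shellIntegral hΨ hw₀ hk hr δ).congr (R := R) fun z hz => ?_
  have hdec : ∀ y : Fin n → ℚ_[p], (polyShell p r ∅).indicator (normMonomial δ) y =
      {y : Fin n → ℚ_[p] | ‖y‖ ≤ r ∧ ‖w₀ * ∏ l, y l ^ e l‖ ∈ Set.Iic b}.indicator
        (normMonomial δ) y +
      {y : Fin n → ℚ_[p] | ‖y‖ ≤ r ∧ ‖w₀ * ∏ l, y l ^ e l‖ ∈ Set.Ioi b}.indicator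
        (normMonomial δ) y := by
    intro y
    by_cases h1 : ‖y‖ ≤ r <;> by_cases h2 : ‖w₀ * ∏ l, y l ^ e l‖ ≤ b
    · simp [polyShell, Set.indicator, h1, h2, not_lt.2 h2, -norm_mul]
    · simp [polyShell, Set.indicator, h1, h2, not_le.1 h2, -norm_mul]
    · simp [polyShell, Set.indicator, h1]
    · simp [polyShell, Set.indicator, h1]
  rw [shellIntegral]
  simp only [hdec, add_mul]
  rw [integral_add (hΨ.integrable_mul (hi _ measurableSet_Iic) (hm.const_mul z))
    (hΨ.integrable_mul (hi _ measurableSet_Ioi) (hm.const_mul z)), hR z hz, add_zero]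

theorem monomialInvIntegral_eventually_eq_zero (hΨ : IsStandardChar Ψ) (hk : e k ≠ 0) {a : ℝ}
    (ha : 0 < a) (δ : Fin n → ℕ) (w₀ : ℚ_[p]) (r : ℝ) :
    ∃ R : ℝ, ∀ z, R < ‖z‖ → ∫ y, {y : Fin n → ℚ_[p] | ‖y‖ ≤ r ∧
      ‖w₀ * ∏ l, y l ^ e l‖ ∈ Inv.inv ⁻¹' Set.Ici a}.indicator
        (normMonomial δ) y * Ψ (z * (w₀ * ∏ l, y l ^ e l)⁻¹) = 0 := by
  have hm := measurable_monomial (n := n) w₀ e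
  refine integral_eq_zero_of_large hΨ (integrable_indicator_normMonomial
    (measurableSet_norm_le_and hm (measurable_inv measurableSet_Ici)) (r := r)
      (fun y hy => hy.1) δ)
    (fun v hv y => indicator_normMonomial_scaleCoord mem_norm_le_and_congr δ k hv y) hm.inv
    (eventually_exists_scale_inv hk w₀) ha fun y hy => ?_
  by_contra h
  refine hy (Set.indicator_of_notMem (fun h' => h ?_) _)
  simpa using h'.2

end MonomialTame

end

section

open Filter Topology MeasureTheory
open scoped ENNReal NNReal

set_option linter.unusedSectionVars false

section DisjointBalls

open Metric

theorem exists_disjoint_closedBalls_union {X : Type*} [PseudoMetricSpace X] [IsUltrametricDist X]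
    (ρ : X → ℝ) (t : Finset X) : ∃ s ⊆ t,
      (s : Set X).PairwiseDisjoint (fun a => closedBall a (ρ a)) ∧
      ⋃ a ∈ t, closedBall a (ρ a) ⊆ ⋃ a ∈ s, closedBall a (ρ a) := by
  classical
  induction t using Finset.induction_on with
  | empty => exact ⟨∅, subset_rfl, by simp, subset_rfl⟩
  | insert a t _ ih =>
    obtain ⟨s, hst, hd, hu⟩ := ih
    rw [Finset.set_biUnion_insert]
    by_cases h : ∃ b ∈ s, closedBall a (ρ a) ⊆ closedBall b (ρ b)
    · obtain ⟨b, hb, hab⟩ := h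
      exact ⟨s, hst.trans (Finset.subset_insert _ _), hd, Set.union_subset
        (hab.trans (Set.subset_biUnion_of_mem (u := fun a => closedBall a (ρ a)) hb)) hu⟩
    · push Not at h
      set s' := s.filter fun b => ¬ closedBall b (ρ b) ⊆ closedBall a (ρ a) with hs'
      have hs's : s' ⊆ s := Finset.filter_subset _ _
      refine ⟨insert a s', Finset.insert_subset_insert _ (hs's.trans hst), ?_, ?_⟩
      · rw [Finset.coe_insert, Set.pairwiseDisjoint_insert]
        refine ⟨hd.subset (by exact_mod_cast hs's), fun b hb _ => ?_⟩
        have hb' := Finset.mem_filter.1 (Finset.mem_coe.1 hb)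
        exact ((IsUltrametricDist.closedBall_subset_trichotomy a b (ρ a) (ρ b)).resolve_left (h b hb'.1)).resolve_left
          hb'.2
      · rw [Finset.set_biUnion_insert]
        refine Set.union_subset Set.subset_union_left (hu.trans (Set.iUnion₂_subset fun b hb => ?_))
        by_cases hba : closedBall b (ρ b) ⊆ closedBall a (ρ a)
        · exact hba.trans Set.subset_union_left
        · exact (Set.subset_biUnion_of_mem (u := fun a => closedBall a (ρ a))
            (Finset.mem_coe.2 (Finset.mem_filter.2 ⟨hb, hba⟩))).trans Set.subset_union_right

theorem exists_disjoint_closedBalls {X : Type*} [PseudoMetricSpace X] [IsUltrametricDist X]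
    {K : Set X} (hK : IsCompact K) {ρ : X → ℝ} (hρ : ∀ a ∈ K, 0 < ρ a)
    (hρK : ∀ a ∈ K, closedBall a (ρ a) ⊆ K) : ∃ s : Finset X, (∀ a ∈ s, a ∈ K) ∧
      (s : Set X).PairwiseDisjoint (fun a => closedBall a (ρ a)) ∧
      K = ⋃ a ∈ s, closedBall a (ρ a) := by
  obtain ⟨t, ht, hKt⟩ := hK.elim_nhds_subcover (fun a => closedBall a (ρ a))
    fun a ha => closedBall_mem_nhds a (hρ a ha)
  obtain ⟨s, hst, hd, hu⟩ := exists_disjoint_closedBalls_union ρ t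
  exact ⟨s, fun a ha => ht a (hst ha), hd, (hKt.trans hu).antisymm
    (Set.iUnion₂_subset fun a ha => hρK a (ht a (hst ha)))⟩

end DisjointBalls

section ChartIntegral

variable {p : ℕ} [Fact p.Prime] {n : ℕ}

variable [MeasureSpace ℚ_[p]] [BorelSpace ℚ_[p]] [(volume : Measure ℚ_[p]).IsAddHaarMeasure]
  {P : ((Fin n → ℚ_[p]) → Fin n → ℚ_[p]) → ((Fin n → ℚ_[p]) → ℚ_[p]) → (Fin n → ℚ_[p]) → Prop}

theorem integral_leaf {B : Set (Fin n → ℚ_[p])} {φ : (Fin n → ℚ_[p]) → Fin n → ℚ_[p]}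
    {j : (Fin n → ℚ_[p]) → ℚ_[p]} (hφ : Continuous φ) (hj : Continuous j)
    {F : (Fin n → ℚ_[p]) → ℂ} (hF : Measurable F) :
    ∫ x, F x ∂(((volume.restrict B).withDensity fun y => ‖j y‖ₑ).map φ) =
      ∫ y in B, (‖j y‖ : ℂ) * F (φ y) := by
  rw [integral_map hφ.aemeasurable hF.aestronglyMeasurable]
  have := integral_withDensity_eq_integral_smul (μ := volume.restrict B)
    (f := fun y => ‖j y‖₊) (by fun_prop) (fun y => F (φ y))
  refine this.trans (integral_congr_ae (Eventually.of_forall fun y => ?_))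
  simp only [NNReal.smul_def, Complex.real_smul, coe_nnnorm]

/-- A property of families of integrals which is stable under linear combinations follows for
charted measures from the corresponding local statement in the charts. -/
theorem ChartRep.eventually_mem {T : Submodule ℂ (ℚ_[p] → ℂ)} {l : Filter ℝ}
    {K : ℝ → ℚ_[p] → (Fin n → ℚ_[p]) → ℂ} (hKm : ∀ b z, Measurable (K b z))
    (hKb : ∀ b z x, ‖K b z x‖ ≤ 1) {ν : Measure (Fin n → ℚ_[p])} (hν : ChartRep P ν)
    (hP : ∀ φ j y, Continuous φ → Continuous j → P φ j y → ∃ r₀ : ℝ, 0 < r₀ ∧ ∀ r, 0 < r → r ≤ r₀ →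
      ∀ᶠ b in l, (fun z => ∫ x in Metric.closedBall y r, (‖j x‖ : ℂ) * K b z (φ x)) ∈ T) :
    IsFiniteMeasure ν ∧ ∀ᶠ b in l, (fun z => ∫ x, K b z x ∂ν) ∈ T := by
  induction hν with
  | zero =>
    refine ⟨inferInstance, Eventually.of_forall fun b => ?_⟩
    simp only [integral_zero_measure]
    exact T.zero_mem
  | add _ _ h1 h2 =>
    obtain ⟨f1, h1⟩ := h1
    obtain ⟨f2, h2⟩ := h2
    refine ⟨inferInstance, ?_⟩
    filter_upwards [h1, h2] with b hb1 hb2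
    have hi : ∀ (ν : Measure (Fin n → ℚ_[p])) [IsFiniteMeasure ν] z, Integrable (K b z) ν :=
      fun ν _ z => Integrable.of_bound (hKm b z).aestronglyMeasurable 1
        (Eventually.of_forall (hKb b z))
    simp only [integral_add_measure (hi _ _) (hi _ _)]
    exact T.add_mem hb1 hb2
  | smul c hc _ h =>
    obtain ⟨f, h⟩ := h
    refine ⟨Measure.smul_finite _ hc, ?_⟩
    filter_upwards [h] with b hb
    simp only [integral_smul_measure, Complex.real_smul]
    exact T.smul_mem (c.toReal : ℂ) hb
  | leaf B φ j hB hBo hφ hj h =>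
    have hfin : IsFiniteMeasure ((volume.restrict B).withDensity fun y => ‖j y‖ₑ) := by
      refine isFiniteMeasure_withDensity ?_
      exact (hj.continuousOn.integrableOn_compact hB).2.ne
    refine ⟨inferInstance, ?_⟩
    simp only [integral_leaf hφ hj (hKm _ _)]
    have hloc : ∀ y, ∃ ρ : ℝ, y ∈ B → 0 < ρ ∧ Metric.closedBall y ρ ⊆ B ∧
        ∀ᶠ b in l, (fun z => ∫ x in Metric.closedBall y ρ, (‖j x‖ : ℂ) * K b z (φ x)) ∈ T := by
      intro y
      by_cases hy : y ∈ B
      · obtain ⟨r₀, hr₀, hr⟩ := hP φ j y hφ hj (h y hy)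
        obtain ⟨r₁, hr₁, hb⟩ := Metric.nhds_basis_closedBall.mem_iff.1 (hBo.mem_nhds hy)
        exact ⟨min r₀ r₁, fun _ => ⟨lt_min hr₀ hr₁,
          (Metric.closedBall_subset_closedBall (min_le_right _ _)).trans hb,
          hr _ (lt_min hr₀ hr₁) (min_le_left _ _)⟩⟩
      · exact ⟨0, fun h => absurd h hy⟩
    choose ρ hρ using hloc
    obtain ⟨s, hsB, hd, hu⟩ := exists_disjoint_closedBalls hB (fun a ha => (hρ a ha).1)
      (fun a ha => (hρ a ha).2.1)
    have hev : ∀ᶠ b in l, ∀ y ∈ s,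
        (fun z => ∫ x in Metric.closedBall y (ρ y), (‖j x‖ : ℂ) * K b z (φ x)) ∈ T :=
      (Finset.eventually_all s).2 fun y hy => (hρ y (hsB y hy)).2.2
    filter_upwards [hev] with b hb
    have hintg : ∀ z, ∀ y ∈ s, IntegrableOn (fun x => (‖j x‖ : ℂ) * K b z (φ x))
        (Metric.closedBall y (ρ y)) := by
      intro z y _
      have h1 : IntegrableOn (fun x => (‖j x‖ : ℂ)) (Metric.closedBall y (ρ y)) :=
        (by fun_prop : Continuous fun x => (‖j x‖ : ℂ)).continuousOn.integrableOn_compact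
          (isCompact_closedBall _ _)
      refine Integrable.mono h1 ?_ (Eventually.of_forall fun x => ?_)
      · exact h1.aestronglyMeasurable.mul
          ((hKm b z).comp hφ.measurable).aestronglyMeasurable
      · rw [norm_mul]
        exact mul_le_of_le_one_right (norm_nonneg _) (hKb b z _)
    have heq : (fun z => ∫ x in B, (‖j x‖ : ℂ) * K b z (φ x)) =
        ∑ y ∈ s, fun z => ∫ x in Metric.closedBall y (ρ y), (‖j x‖ : ℂ) * K b z (φ x) := by
      funext z
      rw [Finset.sum_apply, ← integral_biUnion_finset s
        (fun i _ => Metric.isClosed_closedBall.measurableSet) hd (hintg z), ← hu]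
    rw [heq]
    exact T.sum_mem hb

/-- The tame functions form a subspace. -/
def tameSubmodule (p : ℕ) [Fact p.Prime] : Submodule ℂ (ℚ_[p] → ℂ) where
  carrier := {G | IsTame G}
  add_mem' h h' := IsTame.add h h'
  zero_mem' := isTame_zero
  smul_mem' c _ h := IsTame.smul h c

/-- The functions vanishing for large arguments form a subspace. -/
def eventuallyZeroSubmodule (p : ℕ) [Fact p.Prime] : Submodule ℂ (ℚ_[p] → ℂ) where
  carrier := {G | ∃ R : ℝ, ∀ z, R < ‖z‖ → G z = 0}
  add_mem' := by
    rintro G G' ⟨R, h⟩ ⟨R', h'⟩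
    refine ⟨max R R', fun z hz => ?_⟩
    rw [max_lt_iff] at hz
    rw [Pi.add_apply, h z hz.1, h' z hz.2, add_zero]
  zero_mem' := ⟨0, fun _ _ => rfl⟩
  smul_mem' := by
    rintro c G ⟨R, h⟩
    exact ⟨R, fun z hz => by rw [Pi.smul_apply, h z hz, smul_zero]⟩

end ChartIntegral

end

section

open Filter Topology MeasureTheory
open scoped ENNReal NNReal

set_option linter.unusedSectionVars false

section LocalForm

variable {p : ℕ} [Fact p.Prime] {n : ℕ}

theorem eventually_norm_eq_of_tendsto {X : Type*} {l : Filter X} {U : X → ℚ_[p]} {a : ℚ_[p]}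
    (ha : a ≠ 0) (hU : Tendsto U l (𝓝 a)) : ∀ᶠ x in l, ‖U x‖ = ‖a‖ := by
  have h1 : Tendsto (fun x => U x / a) l (𝓝 1) := by
    simpa [div_self ha] using hU.div_const a
  filter_upwards [h1.eventually eventually_norm_eq_one] with x hx
  rwa [norm_div, div_eq_one_iff_eq (norm_ne_zero_iff.2 ha)] at hx

theorem IsMono.exists_translate {G : (Fin n → ℚ_[p]) → ℚ_[p]} {y : Fin n → ℚ_[p]}
    (h : IsMono G y) : ∃ (α : Fin n → ℕ) (U : (Fin n → ℚ_[p]) → ℚ_[p]), AnalyticAt ℚ_[p] U 0 ∧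
      U 0 ≠ 0 ∧ ∀ᶠ x in 𝓝 0, G (y + x) = U x * ∏ i, x i ^ α i ∧ ‖U x‖ = ‖U 0‖ := by
  obtain ⟨α, U, hU, hU0, hG⟩ := h
  have hy : AnalyticAt ℚ_[p] (fun x : Fin n → ℚ_[p] => y + x) 0 := by fun_prop
  have ht : Tendsto (fun x : Fin n → ℚ_[p] => y + x) (𝓝 0) (𝓝 y) := by
    simpa using hy.continuousAt.tendsto
  have hU' : AnalyticAt ℚ_[p] (fun x => U (y + x)) 0 :=
    AnalyticAt.comp_of_eq (f := fun x : Fin n → ℚ_[p] => y + x) hU hy (by simp)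
  have hU0' : U (y + 0) ≠ 0 := by simpa using hU0
  refine ⟨α, fun x => U (y + x), hU', hU0', ?_⟩
  filter_upwards [ht.eventually hG, eventually_norm_eq_of_tendsto hU0' hU'.continuousAt.tendsto]
    with x hx hx'
  exact ⟨by simpa using hx, hx'⟩

theorem IsMono.translate {G : (Fin n → ℚ_[p]) → ℚ_[p]} {y : Fin n → ℚ_[p]} (h : IsMono G y) :
    IsMono (fun x => G (y + x)) 0 := by
  obtain ⟨α, U, hU, hU0, hG⟩ := h.exists_translate
  exact ⟨α, U, hU, hU0, hG.mono fun x hx => by simpa using hx.1⟩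

/-- The functions whose monomialisation controls the quotient `N / g` on the set where neither `f`
nor `g` vanishes. -/
noncomputable def quotControl (f N g : (Fin n → ℚ_[p]) → ℚ_[p]) (x : Fin n → ℚ_[p]) : ℚ_[p] :=
  f x * (g x * (N x * (N x - g x)))

theorem IsResolved.exists_local_form {f N g : (Fin n → ℚ_[p]) → ℚ_[p]}
    (hf : ∀ x, AnalyticAt ℚ_[p] f x) (hN : ∀ x, AnalyticAt ℚ_[p] N x)
    (hg : ∀ x, AnalyticAt ℚ_[p] g x) {φ : (Fin n → ℚ_[p]) → Fin n → ℚ_[p]}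
    {j : (Fin n → ℚ_[p]) → ℚ_[p]} {y : Fin n → ℚ_[p]}
    (h : IsResolved (quotControl f N g) [] φ j y) :
    (∀ᶠ x in 𝓝 0, j (y + x) = 0) ∨
      ∃ (α β δ : Fin n → ℕ) (U V : (Fin n → ℚ_[p]) → ℚ_[p]) (C : ℝ), (α ≤ β ∨ β ≤ α) ∧
        AnalyticAt ℚ_[p] U 0 ∧ U 0 ≠ 0 ∧ AnalyticAt ℚ_[p] V 0 ∧ V 0 ≠ 0 ∧
        ∀ᶠ x in 𝓝 0, (‖j (y + x)‖ : ℂ) = C * normMonomial δ x ∧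
          N (φ (y + x)) = U x * ∏ i, x i ^ α i ∧ ‖U x‖ = ‖U 0‖ ∧
          g (φ (y + x)) = V x * ∏ i, x i ^ β i ∧ ‖V x‖ = ‖V 0‖ ∧
          ((∀ i, x i ≠ 0) → f (φ (y + x)) ≠ 0) := by
  obtain ⟨hφ, hj, h0 | ⟨hjm, hF, -⟩⟩ := h
  · left
    have ht : Tendsto (fun x : Fin n → ℚ_[p] => y + x) (𝓝 0) (𝓝 y) := by
      simpa using (continuous_const_add y).tendsto 0
    exact ht.eventually h0
  right
  have hf' := (hf (φ y)).comp hφ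
  have hg' := (hg (φ y)).comp hφ
  have hN' := (hN (φ y)).comp hφ
  have h3 := hN'.mul (hN'.sub hg')
  obtain ⟨mf, m2⟩ := IsMono.of_mul hf' (hg'.mul h3) hF
  obtain ⟨mg, m3⟩ := IsMono.of_mul hg' h3 m2
  obtain ⟨mN, md⟩ := IsMono.of_mul hN' (hN'.sub hg') m3
  obtain ⟨α, U, hU, hU0, eN⟩ := mN.exists_translate
  obtain ⟨β, V, hV, hV0, eg⟩ := mg.exists_translate
  obtain ⟨γ, X, hX, hX0, ef⟩ := mf.exists_translate
  obtain ⟨δ, W, hW, hW0, ej⟩ := hjm.exists_translate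
  refine ⟨α, β, δ, U, V, ‖W 0‖, ?_, hU, hU0, hV, hV0, ?_⟩
  · refine exponents_le_or_le hU hV hU0 hV0 (Or.inr (md.translate.congr ?_))
    filter_upwards [eN, eg] with x h1 h2
    have h1 := h1.1
    have h2 := h2.1
    simp only [Function.comp_apply] at h1 h2
    simp [h1, h2]
  · filter_upwards [eN, eg, ef, ej] with x h1 h2 h3 h4
    refine ⟨?_, h1.1, h1.2, h2.1, h2.2, fun hx => ?_⟩
    · rw [h4.1, norm_mul, h4.2, normMonomial]
      simp [norm_prod]
    · have h5 := h3.1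
      simp only [Function.comp_apply] at h5
      rw [h5]
      have hXx : X x ≠ 0 := norm_ne_zero_iff.1 (by rw [h3.2]; exact norm_ne_zero_iff.2 hX0)
      exact mul_ne_zero hXx (Finset.prod_ne_zero_iff.2 fun i _ => pow_ne_zero _ (hx i))

theorem prod_pow_eq_mul_of_le {α β : Fin n → ℕ} (h : α ≤ β) (x : Fin n → ℚ_[p]) :
    ∏ i, x i ^ β i = (∏ i, x i ^ (β - α) i) * ∏ i, x i ^ α i := by
  rw [← Finset.prod_mul_distrib]
  refine Finset.prod_congr rfl fun i _ => ?_
  rw [← pow_add, Pi.sub_apply, Nat.sub_add_cancel (h i)]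

theorem quotient_form {α β : Fin n → ℕ} (h : α ≤ β) {x : Fin n → ℚ_[p]} (hx : ∀ i, x i ≠ 0)
    {u v : ℚ_[p]} : (v * ∏ i, x i ^ β i) / (u * ∏ i, x i ^ α i) = v / u * ∏ i, x i ^ (β - α) i := by
  have h0 : ∏ i, x i ^ α i ≠ 0 := Finset.prod_ne_zero_iff.2 fun i _ => pow_ne_zero _ (hx i)
  rw [prod_pow_eq_mul_of_le h, ← mul_assoc, mul_div_mul_right _ _ h0]
  ring

theorem norm_prod_pow_le_one {x : Fin n → ℚ_[p]} (hx : ‖x‖ ≤ 1) (e : Fin n → ℕ) :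
    ‖∏ i, x i ^ e i‖ ≤ 1 := by
  rw [norm_prod]
  refine Finset.prod_le_one (fun i _ => norm_nonneg _) fun i _ => ?_
  rw [norm_pow]
  exact pow_le_one₀ (norm_nonneg _) ((norm_le_pi_norm x i).trans hx)

variable [MeasureSpace ℚ_[p]] [BorelSpace ℚ_[p]] [(volume : Measure ℚ_[p]).IsAddHaarMeasure]

theorem ae_coord_ne_zero : ∀ᵐ x : Fin n → ℚ_[p], ∀ i, x i ≠ 0 := by
  rw [ae_all_iff]
  intro i
  have := Measure.pi_hyperplane (fun _ : Fin n => (volume : Measure ℚ_[p])) i 0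
  rw [ae_iff, volume_pi]
  simpa using this

theorem setIntegral_closedBall_translate (y : Fin n → ℚ_[p]) (r : ℝ) (F : (Fin n → ℚ_[p]) → ℂ) :
    ∫ x in Metric.closedBall y r, F x = ∫ x in Metric.closedBall 0 r, F (y + x) := by
  rw [← integral_indicator Metric.isClosed_closedBall.measurableSet,
    ← integral_indicator Metric.isClosed_closedBall.measurableSet,
    ← integral_add_left_eq_self _ y]
  refine integral_congr_ae (Eventually.of_forall fun x => ?_)
  simp [Set.indicator]

theorem exists_integral_straighten {w : (Fin n → ℚ_[p]) → ℚ_[p]} (hw : AnalyticAt ℚ_[p] w 0)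
    (hw0 : w 0 ≠ 0) {e : Fin n → ℕ} {k : Fin n} (hk : e k ≠ 0) (δ : Fin n → ℕ) :
    ∃ r₀ : ℝ, 0 < r₀ ∧ ∀ r, 0 < r → r ≤ r₀ → ∀ (F : (Fin n → ℚ_[p]) → ℂ) (C : ℂ) (s : Set ℝ)
      (Θ : ℚ_[p] → ℂ), (∀ x, ‖x‖ ≤ r → (∀ i, x i ≠ 0) →
        F x = C * (normMonomial δ x * {t : ℚ_[p] | ‖t‖ ∈ s}.indicator Θ (w x * ∏ i, x i ^ e i))) →
      ∫ x in Metric.closedBall 0 r, F x = C * ∫ y, {y : Fin n → ℚ_[p] | ‖y‖ ≤ r ∧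
        ‖w 0 * ∏ i, y i ^ e i‖ ∈ s}.indicator (normMonomial δ) y * Θ (w 0 * ∏ i, y i ^ e i) := by
  obtain ⟨r₀, hr₀, h⟩ := exists_straighten hw hw0 hk
  refine ⟨r₀, hr₀, fun r hr hrr F C s Θ hF => ?_⟩
  obtain ⟨T, hT, hTw⟩ := h r hr hrr
  have hmp := IsometryEquiv.measurePreserving_of_isUltrametricDist
    (volume : Measure (Fin n → ℚ_[p])) T
  rw [← hmp.integral_comp T.toHomeomorph.measurableEmbedding, ← integral_const_mul,
    ← integral_indicator Metric.isClosed_closedBall.measurableSet]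
  refine integral_congr_ae ?_
  filter_upwards [ae_coord_ne_zero] with x hx
  have hTx : ‖T x‖ = ‖x‖ := norm_congr_coord (hT x)
  by_cases hxr : ‖x‖ ≤ r
  · rw [Set.indicator_of_mem (mem_closedBall_zero_iff.2 hxr), hF x hxr hx, hTw x hxr,
      ← normMonomial_congr (hT x)]
    by_cases hs : ‖w 0 * ∏ i, T x i ^ e i‖ ∈ s
    · rw [Set.indicator_of_mem (by exact hs), Set.indicator_of_mem (by exact ⟨hTx ▸ hxr, hs⟩)]
    · rw [Set.indicator_of_notMem (by exact hs), Set.indicator_of_notMem (fun h => hs h.2)]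
      ring
  · rw [Set.indicator_of_notMem (by simpa using hxr),
      Set.indicator_of_notMem (fun h => hxr (hTx ▸ h.1))]
    ring

end LocalForm

end

section

open Filter Topology MeasureTheory
open scoped ENNReal NNReal

set_option linter.unusedSectionVars false

section QuotKernel

variable {p : ℕ} [Fact p.Prime] {n : ℕ}

/-- The oscillating function of a quotient, restricted to where its norm lies in a given set. -/
noncomputable def quotKernel (Ψ : ℚ_[p] → ℂ) (f N g : (Fin n → ℚ_[p]) → ℚ_[p]) (s : Set ℝ)
    (z : ℚ_[p]) : (Fin n → ℚ_[p]) → ℂ :=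
  {x | f x ≠ 0 ∧ g x ≠ 0 ∧ ‖N x / g x‖ ∈ s}.indicator fun x => Ψ (z * (N x / g x))

variable {Ψ : ℚ_[p] → ℂ} {f N g : (Fin n → ℚ_[p]) → ℚ_[p]} {s : Set ℝ} {z : ℚ_[p]}
  {x : Fin n → ℚ_[p]}

theorem quotKernel_eq (hf : f x ≠ 0) (hg : g x ≠ 0) : quotKernel Ψ f N g s z x =
    {t : ℚ_[p] | ‖t‖ ∈ s}.indicator (fun t => Ψ (z * t)) (N x / g x) := by
  by_cases h : ‖N x / g x‖ ∈ s
  · rw [quotKernel, Set.indicator_of_mem (by exact ⟨hf, hg, h⟩), Set.indicator_of_mem (by exact h)]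
  · rw [quotKernel, Set.indicator_of_notMem (fun h' => h h'.2.2),
      Set.indicator_of_notMem (by exact h)]

theorem indicator_norm_mem_inv {Θ : ℚ_[p] → ℂ} {w : ℚ_[p]} :
    {t : ℚ_[p] | ‖t‖ ∈ s}.indicator Θ w⁻¹ =
      {t : ℚ_[p] | ‖t‖ ∈ Inv.inv ⁻¹' s}.indicator (fun t => Θ t⁻¹) w := by
  have h : w⁻¹ ∈ {t : ℚ_[p] | ‖t‖ ∈ s} ↔ w ∈ {t : ℚ_[p] | ‖t‖ ∈ Inv.inv ⁻¹' s} := by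
    simp
  by_cases hw : w ∈ {t : ℚ_[p] | ‖t‖ ∈ Inv.inv ⁻¹' s}
  · rw [Set.indicator_of_mem hw, Set.indicator_of_mem (h.2 hw)]
  · rw [Set.indicator_of_notMem hw, Set.indicator_of_notMem (mt h.1 hw)]

variable [MeasureSpace ℚ_[p]] [BorelSpace ℚ_[p]] [(volume : Measure ℚ_[p]).IsAddHaarMeasure]

theorem IsStandardChar.norm_quotKernel_le (hΨ : IsStandardChar Ψ) :
    ‖quotKernel Ψ f N g s z x‖ ≤ 1 := by
  rw [quotKernel, Set.indicator]
  split_ifs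
  · exact (hΨ.norm_eq _).le
  · simp

theorem IsStandardChar.measurable_quotKernel (hΨ : IsStandardChar Ψ) (hf : Measurable f)
    (hN : Measurable N) (hg : Measurable g) (hs : MeasurableSet s) (z : ℚ_[p]) :
    Measurable (quotKernel Ψ f N g s z) := by
  have hq : Measurable fun x => N x / g x := hN.div hg
  refine (hΨ.cont.measurable.comp (hq.const_mul z)).indicator ?_
  exact (hf (measurableSet_singleton 0).compl).inter
    ((hg (measurableSet_singleton 0).compl).inter (hq.norm hs))

variable {φ : (Fin n → ℚ_[p]) → Fin n → ℚ_[p]} {j : (Fin n → ℚ_[p]) → ℚ_[p]} {y : Fin n → ℚ_[p]}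

/-- Near a point of a resolving chart the integral of the kernel of a quotient vanishes, or reduces
to a monomial integral, or to the integral of an inverse monomial. -/
theorem IsResolved.local_integral
    (hf : ∀ x, AnalyticAt ℚ_[p] f x) (hN : ∀ x, AnalyticAt ℚ_[p] N x)
    (hg : ∀ x, AnalyticAt ℚ_[p] g x) (h : IsResolved (quotControl f N g) [] φ j y) :
    ∃ (a : ℝ) (w₀ : ℚ_[p]) (δ e : Fin n → ℕ) (C : ℂ) (r₀ : ℝ), 0 < a ∧ w₀ ≠ 0 ∧ 0 < r₀ ∧
      ∀ r, 0 < r → r ≤ r₀ →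
      (∀ s ⊆ Set.Iio a, (∀ z, ∫ x in Metric.closedBall y r,
          (‖j x‖ : ℂ) * quotKernel Ψ f N g s z (φ x) = 0) ∨ (∃ k, e k ≠ 0) ∧ ∀ z,
        ∫ x in Metric.closedBall y r, (‖j x‖ : ℂ) * quotKernel Ψ f N g s z (φ x) =
        C * ∫ y, {y : Fin n → ℚ_[p] | ‖y‖ ≤ r ∧ ‖w₀ * ∏ i, y i ^ e i‖ ∈ s}.indicator
          (normMonomial δ) y * Ψ (z * (w₀ * ∏ i, y i ^ e i))) ∧
      (∀ s ⊆ Set.Ioi a, (∀ z, ∫ x in Metric.closedBall y r,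
          (‖j x‖ : ℂ) * quotKernel Ψ f N g s z (φ x) = 0) ∨ (∃ k, e k ≠ 0) ∧ ∀ z,
        ∫ x in Metric.closedBall y r, (‖j x‖ : ℂ) * quotKernel Ψ f N g s z (φ x) =
        C * ∫ y, {y : Fin n → ℚ_[p] | ‖y‖ ≤ r ∧ ‖w₀ * ∏ i, y i ^ e i‖ ∈ Inv.inv ⁻¹' s}.indicator
          (normMonomial δ) y * Ψ (z * (w₀ * ∏ i, y i ^ e i)⁻¹)) := by
  rcases h.exists_local_form hf hN hg with h0 | ⟨α, β, δ, U, V, C, hαβ, hU, hU0, hV, hV0, hloc⟩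
  · obtain ⟨r₀, hr₀, hb⟩ := Metric.nhds_basis_closedBall.eventually_iff.1 h0
    refine ⟨1, 1, 0, 0, 0, r₀, one_pos, one_ne_zero, hr₀, fun r hr hrr => ?_⟩
    have hz : ∀ s z, ∫ x in Metric.closedBall y r,
        (‖j x‖ : ℂ) * quotKernel Ψ f N g s z (φ x) = 0 := by
      intro s z
      rw [setIntegral_closedBall_translate]
      refine setIntegral_eq_zero_of_forall_eq_zero fun x hx => ?_
      rw [hb (Metric.closedBall_subset_closedBall hrr hx)]
      simp
    exact ⟨fun s _ => Or.inl (hz s), fun s _ => Or.inl (hz s)⟩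
  obtain ⟨r₁, hr₁, hb⟩ := Metric.nhds_basis_closedBall.eventually_iff.1 hloc
  have hUn := norm_pos_iff.2 hU0
  have hVn := norm_pos_iff.2 hV0
  have hker : ∀ s z x, ‖x‖ ≤ r₁ → (∀ i, x i ≠ 0) → quotKernel Ψ f N g s z (φ (y + x)) =
      {t : ℚ_[p] | ‖t‖ ∈ s}.indicator (fun t => Ψ (z * t))
        ((U x * ∏ i, x i ^ α i) / (V x * ∏ i, x i ^ β i)) := by
    intro s z x hx hxi
    obtain ⟨-, h2, -, h4, h5, h6⟩ := hb (mem_closedBall_zero_iff.2 hx)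
    rw [quotKernel_eq (h6 hxi), h2, h4]
    rw [h4]
    exact mul_ne_zero (norm_pos_iff.1 (by rw [h5]; exact hVn))
      (Finset.prod_ne_zero_iff.2 fun i _ => pow_ne_zero _ (hxi i))
  have hzero : ∀ r, r ≤ r₁ → ∀ s z, (∀ x, ‖x‖ ≤ r → (∀ i, x i ≠ 0) →
      ‖(U x * ∏ i, x i ^ α i) / (V x * ∏ i, x i ^ β i)‖ ∉ s) → ∫ x in Metric.closedBall y r,
        (‖j x‖ : ℂ) * quotKernel Ψ f N g s z (φ x) = 0 := by
    intro r hrr s z hs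
    rw [setIntegral_closedBall_translate]
    refine setIntegral_eq_zero_of_ae_eq_zero ?_
    filter_upwards [ae_coord_ne_zero] with x hxi hx
    rw [mem_closedBall_zero_iff] at hx
    rw [hker s z x (hx.trans hrr) hxi, Set.indicator_of_notMem (by exact hs x hx hxi), mul_zero]
  set a := ‖U 0‖ / ‖V 0‖ with ha
  have ha0 : 0 < a := by positivity
  have hlow : α ≤ β → ∀ x, ‖x‖ ≤ min r₁ 1 → (∀ i, x i ≠ 0) →
      a ≤ ‖(U x * ∏ i, x i ^ α i) / (V x * ∏ i, x i ^ β i)‖ := by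
    intro hle x hx hxi
    obtain ⟨-, -, h3, -, h5, -⟩ := hb (mem_closedBall_zero_iff.2 (hx.trans (min_le_left _ _)))
    have hne : ∏ i, x i ^ (β - α) i ≠ 0 :=
      Finset.prod_ne_zero_iff.2 fun i _ => pow_ne_zero _ (hxi i)
    rw [← inv_div, quotient_form hle hxi, norm_inv, norm_mul, norm_div, h3, h5, mul_inv, inv_div]
    exact le_mul_of_one_le_right ha0.le ((one_le_inv₀ (norm_pos_iff.2 hne)).2
      (norm_prod_pow_le_one (hx.trans (min_le_right _ _)) _))
  have hupp : β ≤ α → ∀ x, ‖x‖ ≤ min r₁ 1 → (∀ i, x i ≠ 0) →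
      ‖(U x * ∏ i, x i ^ α i) / (V x * ∏ i, x i ^ β i)‖ ≤ a := by
    intro hle x hx hxi
    obtain ⟨-, -, h3, -, h5, -⟩ := hb (mem_closedBall_zero_iff.2 (hx.trans (min_le_left _ _)))
    rw [quotient_form hle hxi, norm_mul, norm_div, h3, h5]
    exact mul_le_of_le_one_right ha0.le
      (norm_prod_pow_le_one (hx.trans (min_le_right _ _)) _)
  have hne_of : ∀ α β : Fin n → ℕ, α ≤ β → ¬ β ≤ α → ∃ k, (β - α) k ≠ 0 := by
    intro α β h1 h2
    by_contra! h
    exact h2 fun i => Nat.sub_eq_zero_iff_le.1 (h i)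
  by_cases h1 : α ≤ β
  · have hsmall : ∀ r, r ≤ min r₁ 1 → ∀ s ⊆ Set.Iio a, ∀ z, ∫ x in Metric.closedBall y r,
        (‖j x‖ : ℂ) * quotKernel Ψ f N g s z (φ x) = 0 := fun r hrr s hs z =>
      hzero r (hrr.trans (min_le_left _ _)) s z fun x hx hxi hxs =>
        absurd (hs hxs) (not_lt.2 (hlow h1 x (hx.trans hrr) hxi))
    by_cases h2 : β ≤ α
    · refine ⟨a, 1, 0, 0, 0, min r₁ 1, ha0, one_ne_zero, by positivity, fun r hr hrr =>
        ⟨fun s hs => Or.inl (hsmall r hrr s hs), fun s hs => Or.inl fun z => ?_⟩⟩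
      exact hzero r (hrr.trans (min_le_left _ _)) s z fun x hx hxi hxs =>
        absurd (hs hxs) (not_lt.2 (hupp h2 x (hx.trans hrr) hxi))
    · obtain ⟨k, hk⟩ := hne_of α β h1 h2
      obtain ⟨r₂, hr₂, hst⟩ := exists_integral_straighten (hV.div hU hU0)
        (div_ne_zero hV0 hU0) hk δ
      refine ⟨a, V 0 / U 0, δ, β - α, C, min (min r₁ 1) r₂, ha0, div_ne_zero hV0 hU0,
        by positivity, fun r hr hrr => ⟨fun s hs => Or.inl (hsmall r (hrr.trans (min_le_left _ _))
          s hs), fun s _ => Or.inr ⟨⟨k, hk⟩, fun z => ?_⟩⟩⟩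
      rw [setIntegral_closedBall_translate]
      refine hst r hr (hrr.trans (min_le_right _ _)) _ C (Inv.inv ⁻¹' s) (fun t => Ψ (z * t⁻¹)) ?_
      intro x hx hxi
      have hx1 : ‖x‖ ≤ r₁ := hx.trans (hrr.trans ((min_le_left _ _).trans (min_le_left _ _)))
      rw [hker s z x hx1 hxi, (hb (mem_closedBall_zero_iff.2 hx1)).1, mul_assoc, ← inv_div,
        quotient_form h1 hxi, indicator_norm_mem_inv]
      rfl
  · have h2 : β ≤ α := hαβ.resolve_left h1
    obtain ⟨k, hk⟩ := hne_of β α h2 h1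
    obtain ⟨r₂, hr₂, hst⟩ := exists_integral_straighten (hU.div hV hV0)
      (div_ne_zero hU0 hV0) hk δ
    refine ⟨a, U 0 / V 0, δ, α - β, C, min (min r₁ 1) r₂, ha0, div_ne_zero hU0 hV0,
      by positivity, fun r hr hrr => ⟨fun s _ => Or.inr ⟨⟨k, hk⟩, fun z => ?_⟩,
        fun s hs => Or.inl fun z => ?_⟩⟩
    · rw [setIntegral_closedBall_translate]
      refine hst r hr (hrr.trans (min_le_right _ _)) _ C s (fun t => Ψ (z * t)) ?_
      intro x hx hxi
      have hx1 : ‖x‖ ≤ r₁ := hx.trans (hrr.trans ((min_le_left _ _).trans (min_le_left _ _)))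
      rw [hker s z x hx1 hxi, (hb (mem_closedBall_zero_iff.2 hx1)).1, mul_assoc,
        quotient_form h2 hxi]
      simp only [Pi.div_apply]
    · have hrr' := hrr.trans (min_le_left _ _)
      exact hzero r (hrr'.trans (min_le_left _ _)) s z fun x hx hxi hxs =>
        absurd (hs hxs) (not_lt.2 (hupp h2 x (hx.trans hrr') hxi))

theorem IsStandardChar.tame_of_chartRep (hΨ : IsStandardChar Ψ)
    (hf : ∀ x, AnalyticAt ℚ_[p] f x) (hN : ∀ x, AnalyticAt ℚ_[p] N x)
    (hg : ∀ x, AnalyticAt ℚ_[p] g x) (hfm : Measurable f) (hNm : Measurable N) (hgm : Measurable g)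
    {ν : Measure (Fin n → ℚ_[p])} (hν : ChartRep (IsResolved (quotControl f N g) []) ν) :
    ∀ᶠ b in 𝓝[>] (0 : ℝ), IsTame fun z => ∫ x, quotKernel Ψ f N g (Set.Iic b) z x ∂ν := by
  refine (hν.eventually_mem (T := tameSubmodule p)
    (fun b z => hΨ.measurable_quotKernel hfm hNm hgm measurableSet_Iic z)
    (fun b z x => hΨ.norm_quotKernel_le) fun φ j y _ _ h => ?_).2
  obtain ⟨a, w₀, δ, e, C, r₀, ha, hw₀, hr₀, hloc⟩ := h.local_integral (Ψ := Ψ) hf hN hg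
  refine ⟨r₀, hr₀, fun r hr hrr => ?_⟩
  filter_upwards [Ioo_mem_nhdsGT ha] with b hb
  rcases (hloc r hr hrr).1 (Set.Iic b) (Set.Iic_subset_Iio.2 hb.2) with h | ⟨⟨k, hk⟩, h⟩
  · simp only [h]
    exact Submodule.zero_mem _
  · simp only [h]
    exact (isTame_monomialIntegral hΨ hw₀ hk hr hb.1 δ).smul C

theorem IsStandardChar.eventually_eq_zero_of_chartRep (hΨ : IsStandardChar Ψ)
    (hf : ∀ x, AnalyticAt ℚ_[p] f x) (hN : ∀ x, AnalyticAt ℚ_[p] N x)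
    (hg : ∀ x, AnalyticAt ℚ_[p] g x) (hfm : Measurable f) (hNm : Measurable N) (hgm : Measurable g)
    {ν : Measure (Fin n → ℚ_[p])} (hν : ChartRep (IsResolved (quotControl f N g) []) ν) :
    ∀ᶠ b in (atTop : Filter ℝ), ∃ R : ℝ, ∀ z, R < ‖z‖ →
      ∫ x, quotKernel Ψ f N g (Set.Ici b) z x ∂ν = 0 := by
  refine (hν.eventually_mem (T := eventuallyZeroSubmodule p)
    (fun b z => hΨ.measurable_quotKernel hfm hNm hgm measurableSet_Ici z)
    (fun b z x => hΨ.norm_quotKernel_le) fun φ j y _ _ h => ?_).2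
  obtain ⟨a, w₀, δ, e, C, r₀, ha, hw₀, hr₀, hloc⟩ := h.local_integral (Ψ := Ψ) hf hN hg
  refine ⟨r₀, hr₀, fun r hr hrr => ?_⟩
  filter_upwards [eventually_gt_atTop a] with b hb
  rcases (hloc r hr hrr).2 (Set.Ici b) (Set.Ici_subset_Ioi.2 hb) with h | ⟨⟨k, hk⟩, h⟩
  · simp only [h]
    exact Submodule.zero_mem _
  · simp only [h]
    exact (eventuallyZeroSubmodule p).smul_mem C
      (monomialInvIntegral_eventually_eq_zero hΨ hk (ha.trans hb) δ w₀ r)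

end QuotKernel

end

section

open Filter Topology MeasureTheory

section Expansion

variable {p : ℕ} [Fact p.Prime] {n : ℕ}

open MvPolynomial in
theorem MvPolynomial.not_eventually_eval_eq_zero {P : MvPolynomial (Fin n) ℚ_[p]} (hP : P ≠ 0)
    (a : Fin n → ℚ_[p]) : ¬ ∀ᶠ x in 𝓝 a, eval x P = 0 := by
  intro h
  rw [nhds_pi, Filter.Eventually, Filter.mem_pi'] at h
  obtain ⟨I, t, ht, hI⟩ := h
  refine hP (funext_set t (fun i => infinite_of_mem_nhds _ (ht i)) fun x hx => ?_)
  rw [map_zero]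
  exact hI fun i _ => hx i trivial

variable (Ψ : ℚ_[p] → ℂ)

/-- The functions that are linear combinations of tame functions with coefficients
`z ↦ Ψ (c * z)`. -/
noncomputable def charTameSubmodule : Submodule ℂ (ℚ_[p] → ℂ) :=
  ⨆ c : ℚ_[p], (tameSubmodule p).map (LinearMap.mulLeft ℂ fun z => Ψ (c * z))

variable {Ψ}

theorem IsTame.char_mul_mem {G : ℚ_[p] → ℂ} (hG : IsTame G) (c : ℚ_[p]) :
    (fun z => Ψ (c * z) * G z) ∈ charTameSubmodule Ψ :=
  Submodule.mem_iSup_of_mem c ⟨G, hG, rfl⟩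

theorem exists_sum_of_mem_charTameSubmodule {F : ℚ_[p] → ℂ} (hF : F ∈ charTameSubmodule Ψ) :
    ∃ (V : Finset ℚ_[p]) (G : ℚ_[p] → ℚ_[p] → ℂ), (∀ c, IsTame (G c)) ∧
      ∀ z, F z = ∑ c ∈ V, Ψ (c * z) * G c z := by
  obtain ⟨h, hh, rfl⟩ := (Submodule.mem_iSup_iff_exists_finsupp _ _).1 hF
  choose G hG hGh using hh
  refine ⟨h.support, G, hG, fun z => ?_⟩
  rw [Finsupp.sum, Finset.sum_apply]
  refine Finset.sum_congr rfl fun c _ => ?_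
  rw [← hGh c]
  rfl

theorem exists_expansion_of_mem_charTameSubmodule {F : ℚ_[p] → ℂ}
    (hF : F ∈ charTameSubmodule Ψ) :
    ∃ (V : Finset ℚ_[p]) (Γ : ℚ_[p] → Finset ℂ) (m : ℚ_[p] → ℂ → ℕ)
      (e : ℚ_[p] → ℂ → ℕ → ℚ_[p] → ℂ) (R : ℝ),
      0 < R ∧
      (∀ c ∈ V, ∀ γ ∈ Γ c, γ.re < 0) ∧
      (∀ c ∈ V, ∀ γ ∈ Γ c, 1 ≤ m c γ) ∧
      (∀ c γ i, IsLocallyConstant (e c γ i)) ∧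
      ∀ z : ℚ_[p], R < ‖z‖ →
        F z =
          ∑ c ∈ V, Ψ (c * z) *
            ∑ γ ∈ Γ c, ∑ i ∈ Finset.Icc 1 (m c γ),
              e c γ i (z * (p : ℚ_[p]) ^ (-z.valuation)) *
                ((‖z‖ : ℝ) : ℂ) ^ γ * ((Real.log ‖z‖ : ℝ) : ℂ) ^ (i - 1) := by
  obtain ⟨V, G, hG, hFG⟩ := exists_sum_of_mem_charTameSubmodule hF
  choose Γ m e R hm hΓ he h using fun c => (hG c).exists_expansion
  obtain ⟨M, hM⟩ := (V.image R).bddAbove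
  refine ⟨V, Γ, fun c _ => m c, e, max M 1, by positivity, fun c _ => hΓ c, fun c _ _ _ => hm c,
    he, fun z hz => ?_⟩
  rw [hFG z]
  refine Finset.sum_congr rfl fun c hc => ?_
  rw [h c z (lt_of_le_of_lt (hM (Finset.mem_coe.2 (Finset.mem_image_of_mem _ hc)))
    ((le_max_left _ _).trans_lt hz))]

theorem quotKernel_univ_eq {f g : (Fin n → ℚ_[p]) → ℚ_[p]} (hΨ : IsStandardChar Ψ) {a : ℝ}
    {ρ : ℚ_[p] → ℝ} {s : Finset ℚ_[p]}
    (hd : (s : Set ℚ_[p]).PairwiseDisjoint fun c => Metric.closedBall c (ρ c))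
    (hs : Metric.ball 0 a = ⋃ c ∈ s, Metric.closedBall c (ρ c)) (z : ℚ_[p]) (x : Fin n → ℚ_[p]) :
    quotKernel Ψ f f g Set.univ z x =
      ∑ c ∈ s, Ψ (c * z) * quotKernel Ψ f (fun x => f x - c * g x) g (Set.Iic (ρ c)) z x +
        quotKernel Ψ f f g (Set.Ici a) z x := by
  classical
  by_cases hf : f x = 0
  · simp [quotKernel, hf]
  by_cases hg : g x = 0
  · simp [quotKernel, hg]
  have hq : ∀ c, (f x - c * g x) / g x = f x / g x - c := fun c => by field_simp
  have hterm : ∀ c, Ψ (c * z) * quotKernel Ψ f (fun x => f x - c * g x) g (Set.Iic (ρ c)) z x =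
      if f x / g x ∈ Metric.closedBall c (ρ c) then Ψ (z * (f x / g x)) else 0 := by
    intro c
    rw [quotKernel_eq hf hg, hq, Set.indicator, mul_ite, mul_zero]
    refine if_congr (by simp [dist_eq_norm]) ?_ rfl
    rw [← hΨ.map_add]
    congr 1
    ring
  simp only [hterm]
  rw [quotKernel_eq hf hg, quotKernel_eq hf hg]
  by_cases ha : f x / g x ∈ Metric.ball (0 : ℚ_[p]) a
  · have h1 := ha
    rw [hs] at h1
    simp only [Set.mem_iUnion] at h1
    obtain ⟨c, hc, hxc⟩ := h1
    rw [Finset.sum_eq_single_of_mem c hc fun b hb hbc => if_neg fun h =>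
      Set.disjoint_left.1 (hd hb hc hbc) h hxc, if_pos hxc,
      Set.indicator_of_mem (by simp), Set.indicator_of_notMem (by simpa using ha), add_zero]
  · rw [Finset.sum_eq_zero fun c hc => if_neg fun h => ha
      (hs ▸ Set.mem_iUnion₂.2 ⟨c, hc, h⟩), Set.indicator_of_mem (by simp),
      Set.indicator_of_mem (by simpa using ha), zero_add]

variable [MeasureSpace ℚ_[p]] [BorelSpace ℚ_[p]] [(volume : Measure ℚ_[p]).IsAddHaarMeasure]

open MvPolynomial in
theorem chartRep_quotControl_eval {f N g : MvPolynomial (Fin n) ℚ_[p]} (hf : f ≠ 0) (hN : N ≠ 0)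
    (hg : g ≠ 0) (hNg : N - g ≠ 0) {B : Set (Fin n → ℚ_[p])} (hB : IsCompact B) (hBo : IsOpen B) :
    ChartRep (IsResolved (quotControl (eval · f) (eval · N) (eval · g)) [])
      (volume.restrict B) := by
  have hq : quotControl (eval · f) (eval · N) (eval · g) = (eval · (f * (g * (N * (N - g))))) := by
    ext x
    simp [quotControl]
  rw [hq]
  refine ChartRep.mono (ChartCov.of_local hB hBo fun a _ => resolvable p n a _ []
    (AnalyticOnNhd.eval_mvPolynomial _ a trivial) (not_eventually_eval_eq_zero ?_ a) (by simp))
    fun φ j y _ _ h => h.2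
  exact mul_ne_zero hf (mul_ne_zero hg (mul_ne_zero hN hNg))

open MvPolynomial in
theorem IsStandardChar.setIntegral_quotKernel_mem (hΨ : IsStandardChar Ψ)
    {f g : MvPolynomial (Fin n) ℚ_[p]} (hf : f ≠ 0) (hg : g ≠ 0) (hfg : ∀ c : ℚ_[p], f ≠ c • g)
    {B : Set (Fin n → ℚ_[p])} (hB : IsCompact B) (hBo : IsOpen B) :
    (fun z => ∫ x in B, quotKernel Ψ (eval · f) (eval · f) (eval · g) Set.univ z x) ∈
      charTameSubmodule Ψ := by
  have han : ∀ (P : MvPolynomial (Fin n) ℚ_[p]) x, AnalyticAt ℚ_[p] (eval · P) x := fun P x =>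
    AnalyticOnNhd.eval_mvPolynomial P x trivial
  have hm : ∀ P : MvPolynomial (Fin n) ℚ_[p], Measurable fun x : Fin n → ℚ_[p] => eval x P :=
    fun P => P.continuous_eval.measurable
  have hNe : ∀ c, (fun x : Fin n → ℚ_[p] => eval x f - c * eval x g) = (eval · (f - c • g)) :=
    fun c => by ext x; simp [smul_eval]
  have hfg1 : f - g ≠ 0 := sub_ne_zero.2 (by simpa using hfg 1)
  obtain ⟨a, haR, ha⟩ := ((hΨ.eventually_eq_zero_of_chartRep (han f) (han f) (han g) (hm f) (hm f)
    (hm g) (chartRep_quotControl_eval hf hf hg hfg1 hB hBo)).and (eventually_gt_atTop 0)).exists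
  obtain ⟨R, hR⟩ := haR
  have hρ : ∀ c : ℚ_[p], ∃ ρ : ℝ, 0 < ρ ∧ ρ < a ∧
      IsTame fun z => ∫ x in B,
        quotKernel Ψ (eval · f) (fun x => eval x f - c * eval x g) (eval · g) (Set.Iic ρ) z x := by
    intro c
    have h1 := hΨ.tame_of_chartRep (han f) (han (f - c • g)) (han g) (hm f) (hm _) (hm g)
      (chartRep_quotControl_eval hf (sub_ne_zero.2 (hfg c)) hg ?_ hB hBo)
    · obtain ⟨ρ, h2, h3⟩ := (h1.and (Ioo_mem_nhdsGT ha)).exists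
      rw [hNe]
      exact ⟨ρ, h3.1, h3.2, h2⟩
    · rw [sub_sub, sub_ne_zero]
      simpa [add_smul] using hfg (c + 1)
  choose ρ hρ0 hρa hρt using hρ
  obtain ⟨s, -, hd, hs⟩ := exists_disjoint_closedBalls (K := Metric.ball (0 : ℚ_[p]) a)
    (Metric.isCompact_of_isClosed_isBounded (IsUltrametricDist.isClosed_ball 0 a)
      Metric.isBounded_ball) (ρ := ρ) (fun c _ => hρ0 c) fun c hc => by
        rw [IsUltrametricDist.ball_eq_of_mem hc]
        exact Metric.closedBall_subset_ball (hρa c)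
  have : IsFiniteMeasure (volume.restrict B) :=
    ⟨by rw [Measure.restrict_apply_univ]; exact hB.measure_lt_top⟩
  have hintg : ∀ (P : MvPolynomial (Fin n) ℚ_[p]) (t : Set ℝ), MeasurableSet t → ∀ z,
      Integrable (quotKernel Ψ (eval · f) (eval · P) (eval · g) t z) (volume.restrict B) :=
    fun P t ht z => Integrable.of_bound
      (hΨ.measurable_quotKernel (hm f) (hm P) (hm g) ht z).aestronglyMeasurable 1
      (Eventually.of_forall fun x => hΨ.norm_quotKernel_le)
  have hsplit : (fun z => ∫ x in B,
      quotKernel Ψ (eval · f) (eval · f) (eval · g) Set.univ z x) =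
      (∑ c ∈ s, fun z => Ψ (c * z) * ∫ x in B,
        quotKernel Ψ (eval · f) (fun x => eval x f - c * eval x g) (eval · g) (Set.Iic (ρ c)) z x) +
      fun z => Ψ (0 * z) * ∫ x in B,
        quotKernel Ψ (eval · f) (eval · f) (eval · g) (Set.Ici a) z x := by
    ext z
    have h0 : Ψ 0 = 1 := by
      have h1 := hΨ.map_add 0 0
      have h2 : Ψ 0 ≠ 0 := norm_ne_zero_iff.1 (by rw [hΨ.norm_eq]; exact one_ne_zero)
      rw [add_zero] at h1
      exact (mul_eq_left₀ h2).1 h1.symm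
    simp only [Pi.add_apply, Finset.sum_apply, zero_mul, h0, one_mul, ← integral_const_mul]
    rw [← integral_finsetSum, ← integral_add]
    · exact integral_congr_ae (Eventually.of_forall fun x => quotKernel_univ_eq hΨ hd hs z x)
    · refine integrable_finsetSum _ fun c _ => Integrable.const_mul ?_ _
      rw [hNe]
      exact hintg _ _ measurableSet_Iic z
    · exact hintg _ _ measurableSet_Ici z
    · intro c _
      refine Integrable.const_mul ?_ _
      rw [hNe]
      exact hintg _ _ measurableSet_Iic z
  rw [hsplit]
  exact add_mem (sum_mem fun c _ => (hρt c).char_mul_mem c)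
    ((isTame_of_eventually_zero hR).char_mul_mem 0)

open MvPolynomial in
theorem IsStandardChar.integral_mem_charTameSubmodule (hΨ : IsStandardChar Ψ)
    {f g : MvPolynomial (Fin n) ℚ_[p]} (hf : f ≠ 0) (hg : g ≠ 0) (hfg : ∀ c : ℚ_[p], f ≠ c • g)
    {Φ : (Fin n → ℚ_[p]) → ℂ} (hΦ : IsLocallyConstant Φ) (hΦc : HasCompactSupport Φ)
    (μ : Measure (Fin n → ℚ_[p])) [μ.IsAddHaarMeasure] :
    (fun z => ∫ x in {x | eval x f = 0 ∨ eval x g = 0}ᶜ,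
      Φ x * Ψ (z * (eval x f / eval x g)) ∂μ) ∈ charTameSubmodule Ψ := by
  classical
  have hk := Measure.isAddLeftInvariant_eq_smul μ volume
  set k := Measure.addHaarScalarFactor μ volume
  obtain ⟨t, -, ht⟩ := IsCompact.elim_nhds_subcover hΦc (fun x => Φ ⁻¹' {Φ x})
    fun x _ => (hΦ.isOpen_fiber _).mem_nhds rfl
  have hB : ∀ v : ℂ, v ≠ 0 → IsCompact (Φ ⁻¹' {v}) := fun v hv =>
    IsCompact.of_isClosed_subset hΦc (hΦ.isClosed_fiber v) fun x hx =>
      subset_tsupport _ (by rw [Function.mem_support, show Φ x = v from hx]; exact hv)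
  have hBm : ∀ v : ℂ, MeasurableSet (Φ ⁻¹' {v}) := fun v => (hΦ.isOpen_fiber v).measurableSet
  have hm : ∀ P : MvPolynomial (Fin n) ℚ_[p], Measurable fun x : Fin n → ℚ_[p] => eval x P :=
    fun P => P.continuous_eval.measurable
  set S := (t.image Φ).erase 0 with hS
  have hsum : (fun z => ∫ x in {x | eval x f = 0 ∨ eval x g = 0}ᶜ,
      Φ x * Ψ (z * (eval x f / eval x g)) ∂μ) = ∑ v ∈ S, ((k : ℝ) * v : ℂ) • fun z =>
        ∫ x in Φ ⁻¹' {v}, quotKernel Ψ (eval · f) (eval · f) (eval · g) Set.univ z x := by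
    ext z
    have hD : MeasurableSet {x : Fin n → ℚ_[p] | eval x f = 0 ∨ eval x g = 0}ᶜ :=
      ((hm f (measurableSet_singleton 0)).union (hm g (measurableSet_singleton 0))).compl
    rw [hk, ← integral_indicator hD, integral_smul_nnreal_measure]
    simp only [Finset.sum_apply, Pi.smul_apply, smul_eq_mul, mul_assoc]
    rw [← Finset.mul_sum, NNReal.smul_def, Complex.real_smul]
    congr 1
    simp_rw [fun v => (integral_indicator (f := quotKernel Ψ (eval · f) (eval · f) (eval · g)
      Set.univ z) (μ := volume) (hBm v)).symm, ← integral_const_mul]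
    rw [← integral_finsetSum]
    · refine integral_congr_ae (Eventually.of_forall fun x => ?_)
      have hK : ({x : Fin n → ℚ_[p] | eval x f = 0 ∨ eval x g = 0}ᶜ).indicator
          (fun x => Φ x * Ψ (z * (eval x f / eval x g))) x =
          Φ x * quotKernel Ψ (eval · f) (eval · f) (eval · g) Set.univ z x := by
        simp [quotKernel, Set.indicator]
      rw [hK]
      beta_reduce
      by_cases hx : Φ x = 0
      · rw [hx, zero_mul, Finset.sum_eq_zero fun v hv => ?_]
        rw [Set.indicator_of_notMem, mul_zero]
        exact fun h => (Finset.mem_erase.1 hv).1 ((show Φ x = v from h).symm.trans hx)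
      · have hxS : Φ x ∈ S := by
          obtain ⟨y, hy, hxy⟩ := Set.mem_iUnion₂.1 (ht (subset_tsupport _ hx))
          exact Finset.mem_erase.2 ⟨hx, Finset.mem_image.2 ⟨y, hy, hxy.symm⟩⟩
        rw [Finset.sum_eq_single_of_mem _ hxS, Set.indicator_of_mem (by exact rfl)]
        intro v _ hv
        rw [Set.indicator_of_notMem (by exact fun h => hv (show Φ x = v from h).symm), mul_zero]
    · intro v hv
      refine Integrable.const_mul ?_ _
      rw [integrable_indicator_iff (hBm v)]
      exact Measure.integrableOn_of_bounded (hB v (Finset.mem_erase.1 hv).1).measure_lt_top.ne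
        (hΨ.measurable_quotKernel (hm f) (hm f) (hm g) MeasurableSet.univ z).aestronglyMeasurable
        (Eventually.of_forall fun x => hΨ.norm_quotKernel_le)
  rw [hsum]
  exact sum_mem fun v hv => Submodule.smul_mem _ _ (hΨ.setIntegral_quotKernel_mem hf hg hfg
    (hB v (Finset.mem_erase.1 hv).1) (hΦ.isOpen_fiber v))

end Expansion

end

open MeasureTheory Complex MvPolynomial

/-- Expansion of the `p`-adic oscillatory integral `E_Φ(z; f/g)` for large `|z|_p`:
a finite sum, over special values `c`, of terms
`Ψ(cz)·e_{γ,m,c}(ac z)·|z|_p^γ·(ln|z|_p)^{m−1}` with `Re γ < 0`. -/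
theorem padic_oscillatory_integral_expansion_large_z
    (p : ℕ) [Fact p.Prime] (n : ℕ)
    [MeasurableSpace (Fin n → ℚ_[p])] [BorelSpace (Fin n → ℚ_[p])]
    (μ : Measure (Fin n → ℚ_[p])) [μ.IsAddHaarMeasure]
    (hμ : μ (Set.univ.pi fun _ : Fin n => {x : ℚ_[p] | ‖x‖ ≤ 1}) = 1)
    (f g : MvPolynomial (Fin n) ℚ_[p]) (hf : f ≠ 0) (hg : g ≠ 0)
    (hfg : ∀ c : ℚ_[p], f ≠ c • g)
    (Φ : (Fin n → ℚ_[p]) → ℂ) (hΦlc : IsLocallyConstant Φ) (hΦc : HasCompactSupport Φ)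
    (Ψ : ℚ_[p] → ℂ)
    (hΨadd : ∀ a b : ℚ_[p], Ψ (a + b) = Ψ a * Ψ b)
    (hΨcont : Continuous Ψ) (hΨnorm : ∀ x : ℚ_[p], ‖Ψ x‖ = 1)
    (hΨtriv : ∀ x : ℚ_[p], ‖x‖ ≤ 1 → Ψ x = 1)
    (hΨnontriv : ∃ x : ℚ_[p], ‖x‖ ≤ p ∧ Ψ x ≠ 1)
    (D : Set (Fin n → ℚ_[p]))
    (hD : D = {x | eval x f = 0 ∨ eval x g = 0})
    (E : ℚ_[p] → ℂ)
    (hE : ∀ z : ℚ_[p], E z =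
      ∫ x in Dᶜ, Φ x * Ψ (z * (eval x f / eval x g)) ∂μ) :
    ∃ (V : Finset ℚ_[p]) (Γ : ℚ_[p] → Finset ℂ) (m : ℚ_[p] → ℂ → ℕ)
      (e : ℚ_[p] → ℂ → ℕ → ℚ_[p] → ℂ) (R : ℝ),
      0 < R ∧
      (∀ c ∈ V, ∀ γ ∈ Γ c, γ.re < 0) ∧
      (∀ c ∈ V, ∀ γ ∈ Γ c, 1 ≤ m c γ) ∧
      (∀ c γ i, IsLocallyConstant (e c γ i)) ∧
      ∀ z : ℚ_[p], R < ‖z‖ →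
        E z =
          ∑ c ∈ V, Ψ (c * z) *
            ∑ γ ∈ Γ c, ∑ i ∈ Finset.Icc 1 (m c γ),
              e c γ i (z * (p : ℚ_[p]) ^ (-z.valuation)) *
                ((‖z‖ : ℝ) : ℂ) ^ γ * ((Real.log ‖z‖ : ℝ) : ℂ) ^ (i - 1) := by
  rename_i m₀ hm₀ _
  let _ : MeasurableSpace ℚ_[p] := borel ℚ_[p]
  have : BorelSpace ℚ_[p] := ⟨rfl⟩
  let _ : MeasureSpace ℚ_[p] := ⟨Measure.addHaar⟩
  have : (volume : Measure ℚ_[p]).IsAddHaarMeasure :=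
    inferInstanceAs (Measure.addHaar : Measure ℚ_[p]).IsAddHaarMeasure
  obtain rfl : m₀ = MeasurableSpace.pi :=
    hm₀.measurable_eq.trans (@BorelSpace.measurable_eq _ _ MeasurableSpace.pi _).symm
  subst hD
  have hΨ : IsStandardChar Ψ := ⟨hΨadd, hΨcont, hΨnorm, hΨnontriv⟩
  rw [funext hE]
  exact exists_expansion_of_mem_charTameSubmodule
    (hΨ.integral_mem_charTameSubmodule hf hg hfg hΦlc hΦc μ)
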